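/- Nonlinear asymptotic stability of the critical pulled front with algebraic rate t^{-3/2}: There exist constants C > 0 and ε > 0 such that the following holds. Let T ∈ (0, ∞] and let (u, v) : [0,T) × ℝ → ℝ² be a bounded classical solution (C¹ in t, C² in x) of u_t = u_xx + c*·u_x + u(1 − u − a v), v_t = σ v_xx + c*·v_x + r v(1 − b u − v), whose initial datum is (u(0,·), v(0,·)) = (U*, V*) + (u₀, v₀) with 0 ≤ u(0,x) ≤ 1 and 0 ≤ v(0,x) ≤ 1 for all x ∈ ℝ. If (p₀, q₀) := (u₀/ω, v₀/ω) satisfies sup_ℝ(|p₀| + |q₀|) + ∫_ℝ (1 + |y|)(|p₀(y)| + |q₀(y)|) dy < ε, then for all t ∈ (0, T) and all x ∈ ℝ one has (1 + |x|)^{-1}(|p(t,x)| + |q(t,x)|) ≤ C ε (1 + t)^{-3/2}, where p(t,x) = (u(t,x) − U*(x))/ω(x) and q(t,x) = (v(t,x) − V*(x))/ω(x). -/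

import Mathlib

section
open MeasureTheory Filter Set Topology
open Real (exp exp_pos sqrt_pos exp_add sqrt exp_le_exp cosh cosh_pos exp_le_one_iff one_le_exp add_one_le_exp sq_sqrt norm_of_nonneg exp_zero)
lemma mnl {a b c : ℝ} (h : b ≤ c) (ha : 0 ≤ a) : a * b ≤ a * c := mul_le_mul_of_nonneg_left h ha
lemma mnr {a b c : ℝ} (h : b ≤ c) (ha : 0 ≤ a) : b * a ≤ c * a := mul_le_mul_of_nonneg_right h ha
def RC (u : ℝ → ℝ → ℝ) (T s x : ℝ) : Prop :=
  ContinuousWithinAt (fun p : ℝ × ℝ => u p.1 p.2) (Icc s T ×ˢ univ) (s, x)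

lemma RC.mono {u : ℝ → ℝ → ℝ} {T T' s x : ℝ} (h : RC u T s x) (hT : T' ≤ T) : RC u T' s x :=
  ContinuousWithinAt.mono h (prod_mono (Icc_subset_Icc le_rfl hT) le_rfl)

lemma touch_main {z : ℝ → ℝ → ℝ} {t0 t1 l r : ℝ}
    (hRC : ∀ t ∈ Icc t0 t1, ∀ x ∈ Icc l r, RC z t1 t x)
    (hcont : ∀ x, ContinuousOn (fun t => z t x) (Icc t0 t1))
    (hinit : ∀ x, z t0 x < 0)
    (hout : ∀ t ∈ Icc t0 t1, ∀ x, x ∉ Ioo l r → z t x < 0)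
    (hno : ∀ t ∈ Ioc t0 t1, ∀ x ∈ Ioo l r, z t x = 0 → (∀ y, z t y ≤ 0) →
      (∀ s ∈ Ico t0 t, ∀ y, z s y < 0) → False) :
    ∀ t ∈ Icc t0 t1, ∀ x, z t x < 0 := by
  by_contra hcon
  push Not at hcon
  obtain ⟨tb, htb, xb, hxb⟩ := hcon
  set S : Set ℝ := {t | t ∈ Icc t0 t1 ∧ ∃ x, 0 ≤ z t x} with hS
  have hSne : S.Nonempty := ⟨tb, htb, xb, hxb⟩
  have hSb : BddBelow S := ⟨t0, fun t ht => ht.1.1⟩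
  obtain ⟨τ, -, hτ, hτS⟩ := exists_seq_tendsto_sInf hSne hSb
  set ts := sInf S with hts
  have hle : ∀ n, ts ≤ τ n := fun n => csInf_le hSb (hτS n)
  choose hI xs hxs using hτS
  have hxI : ∀ n, xs n ∈ Ioo l r := by
    intro n
    by_contra h
    exact absurd (hxs n) (not_le.2 (hout _ (hI n) _ h))
  have htsI : ts ∈ Icc t0 t1 :=
    ⟨le_csInf hSne fun t ht => ht.1.1, (hle 0).trans (hI 0).2⟩
  obtain ⟨x, hx, φ, hφ, hlim⟩ := isCompact_Icc.tendsto_subseq (fun n => Ioo_subset_Icc_self (hxI n))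
  have h0 : 0 ≤ z ts x := by
    have h1 : Tendsto (fun n => (τ (φ n), xs (φ n))) atTop (𝓝[Icc ts t1 ×ˢ univ] (ts, x)) := by
      apply tendsto_nhdsWithin_iff.2
      refine ⟨(hτ.comp hφ.tendsto_atTop).prodMk_nhds hlim, Eventually.of_forall fun n => ?_⟩
      exact ⟨⟨hle _, (hI _).2⟩, mem_univ _⟩
    have h2 := (hRC ts htsI x hx).tendsto.comp h1
    exact ge_of_tendsto' h2 fun n => hxs _
  have hbefore : ∀ s ∈ Ico t0 ts, ∀ y, z s y < 0 := by
    intro s hs y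
    by_contra h
    exact absurd (csInf_le hSb (⟨⟨hs.1, hs.2.le.trans htsI.2⟩, y, not_lt.1 h⟩ : s ∈ S)) (not_le.2 hs.2)
  have hgt : t0 < ts := by
    rcases htsI.1.lt_or_eq with h | h
    · exact h
    · exact absurd (hinit x) (not_lt.2 (by rw [h]; exact h0))
  have hall : ∀ y, z ts y ≤ 0 := by
    intro y
    have h1 : ContinuousWithinAt (fun t => z t y) (Ico t0 ts) ts :=
      ((hcont y) ts htsI).mono (fun s hs => ⟨hs.1, hs.2.le.trans htsI.2⟩)
    have h2 : (𝓝[Ico t0 ts] ts).NeBot := by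
      rw [← mem_closure_iff_nhdsWithin_neBot, closure_Ico hgt.ne]
      exact ⟨hgt.le, le_rfl⟩
    refine le_of_tendsto h1.tendsto ?_
    filter_upwards [self_mem_nhdsWithin] with s hs using (hbefore s hs y).le
  have hxIoo : x ∈ Ioo l r := by
    by_contra h
    exact absurd h0 (not_le.2 (hout _ htsI _ h))
  exact hno ts ⟨hgt, htsI.2⟩ x hxIoo (le_antisymm (hall x) h0) hall hbefore

lemma touch_t {f : ℝ → ℝ} {f' t : ℝ} (hf : HasDerivAt f f' t) (h0 : f t = 0)
    (hle : ∀ᶠ s in 𝓝[<] t, f s ≤ 0) : 0 ≤ f' := by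
  have h := (hasDerivAt_iff_tendsto_slope_left_right.1 hf).1
  refine ge_of_tendsto h ?_
  filter_upwards [hle, self_mem_nhdsWithin] with s hs hst
  rw [slope_def_field, h0]
  have : s - t < 0 := sub_neg.2 hst
  exact div_nonneg_of_nonpos (by linarith) this.le

lemma touch_x {D D1 : ℝ → ℝ} {d2 x : ℝ} (h1 : ∀ᶠ y in 𝓝 x, HasDerivAt D (D1 y) y)
    (h2 : HasDerivAt D1 d2 x) (hmax : ∀ᶠ y in 𝓝 x, D y ≤ D x) : D1 x = 0 ∧ d2 ≤ 0 := by
  have hx : HasDerivAt D (D1 x) x := h1.self_of_nhds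
  have hm : IsLocalMax D x := hmax
  have e0 : D1 x = 0 := hm.hasDerivAt_eq_zero hx
  refine ⟨e0, ?_⟩
  by_contra hpos
  push Not at hpos
  have he : deriv D =ᶠ[𝓝 x] D1 := h1.mono fun y hy => hy.deriv
  have hdd : deriv (deriv D) x = d2 := by rw [he.deriv_eq]; exact h2.deriv
  have hmin : IsLocalMin D x :=
    isLocalMin_of_deriv_deriv_pos (by rw [hdd]; exact hpos) (by rw [he.self_of_nhds, e0]) hx.continuousAt
  have hc : D =ᶠ[𝓝 x] fun _ => D x := by
    filter_upwards [hmax, hmin] with y a b using le_antisymm a b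
  have : deriv (deriv D) x = 0 := by
    have h3 : deriv D =ᶠ[𝓝 x] deriv (fun _ => D x) := hc.deriv
    rw [h3.deriv_eq]; simp
  linarith

set_option linter.unusedVariables false

noncomputable def gk (τ z : ℝ) : ℝ := (sqrt (4 * Real.pi * τ))⁻¹ * exp (-z ^ 2 / (4 * τ))
noncomputable def gk1 (τ z : ℝ) : ℝ := -z / (2 * τ) * gk τ z
noncomputable def gk2 (τ z : ℝ) : ℝ := (z ^ 2 / (4 * τ ^ 2) - 1 / (2 * τ)) * gk τ z

lemma gk_pos {τ : ℝ} (hτ : 0 < τ) (z : ℝ) : 0 < gk τ z := by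
  unfold gk; have := Real.pi_pos; positivity

lemma gk_deriv_z {τ : ℝ} (hτ : 0 < τ) (z : ℝ) : HasDerivAt (fun z => gk τ z) (gk1 τ z) z := by
  unfold gk1 gk
  have h : HasDerivAt (fun z : ℝ => -z ^ 2 / (4 * τ)) (-(2 * z) / (4 * τ)) z := by
    have := ((hasDerivAt_pow 2 z).neg).div_const (4 * τ)
    simpa using this
  have h2 := (h.exp).const_mul ((sqrt (4 * Real.pi * τ))⁻¹)
  refine h2.congr_deriv ?_
  field_simp
  ring

lemma gk1_deriv_z {τ : ℝ} (hτ : 0 < τ) (z : ℝ) : HasDerivAt (fun z => gk1 τ z) (gk2 τ z) z := by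
  have h : HasDerivAt (fun z : ℝ => -z / (2 * τ)) (-1 / (2 * τ)) z := by
    have := ((hasDerivAt_id z).neg).div_const (2 * τ)
    simpa using this
  have h2 := h.mul (gk_deriv_z hτ z)
  refine h2.congr_deriv ?_
  unfold gk2 gk1
  field_simp
  ring

lemma gk_deriv_t {τ : ℝ} (hτ : 0 < τ) (z : ℝ) : HasDerivAt (fun τ => gk τ z) (gk2 τ z) τ := by
  have hp := Real.pi_pos
  have hpos : 0 < 4 * Real.pi * τ := by positivity
  have hs : 0 < sqrt (4 * Real.pi * τ) := sqrt_pos.2 hpos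
  have h1 : HasDerivAt (fun τ : ℝ => 4 * Real.pi * τ) (4 * Real.pi) τ := by
    simpa using (hasDerivAt_id τ).const_mul (4 * Real.pi)
  have h2 := (h1.sqrt hpos.ne').inv hs.ne'
  have h3 : HasDerivAt (fun τ : ℝ => -z ^ 2 / (4 * τ)) (z ^ 2 / (4 * τ ^ 2)) τ := by
    have h4 : HasDerivAt (fun τ : ℝ => 4 * τ) 4 τ := by
      simpa using (hasDerivAt_id τ).const_mul (4:ℝ)
    have := (hasDerivAt_const τ (-z ^ 2)).div h4 (by positivity)
    refine this.congr_deriv ?_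
    field_simp
    ring
  have h5 := h2.mul h3.exp
  refine h5.congr_deriv ?_
  unfold gk2 gk
  have hsq : sqrt (4 * Real.pi * τ) ^ 2 = 4 * Real.pi * τ := sq_sqrt hpos.le
  simp only [Pi.inv_apply]
  have e1 : -(4 * Real.pi / (2 * sqrt (4 * Real.pi * τ))) / sqrt (4 * Real.pi * τ) ^ 2
      = -(1 / (2 * τ)) * (sqrt (4 * Real.pi * τ))⁻¹ := by
    rw [hsq]; field_simp
  rw [e1]; ring

lemma gk_cont : ContinuousOn (fun p : ℝ × ℝ => gk p.1 p.2) {p | 0 < p.1} := by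
  unfold gk
  have hp := Real.pi_pos
  apply ContinuousOn.mul
  · apply ContinuousOn.inv₀
    · fun_prop
    · intro p hp'
      have : (0:ℝ) < 4 * Real.pi * p.1 := mul_pos (by positivity) hp'
      exact (sqrt_pos.2 this).ne'
  · apply ContinuousOn.rexp
    apply ContinuousOn.div
    · fun_prop
    · fun_prop
    · intro p hp'
      have : (0:ℝ) < 4 * p.1 := mul_pos (by norm_num) hp'
      exact this.ne'

lemma gk1_cont : ContinuousOn (fun p : ℝ × ℝ => gk1 p.1 p.2) {p | 0 < p.1} := by
  unfold gk1
  apply ContinuousOn.mul _ gk_cont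
  apply ContinuousOn.div
  · fun_prop
  · fun_prop
  · intro p hp'
    have : (0:ℝ) < 2 * p.1 := mul_pos (by norm_num) hp'
    exact this.ne'

lemma gk2_cont : ContinuousOn (fun p : ℝ × ℝ => gk2 p.1 p.2) {p | 0 < p.1} := by
  unfold gk2
  apply ContinuousOn.mul _ gk_cont
  apply ContinuousOn.sub
  · apply ContinuousOn.div
    · fun_prop
    · fun_prop
    · intro p hp'
      have : (0:ℝ) < 4 * p.1 ^ 2 := mul_pos (by norm_num) (pow_pos hp' 2)
      exact this.ne'
  · apply ContinuousOn.div
    · fun_prop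
    · fun_prop
    · intro p hp'
      have : (0:ℝ) < 2 * p.1 := mul_pos (by norm_num) hp'
      exact this.ne'

lemma gk_le {τ : ℝ} (hτ : 0 < τ) (z : ℝ) : gk τ z ≤ (sqrt (4 * Real.pi * τ))⁻¹ := by
  unfold gk
  have : exp (-z ^ 2 / (4 * τ)) ≤ 1 := by
    apply exp_le_one_iff.2
    apply div_nonpos_of_nonpos_of_nonneg <;> nlinarith [sq_nonneg z]
  have h : 0 ≤ (sqrt (4 * Real.pi * τ))⁻¹ := by positivity
  nlinarith

lemma sqrt4pi_inv_le {α τ : ℝ} (hα : 0 < α) (h : α ≤ τ) :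
    (sqrt (4 * Real.pi * τ))⁻¹ ≤ (sqrt α)⁻¹ := by
  have hp := Real.pi_gt_three
  apply inv_anti₀ (sqrt_pos.2 hα)
  apply Real.sqrt_le_sqrt
  nlinarith

lemma gk_le' {α τ : ℝ} (hα : 0 < α) (h : α ≤ τ) (z : ℝ) : gk τ z ≤ (sqrt α)⁻¹ :=
  (gk_le (hα.trans_le h) z).trans (sqrt4pi_inv_le hα h)

lemma exp_w_bound (w : ℝ) : w * exp (-w) ≤ 1 := by
  have h := add_one_le_exp w
  have h2 := exp_pos (-w)
  have h3 : exp w * exp (-w) = 1 := by rw [← exp_add]; simp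
  nlinarith

lemma gk_w {τ : ℝ} (hτ : 0 < τ) (z : ℝ) :
    z ^ 2 / (4 * τ) * gk τ z ≤ (sqrt (4 * Real.pi * τ))⁻¹ := by
  unfold gk
  have h := exp_w_bound (z ^ 2 / (4 * τ))
  have h1 : 0 ≤ (sqrt (4 * Real.pi * τ))⁻¹ := by positivity
  rw [neg_div]
  nlinarith

lemma gk2_bdd {α τ : ℝ} (hα : 0 < α) (h : α ≤ τ) (z : ℝ) :
    |gk2 τ z| ≤ 2 / α * (sqrt α)⁻¹ := by
  have hτ := hα.trans_le h
  have h1 := gk_w hτ z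
  have h2 := gk_le hτ z
  have h3 := sqrt4pi_inv_le hα h
  have h4 := gk_pos hτ z
  set G := (sqrt (4 * Real.pi * τ))⁻¹
  have e : gk2 τ z = (1 / τ) * (z ^ 2 / (4 * τ) * gk τ z - 1 / 2 * gk τ z) := by
    unfold gk2; field_simp
  have h5 : 0 ≤ z ^ 2 / (4 * τ) * gk τ z := by positivity
  have h6 : |z ^ 2 / (4 * τ) * gk τ z - 1 / 2 * gk τ z| ≤ 2 * (sqrt α)⁻¹ := by
    rw [abs_le]; constructor <;> linarith
  rw [e, abs_mul, abs_of_pos (by positivity : 0 < 1 / τ)]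
  have h7 : 1 / τ ≤ 1 / α := one_div_le_one_div_of_le hα h
  calc 1 / τ * _ ≤ 1 / α * (2 * (sqrt α)⁻¹) := by gcongr
    _ = _ := by ring

lemma gk1_bdd {α τ : ℝ} (hα : 0 < α) (h : α ≤ τ) (z : ℝ) :
    |gk1 τ z| ≤ (1 + 1 / α) * (sqrt α)⁻¹ := by
  have hτ := hα.trans_le h
  have h1 := gk_w hτ z
  have h2 := gk_le hτ z
  have h3 := sqrt4pi_inv_le hα h
  have h4 := gk_pos hτ z
  have h7 : 1 / τ ≤ 1 / α := one_div_le_one_div_of_le hα h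
  have e : |gk1 τ z| = |z| / (2 * τ) * gk τ z := by
    unfold gk1
    rw [abs_mul, abs_of_pos h4, abs_div, abs_neg, abs_of_pos (by positivity : 0 < 2 * τ)]
  have h8 : |z| / (2 * τ) ≤ (1 / τ) * (z ^ 2 / (4 * τ)) + 1 := by
    have : (1 / τ) * (z ^ 2 / (4 * τ)) = (|z| / (2 * τ)) ^ 2 := by
      rw [← sq_abs z]; field_simp; ring
    rw [this]; nlinarith [sq_nonneg (|z| / (2 * τ) - 1 / 2)]
  rw [e]
  calc |z| / (2 * τ) * gk τ z ≤ ((1 / τ) * (z ^ 2 / (4 * τ)) + 1) * gk τ z := by gcongr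
    _ = (1 / τ) * (z ^ 2 / (4 * τ) * gk τ z) + gk τ z := by ring
    _ ≤ (1 / α) * (sqrt α)⁻¹ + (sqrt α)⁻¹ := by
        have : 0 ≤ z ^ 2 / (4 * τ) * gk τ z := by positivity
        gcongr
        · linarith
        · linarith
    _ = _ := by ring

structure KB (K : ℝ → ℝ → ℝ) : Prop where
  cont : ContinuousOn (fun p : ℝ × ℝ => K p.1 p.2) {p | 0 < p.1}
  bdd : ∀ α > 0, ∃ C, ∀ τ ≥ α, ∀ z, |K τ z| ≤ C

lemma KB_gk : KB gk := ⟨gk_cont, fun α hα => ⟨_, fun τ hτ z => by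
  rw [abs_of_pos (gk_pos (hα.trans_le hτ) z)]; exact gk_le' hα hτ z⟩⟩
lemma KB_gk1 : KB gk1 := ⟨gk1_cont, fun α hα => ⟨_, fun τ hτ z => gk1_bdd hα hτ z⟩⟩
lemma KB_gk2 : KB gk2 := ⟨gk2_cont, fun α hα => ⟨_, fun τ hτ z => gk2_bdd hα hτ z⟩⟩

noncomputable def HmK (K : ℝ → ℝ → ℝ) (n Y : ℝ → ℝ) (τ x : ℝ) : ℝ := ∫ y, n y * K τ (x - Y y)

lemma HmK_aesm {K : ℝ → ℝ → ℝ} (hK : KB K) {n Y : ℝ → ℝ} (hn : Integrable n) (hY : Continuous Y)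
    {τ : ℝ} (hτ : 0 < τ) (x : ℝ) : AEStronglyMeasurable (fun y => n y * K τ (x - Y y)) := by
  apply hn.aestronglyMeasurable.mul
  have : Continuous (fun y => K τ (x - Y y)) := by
    have h := hK.cont.comp_continuous (f := fun y => (τ, x - Y y)) (by fun_prop) (fun y => hτ)
    exact h
  exact this.aestronglyMeasurable

lemma HmK_integrable {K : ℝ → ℝ → ℝ} (hK : KB K) {n Y : ℝ → ℝ} (hn : Integrable n)
    (hY : Continuous Y) {τ : ℝ} (hτ : 0 < τ) (x : ℝ) : Integrable (fun y => n y * K τ (x - Y y)) := by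
  obtain ⟨C, hC⟩ := hK.bdd τ hτ
  refine (hn.norm.mul_const C).mono' (HmK_aesm hK hn hY hτ x) (Eventually.of_forall fun y => ?_)
  rw [norm_mul]
  gcongr
  exact hC τ le_rfl _

lemma HmK_contAt {K : ℝ → ℝ → ℝ} (hK : KB K) {n Y : ℝ → ℝ} (hn : Integrable n)
    (hY : Continuous Y) {τ : ℝ} (hτ : 0 < τ) (x : ℝ) :
    ContinuousAt (fun p : ℝ × ℝ => HmK K n Y p.1 p.2) (τ, x) := by
  unfold HmK
  obtain ⟨C, hC⟩ := hK.bdd (τ / 2) (by positivity)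
  have hnb : ∀ᶠ p : ℝ × ℝ in 𝓝 (τ, x), τ / 2 < p.1 :=
    (continuous_fst.tendsto (τ, x)).eventually (lt_mem_nhds (by simpa using half_lt_self hτ))
  refine continuousAt_of_dominated (bound := fun y => ‖n y‖ * C) ?_ ?_ (hn.norm.mul_const C) ?_
  · filter_upwards [hnb] with p hp
    exact HmK_aesm hK hn hY (by linarith) p.2
  · filter_upwards [hnb] with p hp
    refine Eventually.of_forall fun y => ?_
    rw [norm_mul]; gcongr
    exact hC _ hp.le _
  · refine Eventually.of_forall fun y => ?_
    apply ContinuousAt.mul continuousAt_const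
    have h1 : ContinuousAt (fun p : ℝ × ℝ => K p.1 p.2) (τ, x - Y y) :=
      hK.cont.continuousAt ((isOpen_lt continuous_const continuous_fst).mem_nhds hτ)
    exact ContinuousAt.comp (f := fun p : ℝ × ℝ => (p.1, p.2 - Y y)) (x := (τ, x)) h1 (by fun_prop)

lemma HmK_deriv_x {K K' : ℝ → ℝ → ℝ} (hK : KB K) (hK' : KB K')
    (hd : ∀ τ > 0, ∀ z, HasDerivAt (fun z => K τ z) (K' τ z) z) {n Y : ℝ → ℝ} (hn : Integrable n)
    (hY : Continuous Y) {τ : ℝ} (hτ : 0 < τ) (x : ℝ) :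
    HasDerivAt (fun x => HmK K n Y τ x) (HmK K' n Y τ x) x := by
  unfold HmK
  obtain ⟨C, hC⟩ := hK'.bdd τ hτ
  refine (hasDerivAt_integral_of_dominated_loc_of_deriv_le (bound := fun y => ‖n y‖ * C)
    (F := fun x y => n y * K τ (x - Y y)) (F' := fun x y => n y * K' τ (x - Y y))
    (s := univ) univ_mem ?_ (HmK_integrable hK hn hY hτ x) (HmK_aesm hK' hn hY hτ x) ?_
    (hn.norm.mul_const C) ?_).2
  · exact Eventually.of_forall fun x => HmK_aesm hK hn hY hτ x
  · refine Eventually.of_forall fun y x _ => ?_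
    rw [norm_mul]; gcongr
    exact hC _ le_rfl _
  · refine Eventually.of_forall fun y x _ => ?_
    apply HasDerivAt.const_mul
    exact (hd τ hτ (x - Y y)).comp_sub_const x (Y y)

lemma HmK_deriv_t {K K' : ℝ → ℝ → ℝ} (hK : KB K) (hK' : KB K')
    (hd : ∀ τ > 0, ∀ z, HasDerivAt (fun τ => K τ z) (K' τ z) τ) {n Y : ℝ → ℝ} (hn : Integrable n)
    (hY : Continuous Y) {τ : ℝ} (hτ : 0 < τ) (x : ℝ) :
    HasDerivAt (fun τ => HmK K n Y τ x) (HmK K' n Y τ x) τ := by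
  unfold HmK
  obtain ⟨C, hC⟩ := hK'.bdd (τ / 2) (by positivity)
  refine (hasDerivAt_integral_of_dominated_loc_of_deriv_le (bound := fun y => ‖n y‖ * C)
    (F := fun τ y => n y * K τ (x - Y y)) (F' := fun τ y => n y * K' τ (x - Y y))
    (s := Ioi (τ / 2)) (Ioi_mem_nhds (half_lt_self hτ)) ?_ (HmK_integrable hK hn hY hτ x)
    (HmK_aesm hK' hn hY hτ x) ?_ (hn.norm.mul_const C) ?_).2
  · filter_upwards [Ioi_mem_nhds (half_lt_self hτ)] with s hs
    have hs' : τ / 2 < s := hs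
    exact HmK_aesm hK hn hY (by linarith) x
  · refine Eventually.of_forall fun y s hs => ?_
    rw [norm_mul]; gcongr
    exact hC _ (le_of_lt hs) _
  · refine Eventually.of_forall fun y s hs => ?_
    have hs' : τ / 2 < s := hs
    exact (hd s (by linarith) _).const_mul _

lemma Hm_dx {n Y : ℝ → ℝ} (hn : Integrable n) (hY : Continuous Y) {τ : ℝ} (hτ : 0 < τ) (x : ℝ) :
    HasDerivAt (fun x => HmK gk n Y τ x) (HmK gk1 n Y τ x) x :=
  HmK_deriv_x KB_gk KB_gk1 (fun _ h z => gk_deriv_z h z) hn hY hτ x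
lemma Hm_dxx {n Y : ℝ → ℝ} (hn : Integrable n) (hY : Continuous Y) {τ : ℝ} (hτ : 0 < τ) (x : ℝ) :
    HasDerivAt (fun x => HmK gk1 n Y τ x) (HmK gk2 n Y τ x) x :=
  HmK_deriv_x KB_gk1 KB_gk2 (fun _ h z => gk1_deriv_z h z) hn hY hτ x
lemma Hm_dt {n Y : ℝ → ℝ} (hn : Integrable n) (hY : Continuous Y) {τ : ℝ} (hτ : 0 < τ) (x : ℝ) :
    HasDerivAt (fun τ => HmK gk n Y τ x) (HmK gk2 n Y τ x) τ :=
  HmK_deriv_t KB_gk KB_gk2 (fun _ h z => gk_deriv_t h z) hn hY hτ x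

lemma Hm_nonneg {n Y : ℝ → ℝ} (hn0 : ∀ y, 0 ≤ n y) {τ : ℝ} (hτ : 0 < τ) (x : ℝ) :
    0 ≤ HmK gk n Y τ x :=
  integral_nonneg fun y => mul_nonneg (hn0 y) (gk_pos hτ _).le

lemma Hm_gk2_ge {n Y : ℝ → ℝ} (hn : Integrable n) (hY : Continuous Y) (hn0 : ∀ y, 0 ≤ n y)
    {τ : ℝ} (hτ : 0 < τ) (x : ℝ) :
    -(1 / (2 * τ)) * HmK gk n Y τ x ≤ HmK gk2 n Y τ x := by
  unfold HmK
  rw [← integral_const_mul]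
  refine integral_mono ((HmK_integrable KB_gk hn hY hτ x).const_mul _)
    (HmK_integrable KB_gk2 hn hY hτ x) fun y => ?_
  have h1 := gk_pos hτ (x - Y y)
  have h2 : 0 ≤ (x - Y y) ^ 2 / (4 * τ ^ 2) * gk τ (x - Y y) := by positivity
  have h3 := mul_nonneg (hn0 y) h2
  simp only [gk2]
  nlinarith

lemma gk_mono {τ τ' : ℝ} (hτ : 0 < τ) (h : τ ≤ τ') (z : ℝ) :
    gk τ z ≤ sqrt (τ' / τ) * gk τ' z := by
  have hτ' := hτ.trans_le h
  have hp := Real.pi_pos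
  unfold gk
  have e : sqrt (τ' / τ) * (sqrt (4 * Real.pi * τ'))⁻¹ = (sqrt (4 * Real.pi * τ))⁻¹ := by
    rw [← Real.sqrt_inv, ← Real.sqrt_mul (by positivity), ← Real.sqrt_inv]
    congr 1
    field_simp
  rw [← mul_assoc, e]
  rw [neg_div, neg_div]
  gcongr

lemma Hm_mono {n Y : ℝ → ℝ} (hn : Integrable n) (hY : Continuous Y) (hn0 : ∀ y, 0 ≤ n y)
    {τ τ' : ℝ} (hτ : 0 < τ) (h : τ ≤ τ') (x : ℝ) :
    HmK gk n Y τ x ≤ sqrt (τ' / τ) * HmK gk n Y τ' x := by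
  unfold HmK
  rw [← integral_const_mul]
  refine integral_mono (HmK_integrable KB_gk hn hY hτ x)
    ((HmK_integrable KB_gk hn hY (hτ.trans_le h) x).const_mul _) fun y => ?_
  have := mnl (gk_mono hτ h (x - Y y)) (hn0 y)
  calc _ ≤ _ := this
    _ = _ := by ring

lemma Hm_le_mass {n Y : ℝ → ℝ} (hn : Integrable n) (hY : Continuous Y) (hn0 : ∀ y, 0 ≤ n y)
    {α τ : ℝ} (hα : 0 < α) (h : α ≤ τ) (x : ℝ) :
    HmK gk n Y τ x ≤ (sqrt α)⁻¹ * ∫ y, n y := by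
  unfold HmK
  rw [← integral_const_mul]
  refine integral_mono (HmK_integrable KB_gk hn hY (hα.trans_le h) x) (hn.const_mul _) fun y => ?_
  have := mnl (gk_le' hα h (x - Y y)) (hn0 y)
  calc _ ≤ _ := this
    _ = _ := by ring

lemma gk_int {τ : ℝ} (hτ : 0 < τ) : Integrable (gk τ) ∧ ∫ z, gk τ z = 1 := by
  have hp := Real.pi_pos
  have hb : 0 < 1 / (4 * τ) := by positivity
  have e : ∀ z : ℝ, gk τ z = (sqrt (4 * Real.pi * τ))⁻¹ * exp (-(1 / (4 * τ)) * z ^ 2) := by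
    intro z; unfold gk; congr 2; field_simp
  have hi := integrable_exp_neg_mul_sq hb
  have hg := integral_gaussian (1 / (4 * τ))
  constructor
  · rw [funext e]; exact hi.const_mul _
  · simp_rw [e]
    rw [integral_const_mul, hg]
    have : Real.pi / (1 / (4 * τ)) = 4 * Real.pi * τ := by field_simp
    rw [this]
    exact inv_mul_cancel₀ (sqrt_pos.2 (by positivity)).ne'

lemma gk_shift_int {τ : ℝ} (hτ : 0 < τ) (x : ℝ) :
    Integrable (fun y => gk τ (x - y)) ∧ ∫ y, gk τ (x - y) = 1 := by
  obtain ⟨h1, h2⟩ := gk_int hτ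
  refine ⟨h1.comp_sub_left x, ?_⟩
  rw [integral_sub_left_eq_self (fun y => gk τ y) volume x, h2]

lemma gk_grow {τ : ℝ} (hτ : 0 < τ) (z : ℝ) :
    exp (z ^ 2 / (8 * τ)) * gk τ z = sqrt 2 * gk (2 * τ) z := by
  have hp := Real.pi_pos
  unfold gk
  have e : sqrt 2 * (sqrt (4 * Real.pi * (2 * τ)))⁻¹ = (sqrt (4 * Real.pi * τ))⁻¹ := by
    rw [← Real.sqrt_inv, ← Real.sqrt_mul (by positivity), ← Real.sqrt_inv]
    congr 1
    field_simp
  rw [← mul_assoc (sqrt 2), e]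
  have e2 : exp (-z ^ 2 / (4 * (2 * τ))) = exp (z ^ 2 / (8 * τ)) * exp (-z ^ 2 / (4 * τ)) := by
    rw [← exp_add]; congr 1; field_simp; ring
  rw [e2]; ring

lemma Hm_exp_bound {n : ℝ → ℝ} {lam τ x A : ℝ} (hn : Integrable n) (hτ : 0 < τ)
    (h : ∀ y, n y ≤ A * exp (lam * |x - y|)) (hA : 0 ≤ A) :
    HmK gk n id τ x ≤ 2 * A * exp (2 * lam ^ 2 * τ) := by
  unfold HmK
  obtain ⟨hi, he⟩ := gk_shift_int (by positivity : 0 < 2 * τ) x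
  have hs2 : sqrt 2 ≤ 2 := by
    rw [Real.sqrt_le_left (by norm_num)]; norm_num
  calc ∫ y, n y * gk τ (x - id y) ≤ ∫ y, (A * exp (2 * lam ^ 2 * τ) * sqrt 2) * gk (2 * τ) (x - y) := by
        refine integral_mono (HmK_integrable KB_gk hn continuous_id hτ x) (hi.const_mul _) fun y => ?_
        have hg := gk_pos hτ (x - y)
        have h1 : lam * |x - y| ≤ 2 * lam ^ 2 * τ + (x - y) ^ 2 / (8 * τ) := by
          rw [← sq_abs (x - y)]
          have : 2 * lam ^ 2 * τ + |x - y| ^ 2 / (8 * τ) - lam * |x - y|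
            = (4 * τ * lam - |x - y|) ^ 2 / (8 * τ) := by field_simp; ring
          have h2 : 0 ≤ (4 * τ * lam - |x - y|) ^ 2 / (8 * τ) := by positivity
          linarith
        have h3 := exp_le_exp.2 h1
        rw [exp_add] at h3
        calc n y * gk τ (x - y) ≤ (A * exp (lam * |x - y|)) * gk τ (x - y) := by
              gcongr; exact h y
          _ ≤ (A * (exp (2 * lam ^ 2 * τ) * exp ((x - y) ^ 2 / (8 * τ)))) * gk τ (x - y) := by
              gcongr
          _ = A * exp (2 * lam ^ 2 * τ) * (exp ((x - y) ^ 2 / (8 * τ)) * gk τ (x - y)) := by ring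
          _ = _ := by rw [gk_grow hτ]; ring
    _ = A * exp (2 * lam ^ 2 * τ) * sqrt 2 := by rw [integral_const_mul, he, mul_one]
    _ ≤ A * exp (2 * lam ^ 2 * τ) * 2 := by gcongr
    _ = _ := by ring

lemma Hm_approx {n : ℝ → ℝ} {N0 : ℝ} (hn : Integrable n) (hc : Continuous n)
    (hb : ∀ y, n y ≤ N0) (hn0 : ∀ y, 0 ≤ n y) (N δ : ℝ) (hδ : 0 < δ) :
    ∃ τ1 > 0, ∀ τ, 0 < τ → τ ≤ τ1 → ∀ x, |x| ≤ N → n x - δ ≤ HmK gk n id τ x := by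
  have hN0 : 0 ≤ N0 := (hn0 0).trans (hb 0)
  have huc : UniformContinuousOn n (Icc (-(N + 1)) (N + 1)) :=
    isCompact_Icc.uniformContinuousOn_of_continuous hc.continuousOn
  obtain ⟨d, hd, hd2⟩ := Metric.uniformContinuousOn_iff.1 huc (δ / 2) (by positivity)
  set d' := min d 1 with hd'
  have hd'0 : 0 < d' := lt_min hd one_pos
  refine ⟨δ / 2 * d' ^ 2 / (16 * (N0 + 1)), by positivity, fun τ hτ hτ1 x hx => ?_⟩
  obtain ⟨hi, he⟩ := gk_shift_int (by positivity : 0 < 2 * τ) x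
  obtain ⟨hi1, he1⟩ := gk_shift_int hτ x
  have hs2 : sqrt 2 ≤ 2 := by
    rw [Real.sqrt_le_left (by norm_num)]; norm_num
  have key : ∀ y, (n x - δ / 2) * gk τ (x - y) - (N0 * (8 * τ / d' ^ 2) * sqrt 2) * gk (2 * τ) (x - y)
      ≤ n y * gk τ (x - id y) := by
    intro y
    have hg := gk_pos hτ (x - y)
    have hpt : n x - δ / 2 - N0 * (8 * τ / d' ^ 2) * exp ((x - y) ^ 2 / (8 * τ)) ≤ n y := by
      have hnn : 0 ≤ N0 * (8 * τ / d' ^ 2) * exp ((x - y) ^ 2 / (8 * τ)) := by positivity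
      rcases lt_or_ge |x - y| d' with hlt | hge
      · have h1 : |x - y| < d := hlt.trans_le (min_le_left _ _)
        have h2 : |x - y| < 1 := hlt.trans_le (min_le_right _ _)
        have hx' := abs_le.1 hx
        have hxy := abs_lt.1 h2
        have := hd2 x ⟨by linarith, by linarith⟩ y ⟨by linarith, by linarith⟩ h1
        rw [Real.dist_eq] at this
        have := (abs_lt.1 this).2
        linarith
      · have h1 : d' ^ 2 ≤ (x - y) ^ 2 := by rw [← sq_abs (x - y)]; gcongr
        have h2 : d' ^ 2 / (8 * τ) ≤ exp ((x - y) ^ 2 / (8 * τ)) := by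
          have := add_one_le_exp ((x - y) ^ 2 / (8 * τ))
          have h3 : d' ^ 2 / (8 * τ) ≤ (x - y) ^ 2 / (8 * τ) := by gcongr
          linarith
        have h4 : N0 * (8 * τ / d' ^ 2) * (d' ^ 2 / (8 * τ)) = N0 := by field_simp
        have h5 : N0 * (8 * τ / d' ^ 2) * (d' ^ 2 / (8 * τ)) ≤
          N0 * (8 * τ / d' ^ 2) * exp ((x - y) ^ 2 / (8 * τ)) := by gcongr
        have := hb x
        have := hn0 y
        linarith
    calc _ = (n x - δ / 2) * gk τ (x - y) - N0 * (8 * τ / d' ^ 2) * (sqrt 2 * gk (2 * τ) (x - y)) := by ring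
      _ = (n x - δ / 2 - N0 * (8 * τ / d' ^ 2) * exp ((x - y) ^ 2 / (8 * τ))) * gk τ (x - y) := by
          rw [← gk_grow hτ]; ring
      _ ≤ n y * gk τ (x - y) := by gcongr
  have hint := integral_mono ((hi1.const_mul _).sub (hi.const_mul _))
    (HmK_integrable KB_gk hn continuous_id hτ x) key
  simp only [Pi.sub_apply] at hint
  rw [integral_sub (hi1.const_mul _) (hi.const_mul _), integral_const_mul, integral_const_mul, he, he1] at hint
  have hfin : N0 * (8 * τ / d' ^ 2) * sqrt 2 ≤ δ / 2 := by
    calc N0 * (8 * τ / d' ^ 2) * sqrt 2 ≤ (N0 + 1) * (8 * (δ / 2 * d' ^ 2 / (16 * (N0 + 1))) / d' ^ 2) * 2 := by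
          gcongr; linarith
      _ = δ / 2 := by field_simp; ring
  unfold HmK
  linarith

lemma chain2 {G G1 G2 : ℝ → ℝ → ℝ} {f g : ℝ → ℝ} {f' g' s : ℝ}
    (h1 : ∀ᶠ p : ℝ × ℝ in 𝓝 (f s, g s), HasDerivAt (fun w => G w p.2) (G1 p.1 p.2) p.1)
    (h2 : ∀ᶠ p : ℝ × ℝ in 𝓝 (f s, g s), HasDerivAt (fun w => G p.1 w) (G2 p.1 p.2) p.2)
    (c1 : ContinuousAt (fun p : ℝ × ℝ => G1 p.1 p.2) (f s, g s))
    (c2 : ContinuousAt (fun p : ℝ × ℝ => G2 p.1 p.2) (f s, g s))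
    (hf : HasDerivAt f f' s) (hg : HasDerivAt g g' s) :
    HasDerivAt (fun s => G (f s) (g s)) (f' * G1 (f s) (g s) + g' * G2 (f s) (g s)) s := by
  have h := hasStrictFDerivAt_uncurry_coprod (𝕜 := ℝ) (u := (f s, g s)) (f := G)
    (f₁ := fun a b => ContinuousLinearMap.toSpanSingleton ℝ (G1 a b))
    (f₂ := fun a b => ContinuousLinearMap.toSpanSingleton ℝ (G2 a b))
    (h1.mono fun p hp => hp.hasFDerivAt) (h2.mono fun p hp => hp.hasFDerivAt)
    ((ContinuousLinearMap.toSpanSingletonCLE (𝕜 := ℝ) (E := ℝ)).continuous.continuousAt.comp c1)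
    ((ContinuousLinearMap.toSpanSingletonCLE (𝕜 := ℝ) (E := ℝ)).continuous.continuousAt.comp c2)
  have h3 := (h.hasFDerivAt).comp_hasDerivAt s (hf.prodMk hg)
  refine (h3.congr_deriv ?_)
  show (ContinuousLinearMap.toSpanSingleton ℝ (G1 (f s) (g s))).coprod
    (ContinuousLinearMap.toSpanSingleton ℝ (G2 (f s) (g s))) (f', g') = _
  simp [ContinuousLinearMap.toSpanSingleton_apply]

lemma Hm_line {n Y : ℝ → ℝ} (hn : Integrable n) (hY : Continuous Y) {f g : ℝ → ℝ} {f' g' s : ℝ}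
    (hf : HasDerivAt f f' s) (hg : HasDerivAt g g' s) (hpos : 0 < f s) :
    HasDerivAt (fun s => HmK gk n Y (f s) (g s))
      (f' * HmK gk2 n Y (f s) (g s) + g' * HmK gk1 n Y (f s) (g s)) s := by
  have hnb : ∀ᶠ p : ℝ × ℝ in 𝓝 (f s, g s), 0 < p.1 :=
    (continuous_fst.tendsto (f s, g s)).eventually (lt_mem_nhds hpos)
  exact chain2 (hnb.mono fun p hp => Hm_dt hn hY hp _) (hnb.mono fun p hp => Hm_dx hn hY hp _)
    (HmK_contAt KB_gk2 hn hY hpos _) (HmK_contAt KB_gk1 hn hY hpos _) hf hg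

structure SolU (d c B CF T : ℝ) (u F : ℝ → ℝ → ℝ) : Prop where
  hc : ∀ x, ContinuousOn (fun t => u t x) (Icc 0 T)
  h2 : ∀ t ∈ Icc 0 T, ContDiff ℝ 2 (u t)
  pde : ∀ t ∈ Ioc 0 T, ∀ x, HasDerivAt (fun s => u s x)
    (d * deriv (deriv (u t)) x + c * deriv (u t) x + F t x) t
  hB : ∀ t ∈ Icc 0 T, ∀ x, |u t x| ≤ B
  hF : ∀ t ∈ Ioc 0 T, ∀ x, |F t x| ≤ CF

lemma SolU.neg {d c B CF T : ℝ} {u F : ℝ → ℝ → ℝ} (h : SolU d c B CF T u F) :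
    SolU d c B CF T (fun t x => -u t x) (fun t x => -F t x) where
  hc := fun x => (h.hc x).neg
  h2 := fun t ht => (h.h2 t ht).neg
  pde := fun t ht x => by
    have := (h.pde t ht x).neg
    refine this.congr_deriv ?_
    have e : deriv (fun y => -u t y) = fun y => -deriv (u t) y := by
      ext y; exact deriv.fun_neg
    have e2 : deriv (deriv (fun y => -u t y)) x = - deriv (deriv (u t)) x := by
      rw [e]; exact deriv.fun_neg
    show _ = d * deriv (deriv (fun y => -u t y)) x + c * deriv (fun y => -u t y) x + -F t x
    rw [e2, e]; ring
  hB := fun t ht x => by rw [abs_neg]; exact h.hB t ht x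
  hF := fun t ht x => by rw [abs_neg]; exact h.hF t ht x

lemma cd2_d1 {f : ℝ → ℝ} (hf : ContDiff ℝ 2 f) (x : ℝ) : HasDerivAt f (deriv f x) x :=
  ((hf.differentiable (by norm_num)) x).hasDerivAt

lemma cd2_d2 {f : ℝ → ℝ} (hf : ContDiff ℝ 2 f) (x : ℝ) :
    HasDerivAt (deriv f) (deriv (deriv f) x) x := by
  have h : ContDiff ℝ 1 (deriv f) := by
    have : ContDiff ℝ (1 + 1) f := by convert hf using 1; norm_num
    exact (contDiff_succ_iff_deriv.1 this).2.2
  exact ((h.differentiable (by norm_num)) x).hasDerivAt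

lemma RC.neg {u : ℝ → ℝ → ℝ} {T s x : ℝ} (h : RC u T s x) : RC (fun t x => -u t x) T s x :=
  ContinuousWithinAt.neg h

lemma gap_f_tendsto {d c B CF T : ℝ} {u F : ℝ → ℝ → ℝ} (h : SolU d c B CF T u F)
    {α t x0 ρ : ℝ} (hα : 0 ≤ α) (hαt : α < t) (htT : t ≤ T) :
    Tendsto (fun s => ∫ y, max (u s y - u α y) 0 * exp (ρ ^ 2 - (y - x0) ^ 2))
      (𝓝[Icc α t] α) (𝓝 0) := by
  have hgi : Integrable (fun y : ℝ => exp (ρ ^ 2 - (y - x0) ^ 2)) := by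
    have h1 := (integrable_exp_neg_mul_sq (one_pos)).comp_sub_right x0
    have h2 := h1.const_mul (exp (ρ ^ 2))
    refine h2.congr (Eventually.of_forall fun y => ?_)
    simp only
    rw [← exp_add]; congr 1; ring
  have hαI : α ∈ Icc 0 T := ⟨hα, hαt.le.trans htT⟩
  have e : (0:ℝ) = ∫ y, max (u α y - u α y) 0 * exp (ρ ^ 2 - (y - x0) ^ 2) := by simp
  suffices hsuff : Tendsto (fun s => ∫ y, max (u s y - u α y) 0 * exp (ρ ^ 2 - (y - x0) ^ 2))
      (𝓝[Icc α t] α) (𝓝 (∫ y, max (u α y - u α y) 0 * exp (ρ ^ 2 - (y - x0) ^ 2))) by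
    rwa [← e] at hsuff
  have hcu : ∀ s ∈ Icc 0 T, Continuous (u s) := fun s hs => (h.h2 s hs).continuous
  have hsub : ∀ s ∈ Icc α t, s ∈ Icc 0 T := fun s hs => ⟨hα.trans hs.1, hs.2.trans htT⟩
  refine tendsto_integral_filter_of_dominated_convergence
    (fun y => 2 * B * exp (ρ ^ 2 - (y - x0) ^ 2)) ?_ ?_ (hgi.const_mul _) ?_
  · filter_upwards [self_mem_nhdsWithin] with s hs
    have := hcu s (hsub s hs)
    have := hcu α hαI
    exact Continuous.aestronglyMeasurable (by fun_prop)
  · filter_upwards [self_mem_nhdsWithin] with s hs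
    refine Eventually.of_forall fun y => ?_
    have h1 := abs_le.1 (h.hB s (hsub s hs) y)
    have h2 := abs_le.1 (h.hB α hαI y)
    rw [norm_mul, Real.norm_eq_abs, Real.norm_eq_abs, Real.abs_exp, abs_of_nonneg (le_max_right _ _)]
    gcongr
    exact max_le (by linarith) (by linarith)
  · refine Eventually.of_forall fun y => ?_
    have h1 : ContinuousWithinAt (fun s => u s y) (Icc α t) α := ((h.hc y) α hαI).mono hsub
    have h2 : ContinuousWithinAt (fun s => max (u s y - u α y) 0 * exp (ρ ^ 2 - (y - x0) ^ 2)) (Icc α t) α := by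
      exact ((h1.sub continuousWithinAt_const).max continuousWithinAt_const).mul continuousWithinAt_const
    exact h2.tendsto

lemma gap_upper {d c B CF T : ℝ} (hd : 0 < d) {u F : ℝ → ℝ → ℝ} (h : SolU d c B CF T u F)
    {α t x0 ρ n κ K2 K3 : ℝ} (hα : 0 ≤ α) (hαt : α < t) (htT : t ≤ T) (hρ : 0 < ρ)
    (hκ : 0 < κ) (hK2 : 0 ≤ K2) (hK2n : n ^ 2 ≤ 4 * κ * K2) (hK2ρ : 2 * B + 1 ≤ K2 * ρ ^ 2)
    (hK3 : 2 * d * K2 + 2 * |c| * K2 * ρ + CF + 1 ≤ K3) (hK30 : 0 ≤ K3)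
    (hRC : ∀ s ∈ Ioc α t, ∀ x, |x - x0| ≤ ρ → RC u T s x)
    (hLip : ∀ x, |x - x0| ≤ ρ → u α x ≤ u α x0 + n * |x - x0|) :
    u t x0 ≤ u α x0 + κ + K3 * (t - α) := by
  have hcu : ∀ s ∈ Icc 0 T, Continuous (u s) := fun s hs => (h.h2 s hs).continuous
  have hαI : α ∈ Icc 0 T := ⟨hα, hαt.le.trans htT⟩
  have hB0 : 0 ≤ B := (abs_nonneg _).trans (h.hB α hαI 0)
  apply le_of_forall_pos_le_add
  intro e' he'
  set e := e' / 3 with hee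
  have he : 0 < e := by positivity
  have hlim := gap_f_tendsto h (ρ := ρ) (x0 := x0) hα hαt htT
  have hpos : 0 < e * sqrt (d * (t - α) / 2) := by
    have : 0 < t - α := sub_pos.2 hαt
    positivity
  have hev := hlim.eventually (gt_mem_nhds hpos)
  have hev2 : ∀ᶠ s in 𝓝[>] α, (∫ y, max (u s y - u α y) 0 * exp (ρ ^ 2 - (y - x0) ^ 2)) < e * sqrt (d * (t - α) / 2) := by
    have : 𝓝[>] α = 𝓝[Ioc α t] α := (nhdsWithin_Ioc_eq_nhdsGT hαt).symm
    rw [this]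
    exact hev.filter_mono (nhdsWithin_mono _ Ioc_subset_Icc_self)
  have hev3 : ∀ᶠ s in 𝓝[>] α, s < (α + t) / 2 :=
    (eventually_lt_nhds (by linarith)).filter_mono nhdsWithin_le_nhds
  obtain ⟨s1, ⟨hs1a, hs1b⟩, hs1c⟩ := ((hev2.and hev3).and self_mem_nhdsWithin).exists
  have hs1c' : α < s1 := hs1c
  have hs1t : s1 < t := by linarith
  have hs1I : s1 ∈ Icc 0 T := ⟨by linarith, by linarith⟩
  set f : ℝ → ℝ := fun y => max (u s1 y - u α y) 0 * exp (ρ ^ 2 - (y - x0) ^ 2) with hf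
  have hgi : Integrable (fun y : ℝ => exp (ρ ^ 2 - (y - x0) ^ 2)) := by
    have h1 := (integrable_exp_neg_mul_sq (one_pos)).comp_sub_right x0
    have h2 := h1.const_mul (exp (ρ ^ 2))
    refine h2.congr (Eventually.of_forall fun y => ?_)
    simp only
    rw [← exp_add]; congr 1; ring
  have hfc : Continuous f := by
    have := hcu s1 hs1I
    have := hcu α hαI
    fun_prop
  have hf0 : ∀ y, 0 ≤ f y := fun y => mul_nonneg (le_max_right _ _) (exp_pos _).le
  have hmaxle : ∀ y, max (u s1 y - u α y) 0 ≤ 2 * B := by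
    intro y
    have h1 := abs_le.1 (h.hB s1 hs1I y)
    have h2 := abs_le.1 (h.hB α hαI y)
    exact max_le (by linarith) (by linarith)
  have hfle : ∀ y, f y ≤ 2 * B * exp (ρ ^ 2 - (y - x0) ^ 2) := fun y => by
    have := hmaxle y
    simp only [hf]; gcongr
  have hfi : Integrable f := by
    refine (hgi.const_mul (2 * B)).mono' hfc.aestronglyMeasurable (Eventually.of_forall fun y => ?_)
    rw [Real.norm_eq_abs, abs_of_nonneg (hf0 y)]; exact hfle y
  have hfb : ∀ y, f y ≤ 2 * B * exp (ρ ^ 2) := fun y => by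
    refine (hfle y).trans ?_
    gcongr; nlinarith [sq_nonneg (y - x0)]
  obtain ⟨τ1, hτ1, happ⟩ := Hm_approx hfi hfc hfb hf0 (|x0| + ρ) e he
  set Hf := HmK gk f id with hHf
  set Y : ℝ → ℝ → ℝ := fun r x => u α x0 + κ + K2 * (x - x0) ^ 2 + K3 * (r - α) + 2 * e
    + Hf (d * (r - s1) + τ1) (x + c * (r - s1)) with hY
  have harg : ∀ r ∈ Icc s1 t, 0 < d * (r - s1) + τ1 := fun r hr => by
    have := mul_nonneg hd.le (sub_nonneg.2 hr.1); linarith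
  have hHpos : ∀ r ∈ Icc s1 t, ∀ x, 0 ≤ Hf (d * (r - s1) + τ1) x := fun r hr x =>
    Hm_nonneg hf0 (harg r hr) x
  have hYlow : ∀ r ∈ Icc s1 t, ∀ x, u α x0 + κ + K2 * (x - x0) ^ 2 + 2 * e ≤ Y r x := by
    intro r hr x
    have h1 := hHpos r hr (x + c * (r - s1))
    have h2 : 0 ≤ K3 * (r - α) := mul_nonneg hK30 (by linarith [hr.1])
    simp only [hY]; linarith
  have hYc : ∀ r ∈ Icc s1 t, ∀ x, ContinuousAt (fun p : ℝ × ℝ => Y p.1 p.2) (r, x) := by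
    intro r hr x
    have h1 := HmK_contAt KB_gk hfi continuous_id (harg r hr) (x + c * (r - s1))
    have h2 : ContinuousAt (fun p : ℝ × ℝ => Hf (d * (p.1 - s1) + τ1) (p.2 + c * (p.1 - s1))) (r, x) :=
      ContinuousAt.comp (f := fun p : ℝ × ℝ => (d * (p.1 - s1) + τ1, p.2 + c * (p.1 - s1))) (x := (r, x)) h1 (by fun_prop)
    exact ContinuousAt.add (by fun_prop) h2
  have hsub : ∀ r ∈ Icc s1 t, r ∈ Icc 0 T := fun r hr => ⟨by linarith [hr.1], hr.2.trans htT⟩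
  have main := touch_main (z := fun r x => u r x - Y r x) (t0 := s1) (t1 := t) (l := x0 - ρ) (r := x0 + ρ)
    (by
      intro r hr x hx
      have h1 := (hRC r ⟨hs1c'.trans_le hr.1, hr.2⟩ x (abs_le.2 ⟨by linarith [hx.1], by linarith [hx.2]⟩)).mono htT
      exact ContinuousWithinAt.sub h1 (hYc r hr x).continuousWithinAt)
    (by
      intro x
      refine ((h.hc x).mono hsub).sub fun r hr => ?_
      exact (ContinuousAt.comp (f := fun r : ℝ => (r, x)) (x := r) (hYc r hr x) (by fun_prop)).continuousWithinAt)
    (by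
      intro x
      by_cases hx : |x - x0| ≤ ρ
      · have h1 := hLip x hx
        have h2 : u s1 x - u α x ≤ f x := by
          have h3 : (1:ℝ) ≤ exp (ρ ^ 2 - (x - x0) ^ 2) := by
            apply one_le_exp
            have : (x - x0) ^ 2 ≤ ρ ^ 2 := by rw [← sq_abs (x - x0)]; gcongr
            linarith
          have h4 := le_max_right (u s1 x - u α x) 0
          have h5 := le_max_left (u s1 x - u α x) 0
          simp only [hf]; nlinarith
        have h6 := happ τ1 hτ1 le_rfl x (by
          have := abs_add_le (x - x0) x0; rw [sub_add_cancel] at this; linarith)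
        have h7 : n * |x - x0| ≤ κ + K2 * (x - x0) ^ 2 := by
          rw [← sq_abs (x - x0)]
          set w := |x - x0|
          by_contra hcon
          push Not at hcon
          have hw : 0 ≤ w := abs_nonneg _
          have h8 : 0 < κ + K2 * w ^ 2 := by positivity
          have h9 : (κ + K2 * w ^ 2) ^ 2 < (n * w) ^ 2 := by gcongr
          have h10 : n ^ 2 * w ^ 2 ≤ 4 * κ * K2 * w ^ 2 := by gcongr
          nlinarith [sq_nonneg (κ - K2 * w ^ 2)]
        have h8 : 0 ≤ K3 * (s1 - α) := mul_nonneg hK30 (by linarith)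
        simp only [hY, sub_self, mul_zero, zero_add, add_zero]
        linarith
      · push Not at hx
        have h1 := hYlow s1 ⟨le_rfl, hs1t.le⟩ x
        have h2 : K2 * ρ ^ 2 ≤ K2 * (x - x0) ^ 2 := by
          rw [← sq_abs (x - x0)]; gcongr
        have h3 := abs_le.1 (h.hB s1 hs1I x)
        have h4 := abs_le.1 (h.hB α hαI x0)
        show u s1 x - Y s1 x < 0
        linarith)
    (by
      intro r hr x hx
      have hx' : ρ ≤ |x - x0| := by
        by_contra hh
        push Not at hh
        have := abs_lt.1 hh
        exact hx ⟨by linarith, by linarith⟩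
      have h1 := hYlow r hr x
      have h2 : K2 * ρ ^ 2 ≤ K2 * (x - x0) ^ 2 := by
        rw [← sq_abs (x - x0)]; gcongr
      have h3 := abs_le.1 (h.hB r (hsub r hr) x)
      have h4 := abs_le.1 (h.hB α hαI x0)
      show u r x - Y r x < 0
      linarith)
    (by
      intro r hr x hx hz hzy hbef
      have hrI : r ∈ Icc s1 t := Ioc_subset_Icc_self hr
      have hr0 : r ∈ Ioc 0 T := ⟨by linarith [hr.1], hr.2.trans htT⟩
      have hap := harg r hrI
      set τ := d * (r - s1) + τ1 with hτ
      set X := x + c * (r - s1) with hX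
      have hxd : ∀ w, HasDerivAt (fun x => Hf τ x) (HmK gk1 f id τ w) w := fun w => Hm_dx hfi continuous_id hap w
      have htd : HasDerivAt (fun s => Hf (d * (s - s1) + τ1) (x + c * (s - s1)))
          (d * HmK gk2 f id τ X + c * HmK gk1 f id τ X) r := by
        have h1 : HasDerivAt (fun s : ℝ => d * (s - s1) + τ1) d r := by
          simpa using (((hasDerivAt_id r).sub_const s1).const_mul d).add_const τ1
        have h2 : HasDerivAt (fun s : ℝ => x + c * (s - s1)) c r := by
          simpa using (((hasDerivAt_id r).sub_const s1).const_mul c).const_add x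
        exact Hm_line hfi continuous_id h1 h2 hap
      have hYt : HasDerivAt (fun s => Y s x) (K3 + (d * HmK gk2 f id τ X + c * HmK gk1 f id τ X)) r := by
        have h1 : HasDerivAt (fun s : ℝ => u α x0 + κ + K2 * (x - x0) ^ 2 + K3 * (s - α) + 2 * e) K3 r := by
          have := ((((hasDerivAt_id r).sub_const α).const_mul K3).const_add (u α x0 + κ + K2 * (x - x0) ^ 2)).add_const (2 * e)
          simpa using this
        exact h1.add htd
      have hut := h.pde r hr0 x
      have ht := touch_t (hut.sub hYt) hz (by
        filter_upwards [Ico_mem_nhdsLT hr.1] with s hs using (hbef s hs x).le)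
      have hxx := touch_x (D := fun y => u r y - Y r y)
        (D1 := fun y => deriv (u r) y - (2 * K2 * (y - x0) + HmK gk1 f id τ (y + c * (r - s1))))
        (d2 := deriv (deriv (u r)) x - (2 * K2 + HmK gk2 f id τ X)) (x := x)
        (Eventually.of_forall fun y => by
          refine (cd2_d1 (h.h2 r (hsub r hrI)) y).sub ?_
          have h1 : HasDerivAt (fun y : ℝ => u α x0 + κ + K2 * (y - x0) ^ 2 + K3 * (r - α) + 2 * e) (2 * K2 * (y - x0)) y := by
            have := ((((((hasDerivAt_id y).sub_const x0).pow 2).const_mul K2).const_add (u α x0 + κ)).add_const (K3 * (r - α))).add_const (2 * e)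
            refine this.congr_deriv ?_
            simp; ring
          exact h1.add ((hxd (y + c * (r - s1))).comp_add_const y _))
        (by
          refine (cd2_d2 (h.h2 r (hsub r hrI)) x).sub ?_
          have h1 : HasDerivAt (fun y : ℝ => 2 * K2 * (y - x0)) (2 * K2) x := by
            simpa using ((hasDerivAt_id x).sub_const x0).const_mul (2 * K2)
          exact h1.add ((Hm_dxx hfi continuous_id hap X).comp_add_const x _))
        (Eventually.of_forall fun y => by
          have := hzy y
          rw [← hz] at this; exact this)
      obtain ⟨e1, e2⟩ := hxx
      have hFb := (abs_le.1 (h.hF r hr0 x)).2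
      have hcx : c * (2 * K2 * (x - x0)) ≤ 2 * |c| * K2 * ρ := by
        have hw : |x - x0| ≤ ρ := (abs_lt.2 ⟨by linarith [hx.1], by linarith [hx.2]⟩).le
        calc c * (2 * K2 * (x - x0)) ≤ |c * (2 * K2 * (x - x0))| := le_abs_self _
          _ = |c| * (2 * K2 * |x - x0|) := by
            rw [abs_mul, abs_mul, abs_of_nonneg (by positivity : 0 ≤ 2 * K2)]
          _ ≤ |c| * (2 * K2 * ρ) := by gcongr
          _ = _ := by ring
      have e1' : deriv (u r) x = 2 * K2 * (x - x0) + HmK gk1 f id τ X := by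
        linarith
      rw [e1'] at ht
      have e3 := mnl e2 hd.le
      nlinarith)
  have hfin := main t ⟨hs1t.le, le_rfl⟩ x0
  have hH : Hf (d * (t - s1) + τ1) (x0 + c * (t - s1)) ≤ e := by
    have h0 : 0 < d * (t - α) / 2 := by
      have : 0 < t - α := sub_pos.2 hαt
      positivity
    have h1 : d * (t - α) / 2 ≤ d * (t - s1) + τ1 := by
      have : d * ((t - α) / 2) ≤ d * (t - s1) := by gcongr; linarith
      linarith
    have h2 := Hm_le_mass hfi continuous_id hf0 h0 h1 (x0 + c * (t - s1))
    have h3 : 0 < sqrt (d * (t - α) / 2) := sqrt_pos.2 h0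
    refine h2.trans ?_
    rw [inv_mul_le_iff₀ h3]
    rw [mul_comm]; exact hs1a.le
  simp only [hY, sub_self] at hfin
  have : K2 * (0:ℝ) ^ 2 = 0 := by ring
  rw [this] at hfin
  linarith

lemma gap_abs {d c B CF T : ℝ} (hd : 0 < d) {u F : ℝ → ℝ → ℝ} (h : SolU d c B CF T u F)
    {α t x0 ρ n κ K2 K3 : ℝ} (hα : 0 ≤ α) (hαt : α < t) (htT : t ≤ T) (hρ : 0 < ρ)
    (hκ : 0 < κ) (hK2 : 0 ≤ K2) (hK2n : n ^ 2 ≤ 4 * κ * K2) (hK2ρ : 2 * B + 1 ≤ K2 * ρ ^ 2)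
    (hK3 : 2 * d * K2 + 2 * |c| * K2 * ρ + CF + 1 ≤ K3) (hK30 : 0 ≤ K3)
    (hRC : ∀ s ∈ Ioc α t, ∀ x, |x - x0| ≤ ρ → RC u T s x)
    (hLip : ∀ x, |x - x0| ≤ ρ → |u α x - u α x0| ≤ n * |x - x0|) :
    |u t x0 - u α x0| ≤ κ + K3 * (t - α) := by
  have h1 := gap_upper hd h hα hαt htT hρ hκ hK2 hK2n hK2ρ hK3 hK30 hRC
    (fun x hx => by linarith [(abs_le.1 (hLip x hx)).2])
  have h2 := gap_upper hd h.neg hα hαt htT hρ hκ hK2 hK2n hK2ρ hK3 hK30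
    (fun s hs x hx => (hRC s hs x hx).neg)
    (fun x hx => by
      have := (abs_le.1 (hLip x hx)).1
      linarith)
  rw [abs_le]; constructor <;> linarith

lemma c1_lip {f : ℝ → ℝ} (hf : ContDiff ℝ 2 f) (R : ℝ) :
    ∃ n : ℕ, ∀ x ∈ Icc (-R) R, ∀ y ∈ Icc (-R) R, |f x - f y| ≤ n * |x - y| := by
  have hc : Continuous (deriv f) := hf.continuous_deriv (by norm_num)
  obtain ⟨C, hC⟩ := isCompact_Icc.exists_bound_of_continuousOn (hc.continuousOn (s := Icc (-R) R))
  obtain ⟨n, hn⟩ := exists_nat_ge C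
  refine ⟨n, fun x hx y hy => ?_⟩
  have := (convex_Icc (-R) R).norm_image_sub_le_of_norm_deriv_le (f := f) (C := n)
    (fun z _ => (hf.differentiable (by norm_num)) z) (fun z hz => (hC z hz).trans hn) hy hx
  simpa [Real.norm_eq_abs] using this

theorem RC_all {d c B CF T : ℝ} (hd : 0 < d) {u F : ℝ → ℝ → ℝ} (h : SolU d c B CF T u F) :
    ∀ s ∈ Icc 0 T, ∀ x, RC u T s x := by
  intro s0 hs0 x00
  obtain ⟨R, hR⟩ := exists_gt |x00|
  have hB0 : 0 ≤ B := (abs_nonneg _).trans (h.hB s0 hs0 0)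
  let Good : ℝ → Prop := fun t => ∃ ε > 0, ∀ s ∈ Icc 0 T, |s - t| < ε → ∀ x, |x| < R → RC u T s x
  let Sg : Set ℝ := {t | t ∈ Icc 0 T ∧ ¬ Good t}
  have hgood : ∀ t, Good t → ∀ᶠ s in 𝓝 t, Good s := by
    rintro t ⟨ε, hε, hh⟩
    filter_upwards [Metric.ball_mem_nhds t (half_pos hε)] with s hs
    rw [Metric.mem_ball, Real.dist_eq] at hs
    refine ⟨ε / 2, half_pos hε, fun r hr hrs x hx => hh r hr ?_ x hx⟩
    calc |r - t| = |(r - s) + (s - t)| := by congr 1; ring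
      _ ≤ |r - s| + |s - t| := abs_add_le _ _
      _ < ε := by linarith
  have hSgc : IsClosed Sg := by
    have : Sg = Icc 0 T ∩ {t | Good t}ᶜ := rfl
    rw [this]
    refine isClosed_Icc.inter (IsOpen.isClosed_compl ?_)
    rw [isOpen_iff_mem_nhds]
    exact fun t ht => hgood t ht
  have hempty : Sg = ∅ := by
    by_contra hne
    have hne' : Sg.Nonempty := nonempty_iff_ne_empty.2 hne
    have : Nonempty Sg := hne'.to_subtype
    have : CompleteSpace Sg := hSgc.completeSpace_coe
    have hunion := nonempty_interior_of_iUnion_of_closed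
      (f := fun n : ℕ => {t : Sg | ∀ x ∈ Icc (-R) R, ∀ y ∈ Icc (-R) R, |u t x - u t y| ≤ n * |x - y|})
      (by
        intro n
        simp only [ofPred_forall]
        refine isClosed_iInter fun x => isClosed_iInter fun _ => isClosed_iInter fun y =>
          isClosed_iInter fun _ => ?_
        have hcx : ∀ x, Continuous (fun t : Sg => u t x) := fun x =>
          (h.hc x).comp_continuous continuous_subtype_val (fun t => t.2.1)
        exact isClosed_le ((hcx x).sub (hcx y)).abs continuous_const)
      (by
        rw [eq_univ_iff_forall]
        intro t
        obtain ⟨n, hn⟩ := c1_lip (h.h2 t t.2.1) R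
        exact mem_iUnion.2 ⟨n, hn⟩)
    obtain ⟨n, t0, ht0⟩ := hunion
    obtain ⟨ε, hε, hball⟩ := Metric.mem_nhds_iff.1 (mem_interior_iff_mem_nhds.1 ht0)
    have hL : ∀ t ∈ Sg, |t - t0| < ε → ∀ x ∈ Icc (-R) R, ∀ y ∈ Icc (-R) R,
        |u t x - u t y| ≤ n * |x - y| := by
      intro t ht htt
      have : (⟨t, ht⟩ : Sg) ∈ Metric.ball t0 ε := by
        rw [Metric.mem_ball, Subtype.dist_eq, Real.dist_eq]; exact htt
      exact hball this
    refine t0.2.2 ⟨ε, hε, fun s hs hst x0 hx0 => ?_⟩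
    by_cases hsS : s ∈ Sg
    swap
    · have hg : Good s := by
        by_contra hg; exact hsS ⟨hs, hg⟩
      obtain ⟨ε', hε', hh⟩ := hg
      exact hh s hs (by simpa using hε') x0 hx0
    set ρ := (R - |x0|) / 2 with hρd
    have hρ : 0 < ρ := by rw [hρd]; linarith
    unfold RC
    rw [Metric.continuousWithinAt_iff]
    intro η hη
    set κ := η / 8 with hκd
    have hκ : 0 < κ := by positivity
    set K2 := (n:ℝ) ^ 2 / (4 * κ) + (2 * B + 1) / ρ ^ 2 with hK2d
    have hK2 : 0 ≤ K2 := by positivity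
    set K3 := max (2 * d * K2 + 2 * |c| * K2 * ρ + CF + 1) 0 with hK3d
    have hcs := (h.hc x0) s hs
    rw [Metric.continuousWithinAt_iff] at hcs
    obtain ⟨η1, hη1, hcs⟩ := hcs (η / 8) (by positivity)
    set η2 := min (min η1 (ε - |s - t0|)) (min (κ / (K3 + 1)) (min ρ (κ / (n + 1)))) with hη2
    have hK30 : 0 ≤ K3 := le_max_right _ _
    refine ⟨η2, ?_, ?_⟩
    · refine lt_min (lt_min hη1 (by linarith)) (lt_min (by positivity) (lt_min hρ (by positivity)))
    rintro ⟨t, x⟩ ⟨⟨hst', htT⟩, -⟩ hdist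
    rw [Prod.dist_eq, max_lt_iff, Real.dist_eq, Real.dist_eq] at hdist
    obtain ⟨hdt, hdx⟩ := hdist
    simp only at hst' htT hdt hdx
    have hdt1 : |t - s| < η1 := hdt.trans_le ((min_le_left _ _).trans (min_le_left _ _))
    have hdt2 : |t - s| < ε - |s - t0| := hdt.trans_le ((min_le_left _ _).trans (min_le_right _ _))
    have hdt3 : |t - s| < κ / (K3 + 1) := hdt.trans_le ((min_le_right _ _).trans (min_le_left _ _))
    have hdx1 : |x - x0| < ρ := hdx.trans_le ((min_le_right _ _).trans ((min_le_right _ _).trans (min_le_left _ _)))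
    have hdx2 : |x - x0| < κ / (n + 1) := hdx.trans_le ((min_le_right _ _).trans ((min_le_right _ _).trans (min_le_right _ _)))
    rw [abs_of_nonneg (sub_nonneg.2 hst')] at hdt1 hdt2 hdt3
    have hcomp : IsCompact (Sg ∩ Icc s t) := isCompact_Icc.inter_left hSgc
    have hα := hcomp.sSup_mem ⟨s, hsS, le_rfl, hst'⟩
    set α := sSup (Sg ∩ Icc s t) with hαd
    have hαt0 : |α - t0| < ε := by
      calc |α - t0| = |(α - s) + (s - t0)| := by congr 1; ring
        _ ≤ |α - s| + |s - t0| := abs_add_le _ _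
        _ < ε := by
          rw [abs_of_nonneg (sub_nonneg.2 hα.2.1)]; linarith [hα.2.2]
    have hLα := hL α hα.1 hαt0
    have hx0I : x0 ∈ Icc (-R) R := abs_le.1 hx0.le
    have hxb : ∀ y, |y - x| ≤ ρ → |y| ≤ R ∧ |y| < R := by
      intro y hy
      have h1 : |y| ≤ |y - x| + |x - x0| + |x0| := by
        calc |y| = |(y - x) + (x - x0) + x0| := by congr 1; ring
          _ ≤ _ := (abs_add_le _ _).trans (by gcongr; exact abs_add_le _ _)
      have : |x0| + 2 * ρ = R := by rw [hρd]; ring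
      exact ⟨by linarith, by linarith⟩
    have hxI : x ∈ Icc (-R) R := abs_le.1 (hxb x (by simpa using hρ.le)).1
    have hgap : |u t x - u α x| ≤ κ + K3 * (t - α) := by
      rcases hα.2.2.lt_or_eq with hlt | heq
      · refine gap_abs (ρ := ρ) (n := n) (K2 := K2) hd h (hs.1.trans hα.2.1) hlt htT hρ hκ hK2 ?_ ?_ (le_max_left _ _) hK30 ?_ ?_
        · have h1 : 4 * κ * ((n:ℝ) ^ 2 / (4 * κ)) = n ^ 2 := by field_simp
          have h2 : 0 ≤ 4 * κ * ((2 * B + 1) / ρ ^ 2) := by positivity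
          rw [hK2d, mul_add, h1]; linarith
        · have h1 : (2 * B + 1) / ρ ^ 2 * ρ ^ 2 = 2 * B + 1 := by field_simp
          have h2 : 0 ≤ (n:ℝ) ^ 2 / (4 * κ) * ρ ^ 2 := by positivity
          rw [hK2d, add_mul, h1]; linarith
        · intro r hr y hy
          have hrI : r ∈ Icc 0 T := ⟨hs.1.trans (hα.2.1.trans hr.1.le), hr.2.trans htT⟩
          have hrg : Good r := by
            by_contra hg
            have : r ≤ α := le_csSup hcomp.bddAbove ⟨⟨hrI, hg⟩, hα.2.1.trans hr.1.le, hr.2⟩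
            linarith [hr.1]
          obtain ⟨ε', hε', hh⟩ := hrg
          exact hh r hrI (by simpa using hε') y (hxb y hy).2
        · intro y hy
          exact hLα y (abs_le.1 (hxb y hy).1) x hxI
      · rw [heq]; simp; positivity
    have h1 : |u α x - u α x0| ≤ κ := by
      refine (hLα x hxI x0 hx0I).trans ?_
      calc (n:ℝ) * |x - x0| ≤ n * (κ / (n + 1)) := by gcongr
        _ ≤ (n + 1) * (κ / (n + 1)) := by gcongr; linarith
        _ = κ := by field_simp
    have h2 : |u α x0 - u s x0| < η / 8 := by
      have := hcs (x := α) hα.1.1 (by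
        rw [Real.dist_eq, abs_of_nonneg (sub_nonneg.2 hα.2.1)]; linarith [hα.2.2])
      rwa [Real.dist_eq] at this
    have h3 : K3 * (t - α) ≤ κ := by
      calc K3 * (t - α) ≤ K3 * (κ / (K3 + 1)) := by
            gcongr; linarith [hα.2.1]
        _ ≤ (K3 + 1) * (κ / (K3 + 1)) := by gcongr; linarith
        _ = κ := by field_simp
    simp only [Real.dist_eq]
    calc |u t x - u s x0| = |(u t x - u α x) + (u α x - u α x0) + (u α x0 - u s x0)| := by congr 1; ring
      _ ≤ |u t x - u α x| + |u α x - u α x0| + |u α x0 - u s x0| :=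
        (abs_add_le _ _).trans (by gcongr; exact abs_add_le _ _)
      _ < η := by linarith
  have hg : Good s0 := by
    by_contra hg
    have : s0 ∈ Sg := ⟨hs0, hg⟩
    rw [hempty] at this; exact this
  obtain ⟨ε', hε', hh⟩ := hg
  exact hh s0 hs0 (by simpa using hε') x00 hR

def LocMaj (W : ℝ → ℝ → ℝ) (t x a0 a1 a2 : ℝ) : Prop :=
  ∃ f g g1 : ℝ → ℝ, f t = W t x ∧ g x = W t x ∧ (∀ᶠ s in 𝓝[<] t, W s x ≤ f s) ∧
    (∀ᶠ y in 𝓝 x, W t y ≤ g y) ∧ HasDerivAt f a0 t ∧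
    (∀ᶠ y in 𝓝 x, HasDerivAt g (g1 y) y) ∧ g1 x = a1 ∧ HasDerivAt g1 a2 x

lemma LocMaj.of_smooth {W W1 : ℝ → ℝ → ℝ} {t x a0 a2 : ℝ}
    (h0 : HasDerivAt (fun s => W s x) a0 t) (h1 : ∀ᶠ y in 𝓝 x, HasDerivAt (W t) (W1 t y) y)
    (h2 : HasDerivAt (W1 t) a2 x) : LocMaj W t x a0 (W1 t x) a2 :=
  ⟨fun s => W s x, W t, W1 t, rfl, rfl, Eventually.of_forall fun _ => le_rfl,
    Eventually.of_forall fun _ => le_rfl, h0, h1, rfl, h2⟩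

lemma LocMaj.congr_le {W W' : ℝ → ℝ → ℝ} {t x a0 a1 a2 : ℝ} (h : LocMaj W t x a0 a1 a2)
    (he : W' t x = W t x) (ht : ∀ᶠ s in 𝓝[<] t, W' s x ≤ W s x)
    (hx : ∀ᶠ y in 𝓝 x, W' t y ≤ W t y) : LocMaj W' t x a0 a1 a2 := by
  obtain ⟨f, g, g1, h1, h2, h3, h4, h5, h6, h7, h8⟩ := h
  refine ⟨f, g, g1, h1.trans he.symm, h2.trans he.symm, ?_, ?_, h5, h6, h7, h8⟩
  · filter_upwards [h3, ht] with s a b using b.trans a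
  · filter_upwards [h4, hx] with s a b using b.trans a

lemma notouch_pos {w : ℝ → ℝ → ℝ} {W W2 : ℝ → ℝ → ℝ} {D c t x t0 δ K a0 a1 a2 m k w2 Nn M k0 e N1 N2 wt : ℝ}
    (hD : 0 ≤ D) (hδ : 0 < δ) (ht : t0 < t)
    (h2 : ContDiff ℝ 2 (w t))
    (hw : HasDerivAt (fun s => w s x) wt t)
    (hwt : wt = D * deriv (deriv (w t)) x + c * deriv (w t) x + w t x * m + k * w2 + w t x * Nn)
    (hm : |m| ≤ M) (hk : 0 ≤ k) (hk0 : k ≤ k0)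
    (hW0 : 0 ≤ W t x) (hW1 : W t x ≤ 1)
    (hw2 : |w2| ≤ W2 t x + δ * exp (K * (t - t0)) * cosh x)
    (hN1 : |Nn| ≤ N1 + e * (δ * exp (K * (t - t0)) * cosh x)) (hN2 : |Nn| ≤ N2) (he : 0 ≤ e)
    (hmaj : LocMaj W t x a0 a1 a2)
    (hsup : D * a2 + c * a1 + W t x * m + k * W2 t x + W t x * N1 ≤ a0)
    (hK : D + |c| + M + k0 + e + N2 < K)
    (heq : w t x = W t x + δ * exp (K * (t - t0)) * cosh x)
    (hsp : ∀ y, w t y ≤ W t y + δ * exp (K * (t - t0)) * cosh y)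
    (htm : ∀ s ∈ Ico t0 t, w s x ≤ W s x + δ * exp (K * (s - t0)) * cosh x) : False := by
  obtain ⟨f, g, g1, e1, e2, h3, h4, h5, h6, h7, h8⟩ := hmaj
  set β := δ * exp (K * (t - t0)) * cosh x with hβ
  have hβ0 : 0 < β := by have := cosh_pos x; positivity
  have dβ : HasDerivAt (fun s => δ * exp (K * (s - t0)) * cosh x) (K * β) t := by
    have h1 : HasDerivAt (fun s : ℝ => K * (s - t0)) K t := by
      simpa using ((hasDerivAt_id t).sub_const t0).const_mul K
    have := (h1.exp.const_mul δ).mul_const (cosh x)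
    refine this.congr_deriv ?_
    rw [hβ]; ring
  have q1 := touch_t (hw.sub (h5.add dβ)) (by
      simp only [Pi.sub_apply, Pi.add_apply]; rw [e1, heq]; ring) (by
      filter_upwards [h3, Ico_mem_nhdsLT ht] with s a b
      have := htm s b
      simp only [Pi.sub_apply, Pi.add_apply]; linarith)
  have q2 := touch_x (D := fun y => w t y - (g y + δ * exp (K * (t - t0)) * cosh y))
    (D1 := fun y => deriv (w t) y - (g1 y + δ * exp (K * (t - t0)) * Real.sinh y))
    (d2 := deriv (deriv (w t)) x - (a2 + β)) (x := x)
    (by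
      filter_upwards [h6] with y hy
      exact (cd2_d1 h2 y).sub (hy.add ((Real.hasDerivAt_cosh y).const_mul _)))
    ((cd2_d2 h2 x).sub (h8.add ((Real.hasDerivAt_sinh x).const_mul _)))
    (by
      filter_upwards [h4] with y hy
      have := hsp y
      rw [e2, heq]
      linarith)
  obtain ⟨q2, q3⟩ := q2
  have hsinh : |δ * exp (K * (t - t0)) * Real.sinh x| ≤ β := by
    rw [abs_mul, abs_of_pos (by positivity), hβ]
    gcongr
    rw [abs_le]
    constructor
    · have := Real.cosh_add_sinh x; have := exp_pos x; linarith
    · have := Real.cosh_sub_sinh x; have := exp_pos (-x); linarith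
  set S := δ * exp (K * (t - t0)) * Real.sinh x
  have hcS : c * S ≤ |c| * β := by
    calc c * S ≤ |c * S| := le_abs_self _
      _ = |c| * |S| := abs_mul _ _
      _ ≤ _ := by gcongr
  have hd1 : deriv (w t) x = a1 + S := by rw [← h7]; linarith
  have hd2 : D * deriv (deriv (w t)) x ≤ D * (a2 + β) := by
    apply mnl _ hD; linarith
  have hcd : c * deriv (w t) x = c * a1 + c * S := by rw [hd1]; ring
  have hmm : β * m ≤ M * β := by
    rw [mul_comm]; exact mnr ((le_abs_self m).trans hm) hβ0.le
  have hkk : k * w2 ≤ k * W2 t x + k0 * β := by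
    have h1 := (le_abs_self w2).trans hw2
    have h2 : k * w2 ≤ k * (W2 t x + β) := mnl h1 hk
    have h3 : k * β ≤ k0 * β := by gcongr
    linarith
  have hnn : w t x * Nn ≤ W t x * N1 + e * β + N2 * β := by
    rw [heq]
    have h1 := (le_abs_self Nn).trans hN1
    have h2 := (le_abs_self Nn).trans hN2
    have h3 : W t x * Nn ≤ W t x * (N1 + e * β) := mnl h1 hW0
    have h4 : β * Nn ≤ β * N2 := mnl h2 hβ0.le
    have h5 : W t x * (e * β) ≤ 1 * (e * β) := by gcongr
    linarith
  have hKK : (D + |c| + M + k0 + e + N2) * β < K * β := by gcongr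
  have hwm : w t x * m = W t x * m + β * m := by rw [heq]; ring
  rw [hwt] at q1
  linarith

structure PQ (a b σ r c B T : ℝ) (U V : ℝ → ℝ) (P Q : ℝ → ℝ → ℝ) : Prop where
  cP : ∀ x, ContinuousOn (fun t => P t x) (Icc 0 T)
  cQ : ∀ x, ContinuousOn (fun t => Q t x) (Icc 0 T)
  dP : ∀ t ∈ Icc 0 T, ContDiff ℝ 2 (P t)
  dQ : ∀ t ∈ Icc 0 T, ContDiff ℝ 2 (Q t)
  eP : ∀ t ∈ Ioc 0 T, ∀ x, HasDerivAt (fun s => P s x)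
    (1 * deriv (deriv (P t)) x + c * deriv (P t) x + P t x * (1 - 2 * U x - a * V x)
      + a * U x * Q t x + P t x * (a * Q t x - P t x)) t
  eQ : ∀ t ∈ Ioc 0 T, ∀ x, HasDerivAt (fun s => Q s x)
    (σ * deriv (deriv (Q t)) x + c * deriv (Q t) x + Q t x * (r * (1 - b * U x - 2 * V x))
      + r * b * V x * P t x + Q t x * (r * (Q t x - b * P t x))) t
  bP : ∀ t ∈ Icc 0 T, ∀ x, |P t x| ≤ B
  bQ : ∀ t ∈ Icc 0 T, ∀ x, |Q t x| ≤ B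
  rP : ∀ t ∈ Icc 0 T, ∀ x, RC P T t x
  rQ : ∀ t ∈ Icc 0 T, ∀ x, RC Q T t x

lemma deriv2_neg (w : ℝ → ℝ) (x : ℝ) : deriv (deriv (fun y => -w y)) x = -deriv (deriv w) x := by
  have e : deriv (fun y => -w y) = fun y => -deriv w y := by
    ext y; exact deriv.fun_neg
  rw [e]; exact deriv.fun_neg

lemma notouch_abs {w : ℝ → ℝ → ℝ} {W W2 : ℝ → ℝ → ℝ} {D c t x t0 δ K m k w2 Nn M k0 e N1 N2 : ℝ}
    (hD : 0 ≤ D) (hδ : 0 < δ) (ht : t0 < t)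
    (h2 : ContDiff ℝ 2 (w t))
    (hw : HasDerivAt (fun s => w s x) (D * deriv (deriv (w t)) x + c * deriv (w t) x + w t x * m + k * w2 + w t x * Nn) t)
    (hm : |m| ≤ M) (hk : 0 ≤ k) (hk0 : k ≤ k0)
    (hW0 : 0 ≤ W t x) (hW1 : W t x ≤ 1)
    (hw2 : |w2| ≤ W2 t x + δ * exp (K * (t - t0)) * cosh x)
    (hN1 : |Nn| ≤ N1 + e * (δ * exp (K * (t - t0)) * cosh x)) (hN2 : |Nn| ≤ N2) (he : 0 ≤ e)
    (hmaj : ∃ a0 a1 a2, LocMaj W t x a0 a1 a2 ∧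
      D * a2 + c * a1 + W t x * m + k * W2 t x + W t x * N1 ≤ a0)
    (hK : D + |c| + M + k0 + e + N2 < K)
    (heq : |w t x| = W t x + δ * exp (K * (t - t0)) * cosh x)
    (hsp : ∀ y, |w t y| ≤ W t y + δ * exp (K * (t - t0)) * cosh y)
    (htm : ∀ s ∈ Ico t0 t, |w s x| ≤ W s x + δ * exp (K * (s - t0)) * cosh x) : False := by
  obtain ⟨a0, a1, a2, hmaj, hsup⟩ := hmaj
  rcases le_total 0 (w t x) with h0 | h0
  · rw [abs_of_nonneg h0] at heq
    exact notouch_pos hD hδ ht h2 hw rfl hm hk hk0 hW0 hW1 hw2 hN1 hN2 he hmaj hsup hK heq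
      (fun y => (le_abs_self _).trans (hsp y)) (fun s hs => (le_abs_self _).trans (htm s hs))
  · rw [abs_of_nonpos h0] at heq
    refine notouch_pos (w := fun t x => -w t x) (w2 := -w2) hD hδ ht h2.neg hw.neg ?_ hm hk hk0 hW0 hW1
      (by rw [abs_neg]; exact hw2) hN1 hN2 he hmaj hsup hK heq
      (fun y => (neg_le_abs _).trans (hsp y)) (fun s hs => (neg_le_abs _).trans (htm s hs))
    rw [deriv2_neg, deriv.fun_neg]; ring

theorem CL {a b σ r c B T : ℝ} {U V : ℝ → ℝ} {P Q : ℝ → ℝ → ℝ} (h : PQ a b σ r c B T U V P Q)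
    (ha0 : 0 < a) (ha1 : a < 1) (hb : 1 < b) (hσ : 0 < σ) (hr : 0 < r)
    (hU : ∀ x, 0 < U x ∧ U x < 1) (hV : ∀ x, 0 < V x ∧ V x < 1) {t0 : ℝ} (ht0 : 0 ≤ t0)
    {Pb Qb : ℝ → ℝ → ℝ}
    (hPc : ∀ t ∈ Icc t0 T, ∀ x, ContinuousAt (fun p : ℝ × ℝ => Pb p.1 p.2) (t, x))
    (hQc : ∀ t ∈ Icc t0 T, ∀ x, ContinuousAt (fun p : ℝ × ℝ => Qb p.1 p.2) (t, x))
    (hP01 : ∀ t ∈ Icc t0 T, ∀ x, 0 ≤ Pb t x ∧ Pb t x ≤ 1)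
    (hQ01 : ∀ t ∈ Icc t0 T, ∀ x, 0 ≤ Qb t x ∧ Qb t x ≤ 1)
    (hPm : ∀ t ∈ Ioc t0 T, ∀ x, ∃ a0 a1 a2, LocMaj Pb t x a0 a1 a2 ∧
      1 * a2 + c * a1 + Pb t x * (1 - 2 * U x - a * V x) + a * U x * Qb t x
        + Pb t x * (a * Qb t x + Pb t x) ≤ a0)
    (hQm : ∀ t ∈ Ioc t0 T, ∀ x, ∃ a0 a1 a2, LocMaj Qb t x a0 a1 a2 ∧
      σ * a2 + c * a1 + Qb t x * (r * (1 - b * U x - 2 * V x)) + r * b * V x * Pb t x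
        + Qb t x * (r * (Qb t x + b * Pb t x)) ≤ a0)
    {δ : ℝ} (hδ : 0 < δ)
    (hPi : ∀ x, |P t0 x| < Pb t0 x + δ * cosh x)
    (hQi : ∀ x, |Q t0 x| < Qb t0 x + δ * cosh x) (hB0 : 0 ≤ B) :
    ∀ t ∈ Icc t0 T, ∀ x,
      |P t x| ≤ Pb t x + δ * exp ((20 + σ + |c| + 10 * r + 10 * r * b + 2 * B + r * (1 + b) * B) * (t - t0)) * cosh x ∧
      |Q t x| ≤ Qb t x + δ * exp ((20 + σ + |c| + 10 * r + 10 * r * b + 2 * B + r * (1 + b) * B) * (t - t0)) * cosh x := by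
  set K := 20 + σ + |c| + 10 * r + 10 * r * b + 2 * B + r * (1 + b) * B with hK
  have hK0 : 0 ≤ K := by have := abs_nonneg c; rw [hK]; positivity
  set be : ℝ → ℝ → ℝ := fun t x => δ * exp (K * (t - t0)) * cosh x with hbe
  have hbec : ∀ t x, ContinuousAt (fun p : ℝ × ℝ => be p.1 p.2) (t, x) := by
    intro t x
    have : Continuous (fun p : ℝ × ℝ => be p.1 p.2) := by
      simp only [hbe]
      have := Real.continuous_cosh
      fun_prop
    exact this.continuousAt
  have hsub : ∀ t ∈ Icc t0 T, t ∈ Icc 0 T := fun t ht => ⟨ht0.trans ht.1, ht.2⟩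
  obtain ⟨N, hN⟩ : ∃ N : ℝ, B < δ * N ∧ 0 ≤ N := by
    refine ⟨(B + 1) / δ, ?_, by positivity⟩
    rw [mul_div_cancel₀ _ hδ.ne']; linarith
  have hbig : ∀ t ∈ Icc t0 T, ∀ x, x ∉ Ioo (-N) N → B < be t x := by
    intro t ht x hx
    have h1 : N ≤ |x| := by
      by_contra hh; push Not at hh
      exact hx (abs_lt.1 hh)
    have h2 : |x| ≤ cosh x := by
      rw [← Real.cosh_abs, Real.cosh_eq]
      have h4 := Real.quadratic_le_exp_of_nonneg (abs_nonneg x)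
      have h5 := add_one_le_exp (-|x|)
      linarith only [sq_nonneg (|x| - 2), h4, h5]
    have h3 : 1 ≤ exp (K * (t - t0)) := one_le_exp (mul_nonneg hK0 (by linarith [ht.1]))
    calc B < δ * N := hN.1
      _ ≤ δ * 1 * cosh x := by rw [mul_one]; gcongr; linarith
      _ ≤ _ := by
        simp only [hbe]; have := cosh_pos x; gcongr
  set z : ℝ → ℝ → ℝ := fun t x => max (|P t x| - Pb t x - be t x) (|Q t x| - Qb t x - be t x) with hz
  have hzl : ∀ t x, z t x ≤ 0 → |P t x| ≤ Pb t x + be t x ∧ |Q t x| ≤ Qb t x + be t x := by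
    intro t x hh
    have h1 := max_le_iff.1 hh
    exact ⟨by linarith [h1.1], by linarith [h1.2]⟩
  have main := touch_main (z := z) (t0 := t0) (t1 := T) (l := -N) (r := N)
    (by
      intro t ht x hx
      have h1 : ContinuousWithinAt (fun p : ℝ × ℝ => P p.1 p.2) _ _ := h.rP t (hsub t ht) x
      have h2 : ContinuousWithinAt (fun p : ℝ × ℝ => Q p.1 p.2) _ _ := h.rQ t (hsub t ht) x
      have h3 := (hbec t x).continuousWithinAt (s := Icc t T ×ˢ univ)
      exact ((h1.abs.sub (hPc t ht x).continuousWithinAt).sub h3).max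
        ((h2.abs.sub (hQc t ht x).continuousWithinAt).sub h3))
    (by
      intro x t ht
      have h1 := ((h.cP x) t (hsub t ht)).mono (fun s hs => hsub s hs : Icc t0 T ⊆ Icc 0 T)
      have h2 := ((h.cQ x) t (hsub t ht)).mono (fun s hs => hsub s hs : Icc t0 T ⊆ Icc 0 T)
      have cv : ∀ {G : ℝ → ℝ → ℝ}, ContinuousAt (fun p : ℝ × ℝ => G p.1 p.2) (t, x) →
          ContinuousWithinAt (fun s => G s x) (Icc t0 T) t := by
        intro G hG
        exact (ContinuousAt.comp (f := fun r : ℝ => (r, x)) (x := t) hG (by fun_prop)).continuousWithinAt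
      exact ((h1.abs.sub (cv (hPc t ht x))).sub (cv (hbec t x))).max
        ((h2.abs.sub (cv (hQc t ht x))).sub (cv (hbec t x))))
    (by
      intro x
      have h1 := hPi x
      have h2 := hQi x
      simp only [hz, hbe, sub_self, mul_zero, exp_zero, mul_one]
      exact max_lt (by linarith) (by linarith))
    (by
      intro t ht x hx
      have h1 := hbig t ht x hx
      have h2 := h.bP t (hsub t ht) x
      have h3 := h.bQ t (hsub t ht) x
      exact max_lt (by linarith [(hP01 t ht x).1]) (by linarith [(hQ01 t ht x).1]))
    (by
      intro t ht x hx hz0 hzy hbef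
      have htI := Ioc_subset_Icc_self ht
      have ht' : t ∈ Ioc 0 T := ⟨ht0.trans_lt ht.1, ht.2⟩
      obtain ⟨lP, lQ⟩ := hzl t x (hzy x)
      obtain ⟨hU0, hU1⟩ := hU x
      obtain ⟨hV0, hV1⟩ := hV x
      obtain ⟨hP0, hP1⟩ := hP01 t htI x
      obtain ⟨hQ0, hQ1⟩ := hQ01 t htI x
      have haV : 0 < a * V x ∧ a * V x < 1 := ⟨by positivity, by nlinarith⟩
      have hbU : 0 < b * U x ∧ b * U x < b := ⟨by positivity, by nlinarith⟩
      have bP := h.bP t (hsub t htI) x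
      have bQ := h.bQ t (hsub t htI) x
      have hc0 := abs_nonneg c
      have hrB : 0 ≤ r * (1 + b) * B := by positivity
      have hrb : 0 < r * b := by positivity
      rcases max_choice (|P t x| - Pb t x - be t x) (|Q t x| - Qb t x - be t x) with hmx | hmx
      · have heq : |P t x| = Pb t x + be t x := by
          have : z t x = |P t x| - Pb t x - be t x := hmx
          rw [hz0] at this; linarith
        refine notouch_abs (M := 3) (k0 := 1) (e := 2) (N1 := a * Qb t x + Pb t x) (N2 := 2 * B) zero_le_one hδ ht.1 (h.dP t (hsub t htI)) (h.eP t ht' x) ?_ (by positivity) ?_ hP0 hP1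
          lQ ?_ ?_ (by norm_num) (hPm t ht x) ?_ heq (fun y => (hzl t y (hzy y)).1)
          (fun s hs => (hzl s x (hbef s hs x).le).1)
        · rw [abs_le]; constructor <;> linarith
        · nlinarith
        · have h1 : |a * Q t x| ≤ a * (Qb t x + be t x) := by
            rw [abs_mul, abs_of_pos ha0]; gcongr
          have h2 := abs_sub (a * Q t x) (P t x)
          have h3 : 0 ≤ be t x := by
            simp only [hbe]; have := cosh_pos x; positivity
          change |a * Q t x - P t x| ≤ a * Qb t x + Pb t x + 2 * be t x
          linarith [mnr ha1.le h3]
        · have h1 : |a * Q t x| ≤ 1 * B := by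
            rw [abs_mul, abs_of_pos ha0]; gcongr
          have h2 := abs_sub (a * Q t x) (P t x)
          linarith
        · rw [hK]; nlinarith
      · have heq : |Q t x| = Qb t x + be t x := by
          have : z t x = |Q t x| - Qb t x - be t x := hmx
          rw [hz0] at this; linarith
        refine notouch_abs (M := r * (3 + b)) (k0 := r * b) (e := r * (1 + b)) (N1 := r * (Qb t x + b * Pb t x)) (N2 := r * ((1 + b) * B)) hσ.le hδ ht.1 (h.dQ t (hsub t htI)) (h.eQ t ht' x) ?_ (by positivity) ?_ hQ0 hQ1
          lP ?_ ?_ (by positivity) (hQm t ht x) ?_ heq (fun y => (hzl t y (hzy y)).2)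
          (fun s hs => (hzl s x (hbef s hs x).le).2)
        · rw [abs_mul, abs_of_pos hr]; gcongr; rw [abs_le]; constructor <;> linarith
        · nlinarith
        · have h1 : |b * P t x| ≤ b * (Pb t x + be t x) := by
            rw [abs_mul, abs_of_pos (by linarith)]; gcongr
          have h2 := abs_sub (Q t x) (b * P t x)
          rw [abs_mul, abs_of_pos hr]
          calc r * |Q t x - b * P t x| ≤ r * (Qb t x + b * Pb t x + (1 + b) * be t x) := by
                gcongr; linarith
            _ = _ := by simp only [hbe]; ring
        · have h1 : |b * P t x| ≤ b * B := by
            rw [abs_mul, abs_of_pos (by linarith)]; gcongr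
          have h2 := abs_sub (Q t x) (b * P t x)
          rw [abs_mul, abs_of_pos hr]
          gcongr
          linarith
        · rw [hK]; nlinarith)
  intro t ht x
  exact hzl t x (main t ht x).le

lemma PQ.mono {a b σ r c B T T' : ℝ} {U V : ℝ → ℝ} {P Q : ℝ → ℝ → ℝ} (h : PQ a b σ r c B T U V P Q)
    (hT : T' ≤ T) : PQ a b σ r c B T' U V P Q where
  cP x := (h.cP x).mono (Icc_subset_Icc le_rfl hT)
  cQ x := (h.cQ x).mono (Icc_subset_Icc le_rfl hT)
  dP t ht := h.dP t ⟨ht.1, ht.2.trans hT⟩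
  dQ t ht := h.dQ t ⟨ht.1, ht.2.trans hT⟩
  eP t ht := h.eP t ⟨ht.1, ht.2.trans hT⟩
  eQ t ht := h.eQ t ⟨ht.1, ht.2.trans hT⟩
  bP t ht := h.bP t ⟨ht.1, ht.2.trans hT⟩
  bQ t ht := h.bQ t ⟨ht.1, ht.2.trans hT⟩
  rP t ht x := (h.rP t ⟨ht.1, ht.2.trans hT⟩ x).mono hT
  rQ t ht x := (h.rQ t ⟨ht.1, ht.2.trans hT⟩ x).mono hT

noncomputable def SB (d K L c τ1 : ℝ) (n : ℝ → ℝ) (t x : ℝ) : ℝ :=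
  exp (K * t) * (HmK gk n id (d * (t + τ1)) (x + c * t)
    + L * sqrt (t + τ1) * HmK gk n id (2 * (t + τ1)) (x + c * t))

lemma SB_cont {d K L c τ1 : ℝ} {n : ℝ → ℝ} (hn : Integrable n) (hd : 0 < d) {t : ℝ}
    (hτ : 0 < t + τ1) (x : ℝ) :
    ContinuousAt (fun p : ℝ × ℝ => SB d K L c τ1 n p.1 p.2) (t, x) := by
  unfold SB
  have h1 := HmK_contAt KB_gk hn continuous_id (mul_pos hd hτ) (x + c * t)
  have h1' : ContinuousAt (fun p : ℝ × ℝ => HmK gk n id (d * (p.1 + τ1)) (p.2 + c * p.1)) (t, x) :=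
    ContinuousAt.comp (f := fun p : ℝ × ℝ => (d * (p.1 + τ1), p.2 + c * p.1)) (x := (t, x)) h1 (by fun_prop)
  have h2 := HmK_contAt KB_gk hn continuous_id (mul_pos two_pos hτ) (x + c * t)
  have h2' : ContinuousAt (fun p : ℝ × ℝ => HmK gk n id (2 * (p.1 + τ1)) (p.2 + c * p.1)) (t, x) :=
    ContinuousAt.comp (f := fun p : ℝ × ℝ => (2 * (p.1 + τ1), p.2 + c * p.1)) (x := (t, x)) h2 (by fun_prop)
  refine ContinuousAt.mul (by fun_prop) (h1'.add (ContinuousAt.mul (by fun_prop) h2'))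

lemma SB_maj {d K L c τ1 : ℝ} {n : ℝ → ℝ} (hn : Integrable n) (hn0 : ∀ y, 0 ≤ n y) (hd : 0 < d)
    (hd2 : d ≤ 2) (hL : 0 ≤ L) {t : ℝ} (hτ : 0 < t + τ1) (x : ℝ) :
    ∃ a0 a1 a2, LocMaj (SB d K L c τ1 n) t x a0 a1 a2 ∧
      d * a2 + c * a1 + K * SB d K L c τ1 n t x
        + exp (K * t) * (L * d / (4 * sqrt (t + τ1)) * HmK gk n id (2 * (t + τ1)) (x + c * t)) ≤ a0 := by
  have hg1 : HasDerivAt (fun s : ℝ => d * (s + τ1)) d t := by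
    simpa using ((hasDerivAt_id t).add_const τ1).const_mul d
  have hg2 : HasDerivAt (fun s : ℝ => 2 * (s + τ1)) 2 t := by
    simpa using ((hasDerivAt_id t).add_const τ1).const_mul 2
  have hx : HasDerivAt (fun s : ℝ => x + c * s) c t := by
    simpa using ((hasDerivAt_id t).const_mul c).const_add x
  have hsq : HasDerivAt (fun s : ℝ => L * sqrt (s + τ1)) (L * (1 / (2 * sqrt (t + τ1)))) t :=
    ((((hasDerivAt_id t).add_const τ1).sqrt hτ.ne')).const_mul L
  have he : HasDerivAt (fun s : ℝ => exp (K * s)) (exp (K * t) * K) t := by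
    have : HasDerivAt (fun s : ℝ => K * s) K t := by simpa using (hasDerivAt_id t).const_mul K
    exact this.exp
  have p1 : 0 < d * (t + τ1) := mul_pos hd hτ
  have p2 : 0 < 2 * (t + τ1) := mul_pos two_pos hτ
  have l1 := Hm_line hn continuous_id hg1 hx p1
  have l2 := Hm_line hn continuous_id hg2 hx p2
  have hT := he.mul (l1.add (hsq.mul l2))
  set W1 : ℝ → ℝ → ℝ := fun t x => exp (K * t) * (HmK gk1 n id (d * (t + τ1)) (x + c * t)
    + L * sqrt (t + τ1) * HmK gk1 n id (2 * (t + τ1)) (x + c * t)) with hW1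
  have hX : ∀ y, HasDerivAt (SB d K L c τ1 n t) (W1 t y) y := by
    intro y
    exact (((Hm_dx hn continuous_id p1 (y + c * t)).comp_add_const y _).add
      (((Hm_dx hn continuous_id p2 (y + c * t)).comp_add_const y _).const_mul _)).const_mul _
  have hXX : HasDerivAt (W1 t) (exp (K * t) * (HmK gk2 n id (d * (t + τ1)) (x + c * t)
    + L * sqrt (t + τ1) * HmK gk2 n id (2 * (t + τ1)) (x + c * t))) x :=
    (((Hm_dxx hn continuous_id p1 (x + c * t)).comp_add_const x _).add
      (((Hm_dxx hn continuous_id p2 (x + c * t)).comp_add_const x _).const_mul _)).const_mul _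
  refine ⟨_, _, _, LocMaj.of_smooth (W := SB d K L c τ1 n) hT (Eventually.of_forall hX) hXX, ?_⟩
  simp only [hW1, SB, Pi.add_apply, Pi.mul_apply]
  have hE := exp_pos (K * t)
  set E := exp (K * t)
  have hs : 0 < sqrt (t + τ1) := sqrt_pos.2 hτ
  have hss : sqrt (t + τ1) ^ 2 = t + τ1 := sq_sqrt hτ.le
  have hlow := Hm_gk2_ge hn continuous_id hn0 p2 (x + c * t)
  set s := sqrt (t + τ1)
  rw [← hss] at hlow ⊢
  set H := HmK gk n id (2 * s ^ 2) (x + c * t)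
  set H2 := HmK gk2 n id (2 * s ^ 2) (x + c * t)
  set G := HmK gk n id (d * s ^ 2) (x + c * t)
  set G1 := HmK gk1 n id (d * s ^ 2) (x + c * t)
  set G2 := HmK gk2 n id (d * s ^ 2) (x + c * t)
  set H1 := HmK gk1 n id (2 * s ^ 2) (x + c * t)
  have key : 0 ≤ E * L * ((2 - d) * s * (H2 + 1 / (2 * (2 * s ^ 2)) * H)) := by
    have : 0 ≤ 2 - d := by linarith
    have h3 : 0 ≤ H2 + 1 / (2 * (2 * s ^ 2)) * H := by linarith
    positivity
  have e : E * K * (G + L * s * H) + E * (d * G2 + c * G1 + (L * (1 / (2 * s)) * H + L * s * (2 * H2 + c * H1)))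
     - (d * (E * (G2 + L * s * H2)) + c * (E * (G1 + L * s * H1)) + K * (E * (G + L * s * H)) + E * (L * d / (4 * s) * H))
     = E * L * ((2 - d) * s * (H2 + 1 / (2 * (2 * s ^ 2)) * H)) := by
    field_simp
    ring
  linarith

lemma SB_nonneg {d K L c τ1 : ℝ} {n : ℝ → ℝ} (hn0 : ∀ y, 0 ≤ n y) (hd : 0 < d)
    (hL : 0 ≤ L) {t : ℝ} (hτ : 0 < t + τ1) (x : ℝ) : 0 ≤ SB d K L c τ1 n t x := by
  unfold SB
  have h1 := Hm_nonneg (Y := id) hn0 (mul_pos hd hτ) (x + c * t)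
  have h2 := Hm_nonneg (Y := id) hn0 (mul_pos two_pos hτ) (x + c * t)
  positivity

lemma SB_le {d K L c τ1 G1 G2 : ℝ} {n : ℝ → ℝ} (hK : 0 ≤ K) (hL : 0 ≤ L) {t x : ℝ} (ht : t ≤ 1)
    (hτ : t + τ1 ≤ 2)
    (h1 : HmK gk n id (d * (t + τ1)) (x + c * t) ≤ G1)
    (h2 : HmK gk n id (2 * (t + τ1)) (x + c * t) ≤ G2) (hG1 : 0 ≤ G1) (hG2 : 0 ≤ G2)
    (h20 : 0 ≤ HmK gk n id (2 * (t + τ1)) (x + c * t)) :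
    SB d K L c τ1 n t x ≤ exp K * (G1 + L * 2 * G2) := by
  unfold SB
  have hs : sqrt (t + τ1) ≤ 2 := by
    rw [Real.sqrt_le_left (by norm_num)]; linarith
  have h3 : exp (K * t) ≤ exp K := exp_le_exp.2 (by nlinarith)
  calc _ ≤ exp (K * t) * (G1 + L * 2 * G2) := by gcongr
    _ ≤ _ := by gcongr

lemma s1P {a b σ r K L Ux Vx t τ1 E H Pb Qb c a0 a1 a2 : ℝ} (ha0 : 0 < a) (ha1 : a < 1) (hb : 1 < b) (hσ : 0 < σ) (hr : 0 < r)
    (hU : 0 < Ux ∧ Ux < 1) (hV : 0 < Vx ∧ Vx < 1) (hK : K = 4 + r * (2 + 2 * b))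
    (hL : L = 8 * sqrt (2 / σ) + 16 * r * b / σ) (hp : 0 < t + τ1) (hp2 : t + τ1 ≤ 2)
    (hE : 0 < E) (hH : 0 ≤ H) (hP : 0 ≤ Pb ∧ Pb ≤ 1) (hQ : 0 ≤ Qb ∧ Qb ≤ 1)
    (hQc : Qb ≤ E * (sqrt (2 / σ) * H + L * sqrt (t + τ1) * H))
    (hPl : E * (L * sqrt (t + τ1) * H) ≤ Pb)
    (hle : 1 * a2 + c * a1 + K * Pb + E * (L * 1 / (4 * sqrt (t + τ1)) * H) ≤ a0) :
    1 * a2 + c * a1 + Pb * (1 - 2 * Ux - a * Vx) + a * Ux * Qb + Pb * (a * Qb + Pb) ≤ a0 := by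
  obtain ⟨hU0, hU1⟩ := hU
  obtain ⟨hV0, hV1⟩ := hV
  have hs : 0 < sqrt (t + τ1) := sqrt_pos.2 hp
  have hs2 : sqrt (t + τ1) ≤ 2 := by
    rw [Real.sqrt_le_left (by norm_num)]; linarith
  set s := sqrt (t + τ1) with hsd
  have hLs : sqrt (2 / σ) ≤ L * 1 / (4 * s) := by
    rw [le_div_iff₀ (by positivity), hL]
    have h1 : 0 ≤ sqrt (2 / σ) := Real.sqrt_nonneg _
    have h2 : 0 ≤ 16 * r * b / σ := by positivity
    nlinarith
  have h1 : E * (sqrt (2 / σ) * H) ≤ E * (L * 1 / (4 * s) * H) := by gcongr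
  have hKP : 4 * Pb ≤ K * Pb := by
    have : 4 ≤ K := by rw [hK]; nlinarith
    gcongr; exact hP.1
  have haV : 0 < a * Vx := by positivity
  have haU : a * Ux ≤ 1 := by nlinarith
  have haU0 : 0 ≤ a * Ux := by positivity
  have i1 : Pb * (1 - 2 * Ux - a * Vx) ≤ Pb := by nlinarith [hP.1]
  have i2 : a * Ux * Qb ≤ Qb := by nlinarith [hQ.1]
  have i3 : Pb * (a * Qb + Pb) ≤ Pb * 2 := by
    have : a * Qb + Pb ≤ 2 := by nlinarith [hP.2, hQ.2, hQ.1]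
    exact mnl this hP.1
  have h3 : E * (sqrt (2 / σ) * H + L * s * H) = E * (sqrt (2 / σ) * H) + E * (L * s * H) := by ring
  linarith

lemma s1Q {b σ r K L Ux Vx t τ1 E H Pb Qb c a0 a1 a2 : ℝ} (hb : 1 < b) (hσ : 0 < σ) (hr : 0 < r)
    (hU : 0 < Ux ∧ Ux < 1) (hV : 0 < Vx ∧ Vx < 1) (hK : K = 4 + r * (2 + 2 * b))
    (hL : L = 8 * sqrt (2 / σ) + 16 * r * b / σ) (hp : 0 < t + τ1) (hp2 : t + τ1 ≤ 2)
    (hE : 0 < E) (hH : 0 ≤ H) (hP : 0 ≤ Pb ∧ Pb ≤ 1) (hQ : 0 ≤ Qb ∧ Qb ≤ 1)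
    (hPc : Pb ≤ E * (sqrt (2 / 1) * H + L * sqrt (t + τ1) * H))
    (hQl : E * (L * sqrt (t + τ1) * H) ≤ Qb)
    (hle : σ * a2 + c * a1 + K * Qb + E * (L * σ / (4 * sqrt (t + τ1)) * H) ≤ a0) :
    σ * a2 + c * a1 + Qb * (r * (1 - b * Ux - 2 * Vx)) + r * b * Vx * Pb + Qb * (r * (Qb + b * Pb)) ≤ a0 := by
  obtain ⟨hU0, hU1⟩ := hU
  obtain ⟨hV0, hV1⟩ := hV
  have hs : 0 < sqrt (t + τ1) := sqrt_pos.2 hp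
  have hs2 : sqrt (t + τ1) ≤ 2 := by
    rw [Real.sqrt_le_left (by norm_num)]; linarith
  set s := sqrt (t + τ1) with hsd
  have hsq2 : sqrt (2 / 1) ≤ 2 := by
    rw [Real.sqrt_le_left (by norm_num)]; norm_num
  have hLs : r * b * 2 ≤ L * σ / (4 * s) := by
    rw [le_div_iff₀ (by positivity), hL, add_mul]
    have h2 : 16 * r * b / σ * σ = 16 * (r * b) := by field_simp
    have h1 : 0 ≤ 8 * sqrt (2 / σ) * σ := by positivity
    have h3 : r * b * 2 * (4 * s) ≤ r * b * 2 * (4 * 2) := by gcongr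
    rw [h2]; linarith
  have h1 : E * (r * b * 2 * H) ≤ E * (L * σ / (4 * s) * H) := by gcongr
  have hKQ : (r * (2 + b) + r * b) * Qb ≤ K * Qb := by
    have : r * (2 + b) + r * b ≤ K := by rw [hK]; nlinarith
    gcongr; exact hQ.1
  have hbU : 0 < b * Ux := by positivity
  have i1 : Qb * (r * (1 - b * Ux - 2 * Vx)) ≤ Qb * r := by
    apply mnl _ hQ.1
    nlinarith
  have i2 : r * b * Vx * Pb ≤ r * b * Pb := by
    have : r * b * Vx ≤ r * b := by nlinarith [mul_pos hr (by linarith : 0 < b)]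
    exact mnr this hP.1
  have i3 : Qb * (r * (Qb + b * Pb)) ≤ Qb * (r * (1 + b)) := by
    apply mnl _ hQ.1
    apply mnl _ hr.le
    nlinarith [hP.2, hQ.2]
  have i4 : sqrt (2 / 1) * H ≤ 2 * H := by gcongr
  have i5 : r * b * Pb ≤ r * b * (E * (2 * H + L * s * H)) := by
    apply mnl _ (by positivity)
    refine hPc.trans ?_
    gcongr
  have i6 : r * b * (E * (L * s * H)) ≤ r * b * Qb := by
    gcongr
  have h3 : r * b * (E * (2 * H + L * s * H)) = E * (r * b * 2 * H) + r * b * (E * (L * s * H)) := by ring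
  linarith

lemma step1_raw {a b σ r c B T : ℝ} {U V : ℝ → ℝ} {P Q : ℝ → ℝ → ℝ} (h : PQ a b σ r c B T U V P Q)
    (ha0 : 0 < a) (ha1 : a < 1) (hb : 1 < b) (hσ : 0 < σ) (hσ2 : σ < 2) (hr : 0 < r)
    (hU : ∀ x, 0 < U x ∧ U x < 1) (hV : ∀ x, 0 < V x ∧ V x < 1) (hB0 : 0 ≤ B) (hT1 : T ≤ 1) (hT0 : 0 ≤ T)
    {K L N0 : ℝ} {n : ℝ → ℝ} (hK : K = 4 + r * (2 + 2 * b))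
    (hL : L = 8 * sqrt (2 / σ) + 16 * r * b / σ) (hnd : ∀ y, n y = |P 0 y| + |Q 0 y|)
    (hn : Integrable n) (hN0 : ∀ y, n y ≤ N0) (hsmall : exp K * (N0 + L * 2 * N0) ≤ 1)
    {δ : ℝ} (hδ : 0 < δ) :
    ∃ τ1 > 0, τ1 ≤ 1 ∧ ∀ t ∈ Icc 0 T, ∀ x,
      |P t x| ≤ SB 1 K L c τ1 n t x + δ * exp ((20 + σ + |c| + 10 * r + 10 * r * b + 2 * B + r * (1 + b) * B) * (t - 0)) * cosh x ∧
      |Q t x| ≤ SB σ K L c τ1 n t x + δ * exp ((20 + σ + |c| + 10 * r + 10 * r * b + 2 * B + r * (1 + b) * B) * (t - 0)) * cosh x := by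
  have h0I : (0:ℝ) ∈ Icc 0 T := ⟨le_rfl, hT0⟩
  have hnc : Continuous n := by
    rw [funext hnd]
    exact ((h.dP 0 h0I).continuous.abs).add ((h.dQ 0 h0I).continuous.abs)
  have hn0 : ∀ y, 0 ≤ n y := fun y => by rw [hnd]; positivity
  have hN00 : 0 ≤ N0 := (hn0 0).trans (hN0 0)
  have hL0 : 0 ≤ L := by rw [hL]; positivity
  have hK0 : 0 ≤ K := by rw [hK]; positivity
  obtain ⟨N, hN⟩ : ∃ N : ℝ, N0 < δ * N ∧ 0 ≤ N := by
    refine ⟨(N0 + 1) / δ, ?_, by positivity⟩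
    rw [mul_div_cancel₀ _ hδ.ne']; linarith
  obtain ⟨τ2, hτ2, happ⟩ := Hm_approx hn hnc hN0 hn0 N (δ / 2) (by positivity)
  set τ1 := min 1 (τ2 / 2) with hτ1
  have hτ1p : 0 < τ1 := lt_min one_pos (by positivity)
  have hτ1a : τ1 ≤ 1 := min_le_left _ _
  have hτ1b : τ1 ≤ τ2 / 2 := min_le_right _ _
  have hlam : ∀ x y, n y ≤ N0 * exp (0 * |x - y|) := fun x y => by simpa using hN0 y
  have hHN : ∀ τ > 0, ∀ x, HmK gk n id τ x ≤ N0 := by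
    intro τ hτ x
    unfold HmK
    obtain ⟨hi, he⟩ := gk_shift_int hτ x
    calc ∫ y, n y * gk τ (x - id y) ≤ ∫ y, N0 * gk τ (x - y) := by
          refine integral_mono (HmK_integrable KB_gk hn continuous_id hτ x) (hi.const_mul _) fun y => ?_
          have := gk_pos hτ (x - y)
          have := hN0 y
          simp only [id]; gcongr
      _ = N0 := by rw [integral_const_mul, he, mul_one]
  have hcosh : ∀ x, N ≤ |x| → N ≤ cosh x := by
    intro x h1
    have h2 : |x| ≤ cosh x := by
      rw [← Real.cosh_abs, Real.cosh_eq]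
      have h4 := Real.quadratic_le_exp_of_nonneg (abs_nonneg x)
      have h5 := add_one_le_exp (-|x|)
      nlinarith [sq_nonneg (|x| - 2), abs_nonneg x, sq_nonneg (|x|-1)]
    linarith
  have hini : ∀ d, 0 < d → d ≤ 2 → ∀ x, n x < SB d K L c τ1 n 0 x + δ * cosh x := by
    intro d hd hd2 x
    have h1 : HmK gk n id (d * τ1) x ≤ SB d K L c τ1 n 0 x := by
      unfold SB
      have := Hm_nonneg (Y := id) hn0 (by positivity : 0 < 2 * τ1) x
      simp only [mul_zero, exp_zero, one_mul, zero_add, add_zero]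
      have h3 : 0 ≤ L * sqrt τ1 * HmK gk n id (2 * τ1) x := by positivity
      linarith
    have hc1 := Real.one_le_cosh x
    rcases le_total |x| N with hx | hx
    · have h2 := happ (d * τ1) (by positivity) (by nlinarith) x hx
      nlinarith
    · have h2 := hcosh x hx
      have h3 := hN0 x
      have h4 := Hm_nonneg (Y := id) hn0 (by positivity : 0 < d * τ1) x
      have h5 : δ * N ≤ δ * cosh x := by gcongr
      linarith
  have h01 : ∀ d, 0 < d → ∀ t ∈ Icc 0 T, ∀ x, 0 ≤ SB d K L c τ1 n t x ∧ SB d K L c τ1 n t x ≤ 1 := by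
    intro d hd t ht x
    have hp : 0 < t + τ1 := by linarith [ht.1]
    refine ⟨SB_nonneg hn0 hd hL0 hp x, ?_⟩
    refine (SB_le hK0 hL0 (ht.2.trans hT1) (by linarith [ht.2]) (hHN _ (by positivity) _) (hHN _ (by positivity) _) hN00 hN00 (Hm_nonneg hn0 (by positivity) _)).trans hsmall
  have hcomp : ∀ d, 0 < d → d ≤ 2 → ∀ t ∈ Ioc 0 T, ∀ x,
      SB d K L c τ1 n t x ≤ exp (K * t) * (sqrt (2 / d) * HmK gk n id (2 * (t + τ1)) (x + c * t) + L * sqrt (t + τ1) * HmK gk n id (2 * (t + τ1)) (x + c * t)) := by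
    intro d hd hd2 t ht x
    unfold SB
    have hp : 0 < t + τ1 := by linarith [ht.1]
    have h1 := Hm_mono hn continuous_id hn0 (mul_pos hd hp) (by gcongr : d * (t + τ1) ≤ 2 * (t + τ1)) (x + c * t)
    have : 2 * (t + τ1) / (d * (t + τ1)) = 2 / d := by field_simp
    rw [this] at h1
    gcongr
  refine ⟨τ1, hτ1p, hτ1a, CL h ha0 ha1 hb hσ hr hU hV le_rfl
    (fun t ht x => SB_cont hn one_pos (by linarith [ht.1]) x)
    (fun t ht x => SB_cont hn hσ (by linarith [ht.1]) x)
    (h01 1 one_pos) (h01 σ hσ) ?_ ?_ hδ ?_ ?_ hB0⟩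
  · intro t ht x
    have htI := Ioc_subset_Icc_self ht
    have hp : 0 < t + τ1 := by linarith [ht.1]
    obtain ⟨a0, a1, a2, hm, hle⟩ := SB_maj (K := K) (L := L) (c := c) hn hn0 one_pos one_le_two hL0 hp x
    refine ⟨a0, a1, a2, hm, ?_⟩
    have hP := h01 1 one_pos t htI x
    have hQ := h01 σ hσ t htI x
    have hQc := hcomp σ hσ hσ2.le t ht x
    have hPl : exp (K * t) * (L * sqrt (t + τ1) * HmK gk n id (2 * (t + τ1)) (x + c * t)) ≤ SB 1 K L c τ1 n t x := by
      unfold SB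
      have := Hm_nonneg (Y := id) hn0 (by positivity : 0 < 1 * (t + τ1)) (x + c * t)
      gcongr; linarith
    have hH := Hm_nonneg (Y := id) hn0 (by positivity : 0 < 2 * (t + τ1)) (x + c * t)
    exact s1P ha0 ha1 hb hσ hr (hU x) (hV x) hK hL hp (by linarith [ht.2]) (exp_pos _) hH hP hQ hQc hPl hle
  · intro t ht x
    have htI := Ioc_subset_Icc_self ht
    have hp : 0 < t + τ1 := by linarith [ht.1]
    obtain ⟨a0, a1, a2, hm, hle⟩ := SB_maj (K := K) (L := L) (c := c) hn hn0 hσ hσ2.le hL0 hp x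
    refine ⟨a0, a1, a2, hm, ?_⟩
    have hP := h01 1 one_pos t htI x
    have hQ := h01 σ hσ t htI x
    have hPc := hcomp 1 one_pos one_le_two t ht x
    have hQl : exp (K * t) * (L * sqrt (t + τ1) * HmK gk n id (2 * (t + τ1)) (x + c * t)) ≤ SB σ K L c τ1 n t x := by
      unfold SB
      have := Hm_nonneg (Y := id) hn0 (by positivity : 0 < σ * (t + τ1)) (x + c * t)
      gcongr; linarith
    have hH := Hm_nonneg (Y := id) hn0 (by positivity : 0 < 2 * (t + τ1)) (x + c * t)
    exact s1Q hb hσ hr (hU x) (hV x) hK hL hp (by linarith [ht.2]) (exp_pos _) hH hP hQ hPc hQl hle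
  · intro x
    have := hini 1 one_pos one_le_two x
    have h2 := hnd x
    linarith [abs_nonneg (Q 0 x)]
  · intro x
    have := hini σ hσ hσ2.le x
    have h2 := hnd x
    linarith [abs_nonneg (P 0 x)]

lemma lim_eps {X G A : ℝ} (hA : 0 ≤ A) (h : ∀ δ > 0, X ≤ G + δ * A) : X ≤ G := by
  refine le_of_forall_pos_le_add fun e he => ?_
  have := h (e / (A + 1)) (by positivity)
  have h2 : e / (A + 1) * A ≤ e := by
    rw [div_mul_eq_mul_div, div_le_iff₀ (by positivity)]; nlinarith
  linarith

lemma step1_lim {a b σ r c B T : ℝ} {U V : ℝ → ℝ} {P Q : ℝ → ℝ → ℝ} (h : PQ a b σ r c B T U V P Q)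
    (ha0 : 0 < a) (ha1 : a < 1) (hb : 1 < b) (hσ : 0 < σ) (hσ2 : σ < 2) (hr : 0 < r)
    (hU : ∀ x, 0 < U x ∧ U x < 1) (hV : ∀ x, 0 < V x ∧ V x < 1) (hB0 : 0 ≤ B) (hT1 : T ≤ 1) (hT0 : 0 ≤ T)
    {K L N0 : ℝ} {n : ℝ → ℝ} (hK : K = 4 + r * (2 + 2 * b))
    (hL : L = 8 * sqrt (2 / σ) + 16 * r * b / σ) (hnd : ∀ y, n y = |P 0 y| + |Q 0 y|)
    (hn : Integrable n) (hN0 : ∀ y, n y ≤ N0) (hsmall : exp K * (N0 + L * 2 * N0) ≤ 1)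
    {t x G : ℝ} (ht : t ∈ Icc 0 T) (hG0 : 0 ≤ G)
    (hG : ∀ d, min 1 σ ≤ d → d ≤ 2 → ∀ τ1 > 0, τ1 ≤ 1 → HmK gk n id (d * (t + τ1)) (x + c * t) ≤ G) :
    |P t x| ≤ exp K * (1 + L * 2) * G ∧ |Q t x| ≤ exp K * (1 + L * 2) * G := by
  have hL0 : 0 ≤ L := by rw [hL]; positivity
  have hK0 : 0 ≤ K := by rw [hK]; positivity
  have hn0 : ∀ y, 0 ≤ n y := fun y => by rw [hnd]; positivity
  have key : ∀ d, min 1 σ ≤ d → d ≤ 2 → ∀ τ1 > 0, τ1 ≤ 1 → SB d K L c τ1 n t x ≤ exp K * (1 + L * 2) * G := by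
    intro d hd hd2 τ1 h1 h2
    have := ht.1
    have := SB_le (d := d) (c := c) (τ1 := τ1) (n := n) hK0 hL0 (ht.2.trans hT1) (by linarith [ht.2]) (hG d hd hd2 τ1 h1 h2)
      (hG 2 (by have := min_le_left 1 σ; linarith) le_rfl τ1 h1 h2) hG0 hG0
      (Hm_nonneg hn0 (by positivity) _)
    linarith
  constructor
  · refine lim_eps (A := exp ((20 + σ + |c| + 10 * r + 10 * r * b + 2 * B + r * (1 + b) * B) * (t - 0)) * cosh x) (by have := cosh_pos x; positivity) fun δ hδ => ?_
    obtain ⟨τ1, h1, h2, h3⟩ := step1_raw h ha0 ha1 hb hσ hσ2 hr hU hV hB0 hT1 hT0 hK hL hnd hn hN0 hsmall hδ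
    have := (h3 t ht x).1
    have := key 1 (min_le_left _ _) one_le_two τ1 h1 h2
    linarith
  · refine lim_eps (A := exp ((20 + σ + |c| + 10 * r + 10 * r * b + 2 * B + r * (1 + b) * B) * (t - 0)) * cosh x) (by have := cosh_pos x; positivity) fun δ hδ => ?_
    obtain ⟨τ1, h1, h2, h3⟩ := step1_raw h ha0 ha1 hb hσ hσ2 hr hU hV hB0 hT1 hT0 hK hL hnd hn hN0 hsmall hδ
    have := (h3 t ht x).2
    have := key σ (min_le_right _ _) hσ2.le τ1 h1 h2
    linarith

theorem step1 {a b σ r c : ℝ} {U V : ℝ → ℝ}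
    (ha0 : 0 < a) (ha1 : a < 1) (hb : 1 < b) (hσ : 0 < σ) (hσ2 : σ < 2) (hr : 0 < r)
    (hU : ∀ x, 0 < U x ∧ U x < 1) (hV : ∀ x, 0 < V x ∧ V x < 1) (lam : ℝ) (hlam : 0 ≤ lam) :
    ∃ C1 > 0, ∀ B T : ℝ, ∀ P Q : ℝ → ℝ → ℝ, PQ a b σ r c B T U V P Q → 0 ≤ B → T ≤ 1 → 0 ≤ T →
      Integrable (fun y => |P 0 y| + |Q 0 y|) → ∀ N0 : ℝ, (∀ y, |P 0 y| + |Q 0 y| ≤ N0) → C1 * N0 ≤ 1 →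
      (∀ t ∈ Icc 0 T, ∀ x A, 0 ≤ A → (∀ y, |P 0 y| + |Q 0 y| ≤ A * exp (lam * |x - y|)) →
        |P t x| ≤ C1 * A ∧ |Q t x| ≤ C1 * A) ∧
      (T = 1 → ∀ x, |P 1 x| ≤ C1 * ∫ y, (|P 0 y| + |Q 0 y|) * exp (-(x - y) ^ 2 / 32) ∧
        |Q 1 x| ≤ C1 * ∫ y, (|P 0 y| + |Q 0 y|) * exp (-(x - y) ^ 2 / 32)) := by
  obtain ⟨K, hK⟩ : ∃ K : ℝ, K = 4 + r * (2 + 2 * b) := ⟨_, rfl⟩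
  obtain ⟨L, hL⟩ : ∃ L : ℝ, L = 8 * sqrt (2 / σ) + 16 * r * b / σ := ⟨_, rfl⟩
  have hL0 : 0 ≤ L := by rw [hL]; positivity
  set m0 := min 1 σ with hm0
  have hm : 0 < m0 := lt_min one_pos hσ
  set E := exp K * (1 + L * 2) with hE
  have hE0 : 0 < E := by positivity
  set F := 1 + 2 * exp (2 * lam ^ 2 * 4) * exp (lam * |c|) + (sqrt m0)⁻¹ * exp (c ^ 2 / 16) with hF
  have hF1 : 1 ≤ F := by rw [hF]; have : 0 ≤ 2 * exp (2 * lam ^ 2 * 4) * exp (lam * |c|) := by positivity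
                         have : 0 ≤ (sqrt m0)⁻¹ * exp (c ^ 2 / 16) := by positivity
                         linarith
  refine ⟨E * F, by positivity, ?_⟩
  intro B T P Q h hB0 hT1 hT0 hn N0 hN0 hs
  have hN00 : 0 ≤ N0 := le_trans (by positivity) (hN0 0)
  have hsmall : exp K * (N0 + L * 2 * N0) ≤ 1 := by
    have : E * N0 ≤ E * F * N0 := by
      have := mnl hF1 (by positivity : 0 ≤ E * N0); linarith
    have e : exp K * (N0 + L * 2 * N0) = E * N0 := by rw [hE]; ring
    linarith
  constructor
  · intro t ht x A hA hexp
    have hG0 : 0 ≤ F * A := by positivity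
    have := step1_lim h ha0 ha1 hb hσ hσ2 hr hU hV hB0 hT1 hT0 hK hL (fun y => rfl) hn hN0 hsmall ht (x := x) hG0 (by
      intro d hd hd2 τ1 h1 h2
      have hd0 : 0 < d := hm.trans_le hd
      have ht0 := ht.1
      have hb1 := Hm_exp_bound (lam := lam) (τ := d * (t + τ1)) (x := x + c * t) (A := A * exp (lam * |c|)) hn
        (by positivity) (fun y => by
          refine (hexp y).trans ?_
          rw [mul_assoc, ← exp_add]
          have : |x - y| ≤ |c| + |x + c * t - y| := by
            have h3 : |c * t| ≤ |c| := by
              rw [abs_mul, abs_of_nonneg ht0]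
              exact mul_le_of_le_one_right (abs_nonneg c) (ht.2.trans hT1)
            have h4 : x - y = (x + c * t - y) - c * t := by ring
            rw [h4]
            have := abs_sub (x + c * t - y) (c * t)
            linarith
          gcongr
          rw [← mul_add]; gcongr) (by positivity)
      refine hb1.trans ?_
      have h5 : exp (2 * lam ^ 2 * (d * (t + τ1))) ≤ exp (2 * lam ^ 2 * 4) := by
        have : d * (t + τ1) ≤ 4 := by nlinarith [ht.2]
        gcongr
      calc 2 * (A * exp (lam * |c|)) * exp (2 * lam ^ 2 * (d * (t + τ1)))
          ≤ 2 * (A * exp (lam * |c|)) * exp (2 * lam ^ 2 * 4) := by gcongr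
        _ = (2 * exp (2 * lam ^ 2 * 4) * exp (lam * |c|)) * A := by ring
        _ ≤ F * A := by
          gcongr
          have : 0 ≤ (sqrt m0)⁻¹ * exp (c ^ 2 / 16) := by positivity
          rw [hF]; linarith)
    rw [mul_assoc]; exact this
  · intro hT x
    subst hT
    set n : ℝ → ℝ := fun y => |P 0 y| + |Q 0 y| with hnd
    have hn0 : ∀ y, 0 ≤ n y := fun y => by simp only [hnd]; positivity
    set I := ∫ y, n y * exp (-(x - y) ^ 2 / 32) with hI
    have hI0 : 0 ≤ I := integral_nonneg fun y => mul_nonneg (hn0 y) (exp_pos _).le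
    have hint : Integrable (fun y => n y * exp (-(x - y) ^ 2 / 32)) := by
      refine hn.mono ?_ (Eventually.of_forall fun y => ?_)
      · exact hn.aestronglyMeasurable.mul (by fun_prop : Continuous fun y => exp (-(x - y) ^ 2 / 32)).aestronglyMeasurable
      · rw [norm_mul]
        have : ‖exp (-(x - y) ^ 2 / 32)‖ ≤ 1 := by
          rw [Real.norm_eq_abs, Real.abs_exp, exp_le_one_iff]
          have := sq_nonneg (x - y); linarith
        exact mul_le_of_le_one_right (norm_nonneg _) this
    have hG0 : 0 ≤ F * I := by positivity
    have := step1_lim h ha0 ha1 hb hσ hσ2 hr hU hV hB0 le_rfl hT0 hK hL (fun y => rfl) hn hN0 hsmall (t := 1) ⟨zero_le_one, le_rfl⟩ (x := x) hG0 (by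
      intro d hd hd2 τ1 h1 h2
      have hd0 : 0 < d := hm.trans_le hd
      unfold HmK
      rw [hI, ← integral_const_mul]
      refine integral_mono (HmK_integrable KB_gk hn continuous_id (by positivity) _) (hint.const_mul _) fun y => ?_
      have hm1 : m0 ≤ d * (1 + τ1) := by nlinarith
      have hd4 : d * (1 + τ1) ≤ 4 := by nlinarith
      have hg : gk (d * (1 + τ1)) (x + c * 1 - y) ≤ F * exp (-(x - y) ^ 2 / 32) := by
        unfold gk
        have e1 := sqrt4pi_inv_le hm hm1
        have e2 : exp (-(x + c * 1 - y) ^ 2 / (4 * (d * (1 + τ1)))) ≤ exp (c ^ 2 / 16) * exp (-(x - y) ^ 2 / 32) := by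
          rw [← exp_add]
          apply exp_le_exp.2
          have p : (x + c * 1 - y) ^ 2 / 16 ≤ (x + c * 1 - y) ^ 2 / (4 * (d * (1 + τ1))) := by
            apply div_le_div_of_nonneg_left (sq_nonneg _) (by positivity); linarith
          have : (x - y) ^ 2 ≤ 2 * (x + c * 1 - y) ^ 2 + 2 * c ^ 2 := by nlinarith [sq_nonneg ((x + c * 1 - y) + c)]
          rw [neg_div]; linarith
        calc _ ≤ (sqrt m0)⁻¹ * (exp (c ^ 2 / 16) * exp (-(x - y) ^ 2 / 32)) := by gcongr
          _ = ((sqrt m0)⁻¹ * exp (c ^ 2 / 16)) * exp (-(x - y) ^ 2 / 32) := by ring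
          _ ≤ _ := by
            gcongr
            have : 0 ≤ 2 * exp (2 * lam ^ 2 * 4) * exp (lam * |c|) := by positivity
            rw [hF]; linarith
      calc n y * gk (d * (1 + τ1)) (x + c * 1 - id y) ≤ n y * (F * exp (-(x - y) ^ 2 / 32)) :=
            mnl hg (hn0 y)
        _ = _ := by ring)
    rw [mul_assoc]; exact this

structure Front (a b σ r γ δ : ℝ) (U V : ℝ → ℝ) : Prop where
  a0 : 0 < a
  a1 : a < 1
  b1 : 1 < b
  s0 : 0 < σ
  s2 : σ < 2
  r0 : 0 < r
  g0 : 0 < γ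
  g2 : γ ^ 2 = 1 - a
  d0 : 0 < δ
  d1 : δ ^ 2 + 2 * γ * δ < 1
  d2 : σ * δ ^ 2 + 2 * γ * δ < r * (b - 1)
  Ur : ContDiff ℝ 2 U
  Vr : ContDiff ℝ 2 V
  Uo : ∀ x, deriv (deriv U) x + 2 * γ * deriv U x + U x * (1 - U x - a * V x) = 0
  Vo : ∀ x, σ * deriv (deriv V) x + 2 * γ * deriv V x + r * V x * (1 - b * U x - V x) = 0
  Ub : Tendsto U atBot (𝓝 1)
  Vb : Tendsto V atBot (𝓝 0)
  U01 : ∀ x, 0 < U x ∧ U x < 1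
  V01 : ∀ x, 0 < V x ∧ V x < 1
  Ud : ∀ x, deriv U x < 0
  Vd : ∀ x, 0 < deriv V x

lemma d1_bdd {w : ℝ → ℝ} {d c F : ℝ} (hw : ContDiff ℝ 2 w) (hd : 0 < d) (hc : 0 < c)
    (h1 : ∀ x, |w x| ≤ 1) (hF : ∀ x, |d * deriv (deriv w) x + c * deriv w x| ≤ F) (x : ℝ) :
    |deriv w x| ≤ exp (c / d) * (2 + F / d) := by
  have hF0 : 0 ≤ F := (abs_nonneg _).trans (hF 0)
  obtain ⟨ξ, hξ, he⟩ := exists_deriv_eq_slope w (show x < x + 1 by linarith) hw.continuous.continuousOn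
    (fun y _ => (cd2_d1 hw y).differentiableAt.differentiableWithinAt)
  have hs : |deriv w ξ| ≤ 2 := by
    rw [he, add_sub_cancel_left, div_one]
    have := abs_sub (w (x + 1)) (w x); linarith [h1 x, h1 (x + 1)]
  have hg : ∀ s, HasDerivAt (fun s => exp (c / d * s) * deriv w s)
      (exp (c / d * s) * ((d * deriv (deriv w) s + c * deriv w s) / d)) s := by
    intro s
    have e1 : HasDerivAt (fun s => exp (c / d * s)) (exp (c / d * s) * (c / d)) s := by
      simpa using ((hasDerivAt_id s).const_mul (c / d)).exp
    refine (e1.mul (cd2_d2 hw s)).congr_deriv ?_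
    field_simp
    ring
  have hk : 0 < c / d := by positivity
  have hb : ∀ s ∈ Icc x (x + 1), ‖exp (c / d * s) * ((d * deriv (deriv w) s + c * deriv w s) / d)‖
      ≤ exp (c / d * (x + 1)) * (F / d) := by
    intro s hs
    rw [norm_mul, Real.norm_eq_abs, Real.abs_exp, Real.norm_eq_abs, abs_div, abs_of_pos hd]
    have := hF s
    have := hs.2
    gcongr
  have hmv := Convex.norm_image_sub_le_of_norm_hasDerivWithin_le
    (fun s _ => (hg s).hasDerivWithinAt) hb (convex_Icc x (x + 1))
    (show ξ ∈ Icc x (x + 1) from Ioo_subset_Icc_self hξ) (show x ∈ Icc x (x + 1) from ⟨le_rfl, by linarith⟩)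
  have hx1 : ‖x - ξ‖ ≤ 1 := by
    rw [Real.norm_eq_abs, abs_le]; constructor <;> linarith [hξ.1, hξ.2]
  have h2 : |exp (c / d * x) * deriv w x - exp (c / d * ξ) * deriv w ξ| ≤ exp (c / d * (x + 1)) * (F / d) := by
    rw [← Real.norm_eq_abs]
    refine hmv.trans ?_
    exact mul_le_of_le_one_right (by positivity) hx1
  have h3 : |exp (c / d * ξ) * deriv w ξ| ≤ exp (c / d * (x + 1)) * 2 := by
    rw [abs_mul, Real.abs_exp]
    have := hξ.2.le
    gcongr
  have h4 : |exp (c / d * x) * deriv w x| ≤ exp (c / d * (x + 1)) * (2 + F / d) := by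
    have := abs_sub_abs_le_abs_sub (exp (c / d * x) * deriv w x) (exp (c / d * ξ) * deriv w ξ)
    rw [mul_add]; linarith
  have e : exp (c / d * (x + 1)) = exp (c / d * x) * exp (c / d) := by
    rw [← exp_add]; congr 1; ring
  rw [abs_mul, Real.abs_exp, e, mul_assoc] at h4
  exact le_of_mul_le_mul_left h4 (exp_pos _)

namespace Front
variable {a b σ r γ δ : ℝ} {U V : ℝ → ℝ}

lemma U_bd (h : Front a b σ r γ δ U V) : ∃ C > 0, ∀ x, |deriv U x| ≤ C := by
  refine ⟨exp (2 * γ / 1) * (2 + 2 / 1), by positivity, d1_bdd h.Ur one_pos (by linarith [h.g0]) (fun x => ?_) (fun x => ?_)⟩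
  · rw [abs_le]; constructor <;> linarith [h.U01 x]
  · have e := h.Uo x
    obtain ⟨u0, u1⟩ := h.U01 x
    obtain ⟨v0, v1⟩ := h.V01 x
    have := h.a0; have := h.a1
    have av : a * V x < 1 := by nlinarith
    have av0 : 0 < a * V x := by positivity
    have : 1 * deriv (deriv U) x + 2 * γ * deriv U x = - (U x * (1 - U x - a * V x)) := by linarith
    rw [this, abs_neg, abs_le]; constructor <;> nlinarith

lemma V_bd (h : Front a b σ r γ δ U V) : ∃ C > 0, ∀ x, |deriv V x| ≤ C := by
  have hr := h.r0; have hb := h.b1; have hs := h.s0; have hg := h.g0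
  refine ⟨exp (2 * γ / σ) * (2 + (r * (2 + b)) / σ), by positivity, d1_bdd h.Vr h.s0 (by linarith [h.g0]) (fun x => ?_) (fun x => ?_)⟩
  · rw [abs_le]; constructor <;> linarith [h.V01 x]
  · have e := h.Vo x
    obtain ⟨u0, u1⟩ := h.U01 x
    obtain ⟨v0, v1⟩ := h.V01 x
    have : σ * deriv (deriv V) x + 2 * γ * deriv V x = - (r * V x * (1 - b * U x - V x)) := by linarith
    rw [this, abs_neg, abs_mul, abs_mul, abs_of_pos hr, abs_of_pos v0, mul_assoc]
    gcongr
    have bu : b * U x < b := by nlinarith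
    have bu0 : 0 < b * U x := by positivity
    have : |1 - b * U x - V x| ≤ 2 + b := by rw [abs_le]; constructor <;> linarith
    calc V x * |1 - b * U x - V x| ≤ 1 * (2 + b) := by gcongr
      _ = _ := one_mul _

lemma U3 (h : Front a b σ r γ δ U V) (x : ℝ) : HasDerivAt (deriv (deriv U))
    (-(2 * γ * deriv (deriv U) x + deriv U x * (1 - 2 * U x - a * V x) - a * U x * deriv V x)) x := by
  have e : deriv (deriv U) = fun x => -(2 * γ * deriv U x + U x * (1 - U x - a * V x)) := by
    ext y; linarith [h.Uo y]
  have h1 := cd2_d1 h.Ur x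
  have h2 := cd2_d2 h.Ur x
  have h3 := cd2_d1 h.Vr x
  have : HasDerivAt (fun x => -(2 * γ * deriv U x + U x * (1 - U x - a * V x)))
    (-(2 * γ * deriv (deriv U) x + (deriv U x * (1 - U x - a * V x) + U x * (0 - deriv U x - a * deriv V x)))) x :=
    ((h2.const_mul (2 * γ)).add (h1.mul (((hasDerivAt_const x 1).sub h1).sub (h3.const_mul a)))).neg
  have := this.congr_deriv (g' := -(2 * γ * deriv (deriv U) x + deriv U x * (1 - 2 * U x - a * V x) - a * U x * deriv V x)) (by ring)
  rw [← e] at this; exact this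

lemma V3 (h : Front a b σ r γ δ U V) (x : ℝ) : HasDerivAt (deriv (deriv V))
    (-(2 * γ * deriv (deriv V) x + deriv V x * (r * (1 - b * U x - 2 * V x)) - r * b * V x * deriv U x) / σ) x := by
  have hs := h.s0
  have e : deriv (deriv V) = fun x => -(2 * γ * deriv V x + r * V x * (1 - b * U x - V x)) / σ := by
    ext y; have := h.Vo y; field_simp; linarith
  have h1 := cd2_d1 h.Vr x
  have h2 := cd2_d2 h.Vr x
  have h3 := cd2_d1 h.Ur x
  have : HasDerivAt (fun x => -(2 * γ * deriv V x + r * V x * (1 - b * U x - V x)) / σ)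
    (-(2 * γ * deriv (deriv V) x + (r * deriv V x * (1 - b * U x - V x) + r * V x * (0 - b * deriv U x - deriv V x))) / σ) x :=
    ((h2.const_mul (2 * γ)).add ((h1.const_mul r).mul (((hasDerivAt_const x 1).sub (h3.const_mul b)).sub h1))).neg.div_const σ
  have := this.congr_deriv (g' := -(2 * γ * deriv (deriv V) x + deriv V x * (r * (1 - b * U x - 2 * V x)) - r * b * V x * deriv U x) / σ) (by congr 1; ring)
  rw [← e] at this; exact this

lemma left (h : Front a b σ r γ δ U V) : ∃ X A0 c0 : ℝ, 1 ≤ X ∧ 0 < A0 ∧ 0 < c0 ∧ ∀ x ≤ -X,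
    ((δ ^ 2 + 2 * γ * δ + 1 - 2 * U x - a * V x) * A0 + a * U x ≤ -c0) ∧
    (σ * δ ^ 2 + 2 * γ * δ + r * (1 - b * U x - 2 * V x) + r * b * V x * A0 ≤ -c0) ∧
    ((γ ^ 2 - 2 * γ * γ + 1 - 2 * U x - a * V x) * A0 + a * U x ≤ -c0) ∧
    (σ * γ ^ 2 - 2 * γ * γ + r * (1 - b * U x - 2 * V x) + r * b * V x * A0 ≤ -c0) := by
  have d1 := h.d1; have d2 := h.d2
  have ha := h.a0; have hg := h.g0; have hd := h.d0
  set A0 := 2 * a / (1 - δ ^ 2 - 2 * γ * δ) with hA0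
  have hk : 0 < 1 - δ ^ 2 - 2 * γ * δ := by linarith
  have hA : 0 < A0 := by positivity
  have hAe : (1 - δ ^ 2 - 2 * γ * δ) * A0 = 2 * a := by rw [hA0]; exact mul_div_cancel₀ _ hk.ne'
  have key : ∀ f : ℝ → ℝ, ∀ l, Tendsto f atBot (𝓝 l) → ∀ m, l < m → ∀ᶠ x in atBot, f x ≤ m := by
    intro f l hf m hm
    filter_upwards [hf.eventually (gt_mem_nhds hm)] with x hx using le_of_lt hx
  set c0 := min (a / 2) (min ((r * (b - 1) - (σ * δ ^ 2 + 2 * γ * δ)) / 2) (r * (b - 1) / 2)) with hc0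
  have hrb : 0 < r * (b - 1) := mul_pos h.r0 (by linarith [h.b1])
  have hc : 0 < c0 := lt_min (by positivity) (lt_min (by linarith) (by positivity))
  have hca : c0 ≤ a / 2 := min_le_left _ _
  have hcb : c0 ≤ (r * (b - 1) - (σ * δ ^ 2 + 2 * γ * δ)) / 2 := (min_le_right _ _).trans (min_le_left _ _)
  have hcc : c0 ≤ r * (b - 1) / 2 := (min_le_right _ _).trans (min_le_right _ _)
  have t1 : Tendsto (fun x => (δ ^ 2 + 2 * γ * δ + 1 - 2 * U x - a * V x) * A0 + a * U x) atBot
      (𝓝 ((δ ^ 2 + 2 * γ * δ + 1 - 2 * 1 - a * 0) * A0 + a * 1)) :=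
    (((tendsto_const_nhds.sub (h.Ub.const_mul 2)).sub (h.Vb.const_mul a)).mul_const A0).add (h.Ub.const_mul a)
  have t3 : Tendsto (fun x => (γ ^ 2 - 2 * γ * γ + 1 - 2 * U x - a * V x) * A0 + a * U x) atBot
      (𝓝 ((γ ^ 2 - 2 * γ * γ + 1 - 2 * 1 - a * 0) * A0 + a * 1)) :=
    (((tendsto_const_nhds.sub (h.Ub.const_mul 2)).sub (h.Vb.const_mul a)).mul_const A0).add (h.Ub.const_mul a)
  have t2 : Tendsto (fun x => σ * δ ^ 2 + 2 * γ * δ + r * (1 - b * U x - 2 * V x) + r * b * V x * A0) atBot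
      (𝓝 (σ * δ ^ 2 + 2 * γ * δ + r * (1 - b * 1 - 2 * 0) + r * b * 0 * A0)) :=
    (tendsto_const_nhds.add (((tendsto_const_nhds.sub (h.Ub.const_mul b)).sub (h.Vb.const_mul 2)).const_mul r)).add
      ((h.Vb.const_mul (r * b)).mul_const A0)
  have t4 : Tendsto (fun x => σ * γ ^ 2 - 2 * γ * γ + r * (1 - b * U x - 2 * V x) + r * b * V x * A0) atBot
      (𝓝 (σ * γ ^ 2 - 2 * γ * γ + r * (1 - b * 1 - 2 * 0) + r * b * 0 * A0)) :=
    (tendsto_const_nhds.add (((tendsto_const_nhds.sub (h.Ub.const_mul b)).sub (h.Vb.const_mul 2)).const_mul r)).add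
      ((h.Vb.const_mul (r * b)).mul_const A0)
  have hs2 := h.s2
  have := (key _ _ t1 (-c0) (by nlinarith)).and ((key _ _ t2 (-c0) (by linarith)).and
    ((key _ _ t3 (-c0) (by nlinarith [mul_pos hg hg, mul_pos (mul_pos hg hg) hA, mul_pos hd hA, mul_pos (mul_pos hg hd) hA, mul_pos (mul_pos hd hd) hA])).and (key _ _ t4 (-c0) (by nlinarith [mul_pos hg hg]))))
  obtain ⟨X0, hX0⟩ := eventually_atBot.1 this
  refine ⟨max 1 (-X0), A0, c0, le_max_left _ _, hA, hc, fun x hx => ?_⟩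
  have : x ≤ X0 := by linarith [le_max_right 1 (-X0)]
  exact hX0 x this

lemma exp1 (k x : ℝ) : HasDerivAt (fun x => exp (k * x)) (k * exp (k * x)) x := by
  have := ((hasDerivAt_id x).const_mul k).exp
  simpa [mul_comm] using this

lemma phi_left (h : Front a b σ r γ δ U V) : ∃ C > 0, ∀ x,
    -deriv U x ≤ C * exp (δ * x) ∧ deriv V x ≤ C * exp (δ * x) := by
  obtain ⟨X, A0, c0, hX, hA, hc, hL⟩ := h.left
  obtain ⟨CU, hCU, hUb⟩ := h.U_bd
  obtain ⟨CV, hCV, hVb⟩ := h.V_bd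
  have hg := h.g0
  set C := ((CU + CV) / A0 + (CU + CV)) * exp (δ * X) with hC
  have hC0 : 0 < C := by positivity
  have main : ∀ e > 0, ∀ x ≤ -X, -deriv U x ≤ A0 * (C * exp (δ * x) + e * exp (-γ * x)) ∧
      deriv V x ≤ C * exp (δ * x) + e * exp (-γ * x) := by
    intro e he
    set y : ℝ → ℝ := fun x => C * exp (δ * x) + e * exp (-γ * x) with hy
    have y0 : ∀ x, 0 < y x := fun x => by simp only [hy]; positivity
    set y1 : ℝ → ℝ := fun x => C * (δ * exp (δ * x)) + e * (-γ * exp (-γ * x)) with hy1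
    set y2 : ℝ → ℝ := fun x => C * (δ * (δ * exp (δ * x))) + e * (-γ * (-γ * exp (-γ * x))) with hy2
    have dy : ∀ x, HasDerivAt y (y1 x) x := fun x => ((exp1 δ x).const_mul C).add ((exp1 (-γ) x).const_mul e)
    have dy1 : ∀ x, HasDerivAt y1 (y2 x) x := fun x =>
      (((exp1 δ x).const_mul δ).const_mul C).add (((exp1 (-γ) x).const_mul (-γ)).const_mul e)
    have yc : Continuous y := by simp only [hy]; fun_prop
    set R : ℝ → ℝ := fun x => max (-deriv U x / (A0 * y x)) (deriv V x / y x) with hR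
    have hUc : Continuous (deriv U) := continuous_iff_continuousAt.2 fun x => (cd2_d2 h.Ur x).continuousAt
    have hVc : Continuous (deriv V) := continuous_iff_continuousAt.2 fun x => (cd2_d2 h.Vr x).continuousAt
    have Rc : Continuous R := by
      refine Continuous.max (hUc.neg.div (continuous_const.mul yc) fun x => ?_) (hVc.div yc fun x => (y0 x).ne')
      have := y0 x; positivity
    have crit : ∀ x k, 0 < k → (R x ≤ k ↔ -deriv U x ≤ k * (A0 * y x) ∧ deriv V x ≤ k * y x) := by
      intro x k _
      have := y0 x
      simp only [hR, max_le_iff]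
      rw [div_le_iff₀ (by positivity), div_le_iff₀ (y0 x)]
    have small : ∀ x, ((CU + CV) / A0 + (CU + CV)) ≤ y x → R x ≤ 1 := by
      intro x hx
      rw [crit x 1 one_pos, one_mul, one_mul]
      have h1 := hUb x
      have h2 := hVb x
      have h3 : CU + CV ≤ A0 * y x := by
        have h4 : (CU + CV) / A0 ≤ y x := le_trans (by linarith) hx
        rw [div_le_iff₀ hA] at h4; linarith
      have h5 : 0 ≤ (CU + CV) / A0 := by positivity
      constructor
      · linarith [neg_abs_le (deriv U x)]
      · linarith [le_abs_self (deriv V x)]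
    obtain ⟨N, hN⟩ : ∃ N : ℝ, ((CU + CV) / A0 + (CU + CV)) ≤ e * (γ * N) ∧ X < N := by
      refine ⟨max (X + 1) (((CU + CV) / A0 + (CU + CV)) / (e * γ)), ?_, by have := le_max_left (X + 1) (((CU + CV) / A0 + (CU + CV)) / (e * γ)); linarith⟩
      have := le_max_right (X + 1) (((CU + CV) / A0 + (CU + CV)) / (e * γ))
      rw [div_le_iff₀ (by positivity)] at this; linarith
    have far : ∀ x ≤ -N, R x ≤ 1 := by
      intro x hx
      apply small
      have h1 : γ * N ≤ exp (-γ * x) := by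
        have := add_one_le_exp (-γ * x); nlinarith
      have h2 : 0 ≤ C * exp (δ * x) := by positivity
      have h3 : e * (γ * N) ≤ e * exp (-γ * x) := by gcongr
      simp only [hy]; linarith [hN.1]
    have near : R (-X) ≤ 1 := by
      apply small
      have : C * exp (δ * -X) = ((CU + CV) / A0 + (CU + CV)) := by
        rw [hC, mul_assoc, ← exp_add]; simp
      simp only [hy, this]
      have : 0 ≤ e * exp (-γ * -X) := by positivity
      linarith
    have all : ∀ x ≤ -X, R x ≤ 1 := by
      obtain ⟨x0, hx0, hmax⟩ := isCompact_Icc.exists_isMaxOn (nonempty_Icc.2 (show -N ≤ -X by linarith [hN.2])) Rc.continuousOn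
      by_contra hcon
      push Not at hcon
      obtain ⟨x1, hx1, hx1'⟩ := hcon
      have hx1N : -N ≤ x1 := by
        by_contra hh; push Not at hh
        linarith [far x1 hh.le]
      have hk1 : 1 < R x0 := hx1'.trans_le (hmax ⟨hx1N, hx1⟩)
      set k := R x0 with hk
      have hin1 : -N < x0 := by
        rcases hx0.1.lt_or_eq with q | q
        · exact q
        · have := far x0 (by linarith); linarith
      have hin2 : x0 < -X := by
        rcases hx0.2.lt_or_eq with q | q
        · exact q
        · have := near; rw [← q] at this; linarith
      have k0 : 0 < k := by linarith
      have hev : ∀ᶠ x in 𝓝 x0, R x ≤ k := by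
        filter_upwards [Ioo_mem_nhds hin1 hin2] with x hx
        exact hmax ⟨hx.1.le, hx.2.le⟩
      have hev1 : ∀ᶠ x in 𝓝 x0, -deriv U x - k * (A0 * y x) ≤ 0 := by
        filter_upwards [hev] with x hx
        linarith [((crit x k k0).1 hx).1]
      have hev2 : ∀ᶠ x in 𝓝 x0, deriv V x - k * y x ≤ 0 := by
        filter_upwards [hev] with x hx
        linarith [((crit x k k0).1 hx).2]
      have g1 := hev1.self_of_nhds
      have g2 := hev2.self_of_nhds
      obtain ⟨l1, l2, l3, l4⟩ := hL x0 hin2.le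
      obtain ⟨u0, u1⟩ := h.U01 x0
      obtain ⟨v0, v1⟩ := h.V01 x0
      have hE1 : 0 < C * exp (δ * x0) := by positivity
      have hE2 : 0 < e * exp (-γ * x0) := by positivity
      rcases le_total (deriv V x0 / y x0) (-deriv U x0 / (A0 * y x0)) with hc1 | hc1
      · have e1 : k = -deriv U x0 / (A0 * y x0) := by rw [hk, hR]; exact max_eq_left hc1
        have e2 : -deriv U x0 - k * (A0 * y x0) = 0 := by
          have := y0 x0
          rw [e1]; field_simp; ring
        have hd := touch_x (D := fun x => -deriv U x - k * (A0 * y x)) (D1 := fun x => -deriv (deriv U) x - k * (A0 * y1 x)) (x := x0)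
          (Eventually.of_forall fun x => (cd2_d2 h.Ur x).neg.sub (((dy x).const_mul A0).const_mul k))
          ((h.U3 x0).neg.sub (((dy1 x0).const_mul A0).const_mul k)) (by simp only [e2]; exact hev1)
        obtain ⟨f1, f2⟩ := hd
        have hau : 0 < a * U x0 := mul_pos h.a0 u0
        have g3 := mnl g2 hau.le
        have s1 := mnl l1 (mul_pos k0 hE1).le
        have s2 := mnl l3 (mul_pos k0 hE2).le
        have s3 := mul_pos (mul_pos k0 hE1) hc
        have s4 := mul_pos (mul_pos k0 hE2) hc
        have e3 : deriv U x0 = - (k * (A0 * y x0)) := by linarith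
        have e4 : deriv (deriv U) x0 = - (k * (A0 * y1 x0)) := by linarith
        rw [e3, e4] at f2
        simp only [hy, hy1, hy2] at f2 g3
        linarith
      · have e1 : k = deriv V x0 / y x0 := by rw [hk, hR]; exact max_eq_right hc1
        have e2 : deriv V x0 - k * y x0 = 0 := by
          have := y0 x0
          rw [e1]; field_simp; ring
        have hd := touch_x (D := fun x => deriv V x - k * y x) (D1 := fun x => deriv (deriv V) x - k * y1 x) (x := x0)
          (Eventually.of_forall fun x => (cd2_d2 h.Vr x).sub ((dy x).const_mul k))
          ((h.V3 x0).sub ((dy1 x0).const_mul k)) (by simp only [e2]; exact hev2)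
        obtain ⟨f1, f2⟩ := hd
        have hs := h.s0
        have hbv : 0 < r * b * V x0 := mul_pos (mul_pos h.r0 (by linarith [h.b1])) v0
        have g3 := mnl g1 hbv.le
        have s1 := mnl l2 (mul_pos k0 hE1).le
        have s2 := mnl l4 (mul_pos k0 hE2).le
        have s3 := mul_pos (mul_pos k0 hE1) hc
        have s4 := mul_pos (mul_pos k0 hE2) hc
        have e3 : deriv V x0 = k * y x0 := by linarith
        have e4 : deriv (deriv V) x0 = k * y1 x0 := by linarith
        have f3 : -(2 * γ * deriv (deriv V) x0 + deriv V x0 * (r * (1 - b * U x0 - 2 * V x0)) - r * b * V x0 * deriv U x0) - σ * (k * y2 x0) ≤ 0 := by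
          have := mnl f2 hs.le
          rw [mul_sub, mul_div_cancel₀ _ hs.ne'] at this; linarith
        rw [e3, e4] at f3
        simp only [hy, hy1, hy2] at f3 g3
        linarith
    intro x hx
    have := (crit x 1 one_pos).1 (all x hx)
    rw [one_mul, one_mul] at this; exact this
  set D := (CU + CV) * exp (δ * X) with hD
  refine ⟨A0 * C + C + D, by positivity, fun x => ?_⟩
  have hE := exp_pos (δ * x)
  have hDp : 0 < D := by positivity
  rcases le_total x (-X) with hx | hx
  · constructor
    · have : -deriv U x ≤ A0 * (C * exp (δ * x)) := by
        refine lim_eps (A := A0 * exp (-γ * x)) (by positivity) fun e he => ?_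
        have := (main e he x hx).1; linarith
      have : 0 ≤ (C + D) * exp (δ * x) := by positivity
      linarith
    · have : deriv V x ≤ C * exp (δ * x) := by
        refine lim_eps (A := exp (-γ * x)) (by positivity) fun e he => ?_
        have := (main e he x hx).2; linarith
      have : 0 ≤ (A0 * C + D) * exp (δ * x) := by positivity
      linarith
  · have h1 : CU + CV ≤ D * exp (δ * x) := by
      rw [hD, mul_assoc, ← exp_add]
      have : 1 ≤ exp (δ * X + δ * x) := by
        apply one_le_exp; have := h.d0; nlinarith
      nlinarith
    have h2 : 0 ≤ (A0 * C + C) * exp (δ * x) := by positivity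
    constructor
    · linarith [hUb x, neg_abs_le (deriv U x)]
    · linarith [hVb x, le_abs_self (deriv V x)]

end Front

lemma pp2 (x : ℝ) : HasDerivAt (fun x : ℝ => max 0 x ^ 2) (2 * max 0 x) x := by
  rcases lt_trichotomy x 0 with h | h | h
  · have e : (fun x : ℝ => max 0 x ^ 2) =ᶠ[𝓝 x] fun _ => 0 := by
      filter_upwards [gt_mem_nhds h] with y hy
      rw [max_eq_left (le_of_lt hy)]; simp
    rw [max_eq_left h.le, mul_zero]
    exact (hasDerivAt_const x (0:ℝ)).congr_of_eventuallyEq e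
  · subst h
    rw [max_self, mul_zero, hasDerivAt_iff_isLittleO]
    simp only [max_self, sub_zero, smul_zero]
    have : (fun x : ℝ => x ^ 2) =o[𝓝 0] fun x => x := by
      simpa using (Asymptotics.isLittleO_pow_id (𝕜 := ℝ) (n := 2) one_lt_two)
    refine Asymptotics.IsBigO.trans_isLittleO ?_ this
    refine Asymptotics.IsBigO.of_bound 1 (Eventually.of_forall fun y => ?_)
    rw [one_mul]
    simp only [ne_eq, OfNat.ofNat_ne_zero, not_false_eq_true, zero_pow, sub_zero, norm_pow, Real.norm_eq_abs, sq_abs]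
    rcases le_total y 0 with q | q
    · rw [max_eq_left q]; simpa using sq_nonneg y
    · rw [max_eq_right q]
  · have e : (fun x : ℝ => max 0 x ^ 2) =ᶠ[𝓝 x] fun x => x ^ 2 := by
      filter_upwards [lt_mem_nhds h] with y hy
      rw [max_eq_right (le_of_lt hy)]
    rw [max_eq_right h.le]
    have := hasDerivAt_pow 2 x
    exact (this.congr_of_eventuallyEq e).congr_deriv (by norm_num)

lemma pp3 (x : ℝ) : HasDerivAt (fun x : ℝ => max 0 x ^ 3) (3 * max 0 x ^ 2) x := by
  rcases lt_trichotomy x 0 with h | h | h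
  · have e : (fun x : ℝ => max 0 x ^ 3) =ᶠ[𝓝 x] fun _ => 0 := by
      filter_upwards [gt_mem_nhds h] with y hy
      rw [max_eq_left (le_of_lt hy)]; simp
    rw [max_eq_left h.le]
    exact ((hasDerivAt_const x (0:ℝ)).congr_of_eventuallyEq e).congr_deriv (by norm_num)
  · subst h
    rw [max_self, hasDerivAt_iff_isLittleO]
    simp only [max_self, sub_zero]
    have : (fun x : ℝ => x ^ 3) =o[𝓝 0] fun x => x := by
      simpa using (Asymptotics.isLittleO_pow_id (𝕜 := ℝ) (n := 3) (by norm_num))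
    refine Asymptotics.IsBigO.trans_isLittleO ?_ this
    refine Asymptotics.IsBigO.of_bound 1 (Eventually.of_forall fun y => ?_)
    rw [one_mul]
    rcases le_total y 0 with q | q
    · rw [max_eq_left q]; simp
    · rw [max_eq_right q]; simp
  · have e : (fun x : ℝ => max 0 x ^ 3) =ᶠ[𝓝 x] fun x => x ^ 3 := by
      filter_upwards [lt_mem_nhds h] with y hy
      rw [max_eq_right (le_of_lt hy)]
    rw [max_eq_right h.le]
    have := hasDerivAt_pow 3 x
    exact (this.congr_of_eventuallyEq e).congr_deriv (by norm_num)

lemma ab_comp {d c p q φ φ1 φ2 χ dA θ A A' δ E y K e S ζ ζ1 ζ2 : ℝ} (hdA : 0 < dA)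
    (hK : 0 ≤ K) (hy : 0 ≤ y) (he : 0 < e) (hk : y = 0 ∨ -(d * K * φ) ≤ 2 * d * φ1 + c * φ)
    (hz : d * φ2 + c * φ1 + φ * p + q * χ = 0)
    (hS : A * (d * δ ^ 2 + c * δ + p) + q * A' ≤ S) (hθE : 0 ≤ θ * E)
    (hζ1 : ζ1 = -(dA * ((3 * y ^ 2 + K * y ^ 3) * e)))
    (hζ2 : ζ2 = -(dA * ((6 * y + 6 * K * y ^ 2 + K ^ 2 * y ^ 3) * e))) :
    d * (φ2 * ζ + 2 * φ1 * ζ1 + φ * ζ2 + θ * A * (δ * (δ * E))) + c * (φ1 * ζ + φ * ζ1 + θ * A * (δ * E))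
      + (φ * ζ + θ * A * E) * p + q * (χ * ζ + θ * A' * E)
      ≤ - (φ * dA * d * (6 * y + 3 * K * y ^ 2) * e) + θ * E * S := by
  have h1 : (2 * d * φ1 + c * φ) * ζ1 ≤ -(d * K * φ) * ζ1 := by
    rcases hk with hk | hk
    · rw [hζ1, hk]; simp
    · have : ζ1 ≤ 0 := by rw [hζ1, neg_nonpos]; positivity
      exact mul_le_mul_of_nonpos_right hk this
  have h2 := mnl hS hθE
  have h3 : ζ * (d * φ2 + c * φ1 + φ * p + q * χ) = 0 := by rw [hz, mul_zero]
  have h4 : d * φ * ζ2 - d * K * φ * ζ1 = - (φ * dA * d * (6 * y + 3 * K * y ^ 2) * e) := by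
    rw [hζ1, hζ2]; ring
  linarith

lemma ab_der {φ φ1 φ2 : ℝ → ℝ} {dA K X θA δ : ℝ} (h1 : ∀ x, HasDerivAt φ (φ1 x) x)
    (h2 : ∀ x, HasDerivAt φ1 (φ2 x) x) {y ζ ζ1 ζ2 : ℝ → ℝ} (hy : y = fun x => max 0 (x + X))
    (hζ : ζ = fun x => 1 - dA * (y x ^ 3 * exp (K * x)))
    (hζ1 : ζ1 = fun x => -(dA * ((3 * y x ^ 2 + K * y x ^ 3) * exp (K * x))))
    (hζ2 : ζ2 = fun x => -(dA * ((6 * y x + 6 * K * y x ^ 2 + K ^ 2 * y x ^ 3) * exp (K * x)))) (x : ℝ) :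
    HasDerivAt (fun x => φ x * ζ x + θA * exp (δ * x)) (φ1 x * ζ x + φ x * ζ1 x + θA * (δ * exp (δ * x))) x ∧
    HasDerivAt (fun x => φ1 x * ζ x + φ x * ζ1 x + θA * (δ * exp (δ * x)))
      (φ2 x * ζ x + 2 * φ1 x * ζ1 x + φ x * ζ2 x + θA * (δ * (δ * exp (δ * x)))) x := by
  have y3 : HasDerivAt (fun x => y x ^ 3) (3 * y x ^ 2) x := by rw [hy]; exact (pp3 (x + X)).comp_add_const x X
  have y2 : HasDerivAt (fun x => y x ^ 2) (2 * y x) x := by rw [hy]; exact (pp2 (x + X)).comp_add_const x X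
  have eK := Front.exp1 K x
  have eδ := Front.exp1 δ x
  have d1 : HasDerivAt ζ (ζ1 x) x := by
    rw [hζ, hζ1]
    exact (((y3.mul eK).const_mul dA).const_sub 1).congr_deriv (by ring)
  have d2 : HasDerivAt ζ1 (ζ2 x) x := by
    rw [hζ1, hζ2]
    exact (((((y2.const_mul 3).add (y3.const_mul K)).mul eK).const_mul dA).neg).congr_deriv (by simp only [Pi.add_apply]; ring)
  constructor
  · exact ((h1 x).mul d1).add (eδ.const_mul θA)
  · exact ((((h2 x).mul d1).add ((h1 x).mul d2)).add ((eδ.const_mul δ).const_mul θA)).congr_deriv (by ring)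

namespace Front
variable {a b σ r γ δ : ℝ} {U V : ℝ → ℝ}

set_option maxHeartbeats 1600000 in
theorem ablock (h : Front a b σ r γ δ U V) (XA : ℝ) (hXA : 0 ≤ XA) :
    ∃ ψ ψ1 ψ2 χ χ1 χ2 : ℝ → ℝ, ∃ m Cp cp : ℝ, 0 < m ∧ 0 < Cp ∧ 0 < cp ∧
      (∀ x, HasDerivAt ψ (ψ1 x) x) ∧ (∀ x, HasDerivAt ψ1 (ψ2 x) x) ∧
      (∀ x, HasDerivAt χ (χ1 x) x) ∧ (∀ x, HasDerivAt χ1 (χ2 x) x) ∧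
      (∀ x ≤ XA, 1 * ψ2 x + 2 * γ * ψ1 x + ψ x * (1 - 2 * U x - a * V x) + a * U x * χ x ≤ -(m * ψ x)) ∧
      (∀ x ≤ XA, σ * χ2 x + 2 * γ * χ1 x + χ x * (r * (1 - b * U x - 2 * V x)) + r * b * V x * ψ x ≤ -(m * χ x)) ∧
      (∀ x ≤ XA, cp * exp (δ * x) ≤ ψ x ∧ ψ x ≤ Cp * exp (δ * x)) ∧
      (∀ x ≤ XA, cp * exp (δ * x) ≤ χ x ∧ χ x ≤ Cp * exp (δ * x)) ∧
      (∀ x ∈ Icc 0 XA, 3 / 4 * -deriv U x ≤ ψ x ∧ ψ x ≤ 2 * -deriv U x) ∧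
      (∀ x ∈ Icc 0 XA, 3 / 4 * deriv V x ≤ χ x ∧ χ x ≤ 2 * deriv V x) := by
  obtain ⟨X, A0, c0, hX, hA, hc, hL⟩ := h.left
  obtain ⟨Cf, hCf, hf⟩ := h.phi_left
  have hUc : Continuous (deriv U) := continuous_iff_continuousAt.2 fun x => (cd2_d2 h.Ur x).continuousAt
  have hVc : Continuous (deriv V) := continuous_iff_continuousAt.2 fun x => (cd2_d2 h.Vr x).continuousAt
  have hUUc : Continuous (deriv (deriv U)) := continuous_iff_continuousAt.2 fun x => (h.U3 x).continuousAt
  have hVVc : Continuous (deriv (deriv V)) := continuous_iff_continuousAt.2 fun x => (h.V3 x).continuousAt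
  have hs := h.s0
  have hd := h.d0
  have hg := h.g0
  have ha := h.a0
  have hr := h.r0
  have hb := h.b1
  have hJ : (Icc (-X - 1) XA).Nonempty := nonempty_Icc.2 (by linarith)
  obtain ⟨x1, _, hx1⟩ := isCompact_Icc.exists_isMaxOn hJ
    (f := fun x => max |(2 * 1 * -deriv (deriv U) x + 2 * γ * -deriv U x) / (1 * -deriv U x)|
      |(2 * σ * deriv (deriv V) x + 2 * γ * deriv V x) / (σ * deriv V x)|) (by
      refine Continuous.continuousOn (Continuous.max ?_ ?_)
      · refine (Continuous.div (by fun_prop) (by fun_prop) fun x => ?_).abs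
        have := h.Ud x; simp; linarith
      · refine (Continuous.div (by fun_prop) (by fun_prop) fun x => ?_).abs
        have := h.Vd x; positivity)
  obtain ⟨K, hK⟩ : ∃ K, K = max |(2 * 1 * -deriv (deriv U) x1 + 2 * γ * -deriv U x1) / (1 * -deriv U x1)|
      |(2 * σ * deriv (deriv V) x1 + 2 * γ * deriv V x1) / (σ * deriv V x1)| := ⟨_, rfl⟩
  have hK0 : 0 ≤ K := by rw [hK]; exact le_max_of_le_left (abs_nonneg _)
  have hKU : ∀ x ∈ Icc (-X - 1) XA, -(1 * K * -deriv U x) ≤ 2 * 1 * -deriv (deriv U) x + 2 * γ * -deriv U x := by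
    intro x hx
    have h0 := hx1 hx
    simp only [mem_ofPred_eq] at h0
    rw [← hK] at h0
    have h2 := neg_le_of_abs_le ((le_max_left _ _).trans h0)
    have hp : 0 < 1 * -deriv U x := by linarith [h.Ud x]
    rw [le_div_iff₀ hp] at h2; linarith
  have hKV : ∀ x ∈ Icc (-X - 1) XA, -(σ * K * deriv V x) ≤ 2 * σ * deriv (deriv V) x + 2 * γ * deriv V x := by
    intro x hx
    have h0 := hx1 hx
    simp only [mem_ofPred_eq] at h0
    rw [← hK] at h0
    have h2 := neg_le_of_abs_le ((le_max_right _ _).trans h0)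
    have hp : 0 < σ * deriv V x := mul_pos hs (h.Vd x)
    rw [le_div_iff₀ hp] at h2; linarith
  obtain ⟨x2, _, hx2⟩ := isCompact_Icc.exists_isMinOn hJ
    (f := fun x => min (-deriv U x) (deriv V x)) (Continuous.continuousOn (hUc.neg.min hVc))
  obtain ⟨f0, hf0⟩ : ∃ f0, f0 = min (-deriv U x2) (deriv V x2) := ⟨_, rfl⟩
  have hf00 : 0 < f0 := by rw [hf0]; exact lt_min (by linarith [h.Ud x2]) (h.Vd x2)
  have hfU : ∀ x ∈ Icc (-X - 1) XA, f0 ≤ -deriv U x := fun x hx => hf0.le.trans ((hx2 hx).trans (min_le_left _ _))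
  have hfV : ∀ x ∈ Icc (-X - 1) XA, f0 ≤ deriv V x := fun x hx => hf0.le.trans ((hx2 hx).trans (min_le_right _ _))
  obtain ⟨Hb, hHb⟩ : ∃ Hb, Hb = (XA + (X + 1)) ^ 3 * exp (K * XA) := ⟨_, rfl⟩
  have hHb0 : 0 ≤ Hb := by rw [hHb]; positivity
  obtain ⟨dA, hdA⟩ : ∃ dA, dA = 1 / (4 * (1 + Hb)) := ⟨_, rfl⟩
  have hdA0 : 0 < dA := by rw [hdA]; positivity
  have hdAH : dA * Hb ≤ 1 / 4 := by
    rw [hdA, div_mul_eq_mul_div, div_le_iff₀ (by positivity)]; linarith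
  obtain ⟨y, hy⟩ : ∃ y : ℝ → ℝ, y = fun x => max 0 (x + (X + 1)) := ⟨_, rfl⟩
  have hy0 : ∀ x, 0 ≤ y x := fun x => by rw [hy]; exact le_max_left _ _
  obtain ⟨ζ, hζ⟩ : ∃ ζ : ℝ → ℝ, ζ = fun x => 1 - dA * (y x ^ 3 * exp (K * x)) := ⟨_, rfl⟩
  obtain ⟨ζ1, hζ1⟩ : ∃ ζ1 : ℝ → ℝ, ζ1 = fun x => -(dA * ((3 * y x ^ 2 + K * y x ^ 3) * exp (K * x))) := ⟨_, rfl⟩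
  obtain ⟨ζ2, hζ2⟩ : ∃ ζ2 : ℝ → ℝ, ζ2 = fun x => -(dA * ((6 * y x + 6 * K * y x ^ 2 + K ^ 2 * y x ^ 3) * exp (K * x))) := ⟨_, rfl⟩
  have hζb : ∀ x ≤ XA, 3 / 4 ≤ ζ x ∧ ζ x ≤ 1 := by
    intro x hx
    have h1 : y x ≤ XA + (X + 1) := by rw [hy]; exact max_le (by linarith) (by linarith)
    have h2 : y x ^ 3 * exp (K * x) ≤ Hb := by
      rw [hHb]; have := hy0 x; gcongr
    have h3 : dA * (y x ^ 3 * exp (K * x)) ≤ dA * Hb := by gcongr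
    have h4 : 0 ≤ dA * (y x ^ 3 * exp (K * x)) := by have := hy0 x; positivity
    rw [hζ]; constructor <;> simp only <;> linarith
  obtain ⟨SS, hSS⟩ : ∃ SS, SS = A0 * (δ ^ 2 + 2 * γ * δ + 1) + a + (σ * δ ^ 2 + 2 * γ * δ + r) + r * b * A0 := ⟨_, rfl⟩
  have hSS0 : 0 < SS := by rw [hSS]; positivity
  obtain ⟨g, hg1⟩ : ∃ g, g = f0 * dA * min 1 σ * 6 * exp (-(K * X)) := ⟨_, rfl⟩
  have hms : 0 < min 1 σ := lt_min one_pos hs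
  have hg0 : 0 < g := by rw [hg1]; positivity
  obtain ⟨θ, hθ⟩ : ∃ θ, θ = min f0 (g / 2) / (exp (δ * XA) * (SS + A0 + 1)) := ⟨_, rfl⟩
  have hmin : 0 < min f0 (g / 2) := lt_min hf00 (by positivity)
  have hθ0 : 0 < θ := by rw [hθ]; positivity
  have hθe : θ * (exp (δ * XA) * (SS + A0 + 1)) = min f0 (g / 2) := by
    rw [hθ]; field_simp
  have hθle : ∀ x ≤ XA, ∀ k, k ≤ SS + A0 + 1 → 0 ≤ k → θ * exp (δ * x) * k ≤ min f0 (g / 2) := by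
    intro x hx k hk hk0
    rw [← hθe, mul_assoc]
    gcongr
  have dU := fun x => ab_der (θA := θ * A0) (δ := δ) (fun x => (cd2_d2 h.Ur x).neg) (fun x => (h.U3 x).neg) hy hζ hζ1 hζ2 x
  have dV := fun x => ab_der (θA := θ * 1) (δ := δ) (cd2_d2 h.Vr) h.V3 hy hζ hζ1 hζ2 x
  obtain ⟨Cp, hCp⟩ : ∃ Cp, Cp = Cf + θ * (A0 + 1) := ⟨_, rfl⟩
  have hCp0 : 0 < Cp := by rw [hCp]; positivity
  obtain ⟨m, hm⟩ : ∃ m, m = min (θ * c0 / Cp) (g / 2 / (Cp * exp (δ * XA))) := ⟨_, rfl⟩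
  have hm0 : 0 < m := by rw [hm]; exact lt_min (by positivity) (by positivity)
  have hm1 : m * Cp ≤ θ * c0 := by
    have := min_le_left (θ * c0 / Cp) (g / 2 / (Cp * exp (δ * XA)))
    rw [← hm, le_div_iff₀ hCp0] at this; exact this
  have hm2 : m * (Cp * exp (δ * XA)) ≤ g / 2 := by
    have := min_le_right (θ * c0 / Cp) (g / 2 / (Cp * exp (δ * XA)))
    rw [← hm, le_div_iff₀ (by positivity)] at this; exact this
  have ubU : ∀ x ≤ XA, -deriv U x * ζ x + θ * A0 * exp (δ * x) ≤ Cp * exp (δ * x) := by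
    intro x hx
    have h1 := (hf x).1
    have h2 := (hζb x hx).2
    have h3 := h.Ud x
    have h4 : -deriv U x * ζ x ≤ -deriv U x := mul_le_of_le_one_right (by linarith) h2
    have := exp_pos (δ * x)
    have : 0 ≤ θ * exp (δ * x) := by positivity
    rw [hCp]; linarith
  have ubV : ∀ x ≤ XA, deriv V x * ζ x + θ * 1 * exp (δ * x) ≤ Cp * exp (δ * x) := by
    intro x hx
    have h1 := (hf x).2
    have h2 := (hζb x hx).2
    have h3 := h.Vd x
    have h4 : deriv V x * ζ x ≤ deriv V x := mul_le_of_le_one_right (by linarith) h2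
    have := exp_pos (δ * x)
    have : 0 ≤ θ * A0 * exp (δ * x) := by positivity
    rw [hCp]; linarith
  have fin : ∀ x ≤ XA, ∀ Z S ψ φ d, min 1 σ ≤ d → f0 ≤ φ ∨ x < -X - 1 → 0 ≤ φ → ψ ≤ Cp * exp (δ * x) → S ≤ SS →
      (x ≤ -X → S ≤ -c0) →
      Z ≤ - (φ * dA * d * (6 * y x + 3 * K * y x ^ 2) * exp (K * x)) + θ * exp (δ * x) * S → Z ≤ -(m * ψ) := by
    intro x hx Z S ψ φ d hd1 hφ hφ0 hψ hS hS2 hZ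
    have hyx := hy0 x
    have hd0 : 0 < d := hms.trans_le hd1
    have E := exp_pos (δ * x)
    rcases le_total x (-X) with hxX | hxX
    · have h1 : 0 ≤ φ * dA * d * (6 * y x + 3 * K * y x ^ 2) * exp (K * x) := by positivity
      have h2 : θ * exp (δ * x) * S ≤ θ * exp (δ * x) * -c0 :=
        mnl (hS2 hxX) (by positivity)
      have h3 : m * ψ ≤ m * (Cp * exp (δ * x)) := mnl hψ hm0.le
      have h4 : m * Cp * exp (δ * x) ≤ θ * c0 * exp (δ * x) := mnr hm1 E.le
      linarith
    · have hφ1 : f0 ≤ φ := hφ.resolve_right (by linarith)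
      have hy1 : 1 ≤ y x := by rw [hy]; exact le_max_of_le_right (by linarith)
      have h1 : g ≤ φ * dA * d * (6 * y x + 3 * K * y x ^ 2) * exp (K * x) := by
        rw [hg1]
        have e1 : 6 ≤ 6 * y x + 3 * K * y x ^ 2 := by have : 0 ≤ 3 * K * y x ^ 2 := by positivity
                                                      linarith
        have e2 : -(K * X) ≤ K * x := by have := mnl hxX hK0; linarith
        gcongr
      have h2 : θ * exp (δ * x) * S ≤ θ * exp (δ * x) * SS :=
        mnl hS (by positivity)
      have h3 := (hθle x hx SS (by linarith) hSS0.le).trans (min_le_right _ _)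
      have h4 : m * ψ ≤ g / 2 := by
        refine le_trans ?_ hm2
        gcongr
        refine hψ.trans ?_
        gcongr
      linarith
  refine ⟨_, _, _, _, _, _, m, Cp, min (θ * A0) (θ * 1), hm0, hCp0, lt_min (by positivity) (by positivity),
    fun x => (dU x).1, fun x => (dU x).2, fun x => (dV x).1, fun x => (dV x).2, ?_, ?_, ?_, ?_, ?_, ?_⟩
  · intro x hx
    have hcomp := ab_comp (d := 1) (c := 2 * γ) (p := 1 - 2 * U x - a * V x) (q := a * U x) (φ := -deriv U x)
      (φ1 := -deriv (deriv U) x) (φ2 := -(-(2 * γ * deriv (deriv U) x + deriv U x * (1 - 2 * U x - a * V x) - a * U x * deriv V x)))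
      (χ := deriv V x) (A := A0) (A' := 1) (δ := δ) (E := exp (δ * x)) (y := y x) (K := K) (e := exp (K * x))
      (θ := θ) (ζ := ζ x) (ζ1 := ζ1 x) (ζ2 := ζ2 x) hdA0 hK0 (hy0 x) (exp_pos _)
      (by
        rcases lt_or_ge x (-X - 1) with q | q
        · left; rw [hy]; exact max_eq_left (by linarith)
        · right; exact hKU x ⟨q, hx⟩) (by ring) le_rfl (by positivity) (by rw [hζ1]) (by rw [hζ2])
    obtain ⟨u0, u1⟩ := h.U01 x
    obtain ⟨v0, v1⟩ := h.V01 x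
    refine fin x hx _ _ _ (-deriv U x) 1 (min_le_left _ _) ?_ (by linarith [h.Ud x]) (ubU x hx) ?_ ?_ hcomp
    · rcases lt_or_ge x (-X - 1) with q | q
      · right; exact q
      · left; exact hfU x ⟨q, hx⟩
    · have : 0 < a * V x := by positivity
      have h3 : A0 * (1 * δ ^ 2 + 2 * γ * δ + (1 - 2 * U x - a * V x)) ≤ A0 * (δ ^ 2 + 2 * γ * δ + 1) := by
        apply mnl _ hA.le; linarith
      have h4 : a * U x * 1 ≤ a := by rw [mul_one]; exact mul_le_of_le_one_right h.a0.le u1.le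
      have h5 : 0 ≤ σ * δ ^ 2 + 2 * γ * δ + r + r * b * A0 := by positivity
      rw [hSS]; linarith
    · intro hxX
      have := (hL x hxX).1
      linarith
  · intro x hx
    have hcomp := ab_comp (d := σ) (c := 2 * γ) (p := r * (1 - b * U x - 2 * V x)) (q := r * b * V x) (φ := deriv V x)
      (φ1 := deriv (deriv V) x) (φ2 := -(2 * γ * deriv (deriv V) x + deriv V x * (r * (1 - b * U x - 2 * V x)) - r * b * V x * deriv U x) / σ)
      (χ := -deriv U x) (A := 1) (A' := A0) (δ := δ) (E := exp (δ * x)) (y := y x) (K := K) (e := exp (K * x))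
      (θ := θ) (ζ := ζ x) (ζ1 := ζ1 x) (ζ2 := ζ2 x) hdA0 hK0 (hy0 x) (exp_pos _)
      (by
        rcases lt_or_ge x (-X - 1) with q | q
        · left; rw [hy]; exact max_eq_left (by linarith)
        · right; exact hKV x ⟨q, hx⟩) (by rw [mul_div_cancel₀ _ hs.ne']; ring) le_rfl (by positivity) (by rw [hζ1]) (by rw [hζ2])
    obtain ⟨u0, u1⟩ := h.U01 x
    obtain ⟨v0, v1⟩ := h.V01 x
    refine fin x hx _ _ _ (deriv V x) σ (min_le_right _ _) ?_ (by linarith [h.Vd x]) (ubV x hx) ?_ ?_ hcomp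
    · rcases lt_or_ge x (-X - 1) with q | q
      · right; exact q
      · left; exact hfV x ⟨q, hx⟩
    · have h2 : 0 < b * U x := by positivity
      have h3 : r * (1 - b * U x - 2 * V x) ≤ r := mul_le_of_le_one_right h.r0.le (by linarith only [h2, v0])
      have h4 : r * b * V x * A0 ≤ r * b * A0 := by
        have : 0 < r * b * A0 := by positivity
        linarith only [mnl v1.le this.le]
      have h5 : 0 ≤ A0 * (δ ^ 2 + 2 * γ * δ + 1) + a := by positivity
      rw [hSS]; linarith
    · intro hxX
      have := (hL x hxX).2.1
      linarith
  · intro x hx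
    refine ⟨?_, ubU x hx⟩
    have h1 : 0 ≤ -deriv U x * ζ x := mul_nonneg (by linarith [h.Ud x]) (by linarith [(hζb x hx).1])
    have := mnr (min_le_left (θ * A0) (θ * 1)) (exp_pos (δ * x)).le
    simp only [Pi.neg_apply]
    linarith
  · intro x hx
    refine ⟨?_, ubV x hx⟩
    have h1 : 0 ≤ deriv V x * ζ x := mul_nonneg (by linarith [h.Vd x]) (by linarith [(hζb x hx).1])
    have := mnr (min_le_right (θ * A0) (θ * 1)) (exp_pos (δ * x)).le
    linarith
  · intro x hx
    have hz := hζb x hx.2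
    have hu : 0 < -deriv U x := by linarith [h.Ud x]
    have hff := hfU x ⟨by linarith [hx.1], hx.2⟩
    have ht := (hθle x hx.2 A0 (by linarith) hA.le).trans (min_le_left _ _)
    have h0 : 0 ≤ θ * A0 * exp (δ * x) := by positivity
    have e1 := mnl hz.1 hu.le
    have e2 := mnl hz.2 hu.le
    constructor <;> simp only [Pi.neg_apply] <;> linarith
  · intro x hx
    have hz := hζb x hx.2
    have hu : 0 < deriv V x := h.Vd x
    have hff := hfV x ⟨by linarith [hx.1], hx.2⟩
    have ht := (hθle x hx.2 1 (by linarith) one_pos.le).trans (min_le_left _ _)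
    have h0 : 0 ≤ θ * 1 * exp (δ * x) := by positivity
    have e1 := mnl hz.1 hu.le
    have e2 := mnl hz.2 hu.le
    constructor <;> linarith

end Front

structure MB (f : ℝ → ℝ → ℝ) : Prop where
  cont : ContinuousOn (fun p : ℝ × ℝ => f p.1 p.2) {p | 0 < p.1}
  bd : ∀ N : ℝ, ∃ C, ∀ τ ≥ 1, ∀ x, |x| ≤ N → |f τ x| ≤ C

noncomputable def mix (μ : ℝ) (f : ℝ → ℝ → ℝ) (τ x : ℝ) : ℝ :=
  ∫ s in Ioi (0:ℝ), μ * exp (-μ * s) * f (τ + s) x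

section mixl
variable {f g : ℝ → ℝ → ℝ} {μ : ℝ}

lemma mix_wint (hμ : 0 < μ) : IntegrableOn (fun s => μ * exp (-μ * s)) (Ioi 0) :=
  (integrableOn_exp_mul_Ioi (by linarith) 0).const_mul μ

lemma mix_w1 (hμ : 0 < μ) : ∫ s in Ioi (0:ℝ), μ * exp (-μ * s) = 1 := by
  rw [integral_const_mul, integral_exp_mul_Ioi (by linarith)]
  simp; field_simp

lemma MB.contAt (hf : MB f) {τ : ℝ} (hτ : 0 < τ) (x : ℝ) :
    ContinuousAt (fun p : ℝ × ℝ => f p.1 p.2) (τ, x) :=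
  hf.cont.continuousAt ((continuous_fst.isOpen_preimage _ isOpen_Ioi).mem_nhds hτ)

lemma MB.aesm (hf : MB f) {τ : ℝ} (hτ : 0 < τ) (x : ℝ) :
    AEStronglyMeasurable (fun s => μ * exp (-μ * s) * f (τ + s) x) (volume.restrict (Ioi 0)) := by
  refine ContinuousOn.aestronglyMeasurable (fun s hs => ?_) measurableSet_Ioi
  have h1 : ContinuousAt (fun s : ℝ => f (τ + s) x) s :=
    ContinuousAt.comp (f := fun s : ℝ => (τ + s, x)) (hf.contAt (add_pos hτ hs) x) (by fun_prop)
  exact (ContinuousAt.mul (by fun_prop) h1).continuousWithinAt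

lemma mix_int (hμ : 0 < μ) (hf : MB f) {τ : ℝ} (hτ : 1 ≤ τ) (x : ℝ) :
    IntegrableOn (fun s => μ * exp (-μ * s) * f (τ + s) x) (Ioi 0) := by
  obtain ⟨C, hC⟩ := hf.bd |x|
  refine ((mix_wint hμ).mul_const C).mono' (hf.aesm (by linarith) x) ?_
  filter_upwards [ae_restrict_mem measurableSet_Ioi] with s hs
  have hs' : 0 < s := hs
  rw [norm_mul, norm_of_nonneg (by positivity)]
  gcongr
  exact hC _ (by linarith) x le_rfl

lemma mix_mono (hμ : 0 < μ) (hf : MB f) (hg : MB g) {τ : ℝ} (hτ : 1 ≤ τ) (x : ℝ)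
    (h : ∀ s ≥ τ, f s x ≤ g s x) : mix μ f τ x ≤ mix μ g τ x := by
  refine setIntegral_mono_on (mix_int hμ hf hτ x) (mix_int hμ hg hτ x) measurableSet_Ioi fun s hs => ?_
  have hs' : 0 < s := hs
  exact mnl (h _ (by linarith)) (by positivity)

lemma mix_lin (hμ : 0 < μ) (hf : MB f) (hg : MB g) {τ : ℝ} (hτ : 1 ≤ τ) (x α β : ℝ) :
    mix μ (fun s y => α * f s y + β * g s y) τ x = α * mix μ f τ x + β * mix μ g τ x := by
  unfold mix
  rw [← integral_const_mul, ← integral_const_mul, ← integral_add ((mix_int hμ hf hτ x).const_mul α)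
    ((mix_int hμ hg hτ x).const_mul β)]
  congr 1; ext s; ring

lemma MB_const (c : ℝ → ℝ) (hc : Continuous c) : MB (fun _ x => c x) := by
  refine ⟨(hc.comp continuous_snd).continuousOn, fun N => ?_⟩
  obtain ⟨C, hC⟩ := (isCompact_Icc (a := -N) (b := N)).exists_bound_of_continuousOn hc.continuousOn
  exact ⟨C, fun τ _ x hx => hC x (abs_le.1 hx)⟩

lemma MB.add (hf : MB f) (hg : MB g) : MB (fun s y => f s y + g s y) := by
  refine ⟨hf.cont.add hg.cont, fun N => ?_⟩
  obtain ⟨C, hC⟩ := hf.bd N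
  obtain ⟨D, hD⟩ := hg.bd N
  exact ⟨C + D, fun τ h x hx => (abs_add_le _ _).trans (add_le_add (hC τ h x hx) (hD τ h x hx))⟩

lemma MB.mul (hf : MB f) (hg : MB g) : MB (fun s y => f s y * g s y) := by
  refine ⟨hf.cont.mul hg.cont, fun N => ?_⟩
  obtain ⟨C, hC⟩ := hf.bd N
  obtain ⟨D, hD⟩ := hg.bd N
  refine ⟨C * D, fun τ h x hx => ?_⟩
  rw [abs_mul]
  exact mul_le_mul (hC τ h x hx) (hD τ h x hx) (abs_nonneg _) ((abs_nonneg _).trans (hC τ h x hx))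

lemma MB_inv : MB (fun s _ => s⁻¹) := by
  refine ⟨ContinuousOn.inv₀ (by fun_prop) fun p hp => (ne_of_gt hp), fun N => ⟨1, fun τ h x hx => ?_⟩⟩
  rw [abs_of_pos (by positivity)]
  exact inv_le_one_of_one_le₀ h

lemma mix_cst (hμ : 0 < μ) (c τ x : ℝ) : mix μ (fun _ _ => c) τ x = c := by
  unfold mix; rw [integral_mul_const, mix_w1 hμ, one_mul]

lemma mix_le (hμ : 0 < μ) (hf : MB f) {τ : ℝ} (hτ : 1 ≤ τ) {x c : ℝ}
    (h : ∀ s ≥ τ, f s x ≤ c) : mix μ f τ x ≤ c :=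
  (mix_mono hμ hf (MB_const (fun _ => c) continuous_const) hτ x h).trans (mix_cst hμ c τ x).le

lemma mix_nonneg (hμ : 0 < μ) {τ x : ℝ} (h : ∀ s ≥ τ, 0 ≤ f s x) : 0 ≤ mix μ f τ x := by
  refine setIntegral_nonneg measurableSet_Ioi fun s hs => ?_
  have hs' : 0 < s := hs
  exact mul_nonneg (by positivity) (h _ (by linarith))

lemma mix_ge (hμ : 0 < μ) (hf : MB f) {τ : ℝ} (hτ : 1 ≤ τ) {x c s1 l : ℝ} (hs1 : 0 ≤ s1) (hl : 0 ≤ l) (hc : 0 ≤ c)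
    (h0 : ∀ s ≥ τ, 0 ≤ f s x) (h : ∀ s ∈ Icc s1 (s1 + l), c ≤ f (τ + s) x) :
    μ * l * exp (-μ * (s1 + l)) * c ≤ mix μ f τ x := by
  unfold mix
  have hsub : Ioc s1 (s1 + l) ⊆ Ioi 0 := fun s hs => hs1.trans_lt hs.1
  have h1 : ∫ s in Ioc s1 (s1 + l), μ * exp (-μ * s) * f (τ + s) x ≤ ∫ s in Ioi (0:ℝ), μ * exp (-μ * s) * f (τ + s) x := by
    refine setIntegral_mono_set (mix_int hμ hf hτ x) ?_ (Filter.Eventually.of_forall hsub)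
    filter_upwards [ae_restrict_mem measurableSet_Ioi] with s hs
    have hs' : 0 < s := hs
    exact mul_nonneg (by positivity) (h0 _ (by linarith))
  refine le_trans ?_ h1
  have h2 : ∫ s in Ioc s1 (s1 + l), μ * exp (-μ * (s1 + l)) * c = μ * l * exp (-μ * (s1 + l)) * c := by
    rw [setIntegral_const]
    simp [hl]
    ring
  rw [← h2]
  refine setIntegral_mono_on (integrableOn_const (by simp)) ((mix_int hμ hf hτ x).mono_set hsub) measurableSet_Ioc fun s hs => ?_
  have := h s ⟨hs.1.le, hs.2⟩
  have e : -μ * (s1 + l) ≤ -μ * s := by have := mnl hs.2 hμ.le; linarith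
  gcongr

lemma mix_contAt (hμ : 0 < μ) (hf : MB f) {τ : ℝ} (hτ : 1 < τ) (x : ℝ) :
    ContinuousAt (fun p : ℝ × ℝ => mix μ f p.1 p.2) (τ, x) := by
  unfold mix
  obtain ⟨C, hC⟩ := hf.bd (|x| + 1)
  have hnb : ∀ᶠ p : ℝ × ℝ in 𝓝 (τ, x), 1 < p.1 :=
    (continuous_fst.tendsto (τ, x)).eventually (lt_mem_nhds hτ)
  have hnx : ∀ᶠ p : ℝ × ℝ in 𝓝 (τ, x), |p.2| < |x| + 1 :=
    ((continuous_snd.abs).tendsto (τ, x)).eventually (gt_mem_nhds (by simp))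
  refine continuousAt_of_dominated (bound := fun s => μ * exp (-μ * s) * C) ?_ ?_ ((mix_wint hμ).mul_const C) ?_
  · filter_upwards [hnb] with p hp
    exact hf.aesm (by linarith) p.2
  · filter_upwards [hnb, hnx] with p hp hx
    filter_upwards [ae_restrict_mem measurableSet_Ioi] with s hs
    have hs' : 0 < s := hs
    rw [norm_mul, norm_of_nonneg (by positivity)]
    gcongr
    exact hC _ (by linarith) _ hx.le
  · filter_upwards [ae_restrict_mem measurableSet_Ioi] with s hs
    have hs' : 0 < s := hs
    refine ContinuousAt.mul (by fun_prop) ?_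
    exact ContinuousAt.comp (x := (τ, x)) (f := fun p : ℝ × ℝ => (p.1 + s, p.2)) (hf.contAt (by simp only; linarith) x) (by fun_prop)

lemma mix_dx (hμ : 0 < μ) (hf : MB f) (hg : MB g) (hd : ∀ τ > 0, ∀ x, HasDerivAt (f τ) (g τ x) x)
    {τ : ℝ} (hτ : 1 ≤ τ) (x : ℝ) : HasDerivAt (fun x => mix μ f τ x) (mix μ g τ x) x := by
  unfold mix
  obtain ⟨C, hC⟩ := hg.bd (|x| + 1)
  refine (hasDerivAt_integral_of_dominated_loc_of_deriv_le (bound := fun s => μ * exp (-μ * s) * C)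
    (F := fun x s => μ * exp (-μ * s) * f (τ + s) x) (F' := fun x s => μ * exp (-μ * s) * g (τ + s) x)
    (s := {y | |y| < |x| + 1}) ((isOpen_lt continuous_abs continuous_const).mem_nhds (by simp)) ?_
    (mix_int hμ hf hτ x) (hg.aesm (by linarith) x) ?_ ((mix_wint hμ).mul_const C) ?_).2
  · exact Eventually.of_forall fun y => hf.aesm (by linarith) y
  · filter_upwards [ae_restrict_mem measurableSet_Ioi] with s hs
    have hs' : 0 < s := hs
    intro y hy
    rw [norm_mul, norm_of_nonneg (by positivity)]
    gcongr
    exact hC _ (by linarith) _ (le_of_lt hy)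
  · filter_upwards [ae_restrict_mem measurableSet_Ioi] with s hs
    have hs' : 0 < s := hs
    intro y _
    exact (hd (τ + s) (by linarith) y).const_mul _

lemma mix_dt (hμ : 0 < μ) (hf : MB f) (hg : MB g) (hd : ∀ τ > 0, ∀ x, HasDerivAt (fun τ => f τ x) (g τ x) τ)
    {τ : ℝ} (hτ : 1 < τ) (x : ℝ) : HasDerivAt (fun τ => mix μ f τ x) (mix μ g τ x) τ := by
  unfold mix
  obtain ⟨C, hC⟩ := hg.bd |x|
  refine (hasDerivAt_integral_of_dominated_loc_of_deriv_le (bound := fun s => μ * exp (-μ * s) * C)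
    (F := fun τ s => μ * exp (-μ * s) * f (τ + s) x) (F' := fun τ s => μ * exp (-μ * s) * g (τ + s) x)
    (s := Ioi 1) (Ioi_mem_nhds hτ) ?_
    (mix_int hμ hf hτ.le x) (hg.aesm (by linarith) x) ?_ ((mix_wint hμ).mul_const C) ?_).2
  · filter_upwards [Ioi_mem_nhds hτ] with y hy
    have hy' : 1 < y := hy
    exact hf.aesm (by linarith) x
  · filter_upwards [ae_restrict_mem measurableSet_Ioi] with s hs
    have hs' : 0 < s := hs
    intro y hy
    have hy' : 1 < y := hy
    rw [norm_mul, norm_of_nonneg (by positivity)]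
    gcongr
    exact hC _ (by linarith) _ le_rfl
  · filter_upwards [ae_restrict_mem measurableSet_Ioi] with s hs
    have hs' : 0 < s := hs
    intro y hy
    have hy' : 1 < y := hy
    exact ((hd (y + s) (by linarith) x).comp_add_const y s).const_mul _

lemma mix_ibp (hμ : 0 < μ) (hf : MB f) (hg : MB g) (hd : ∀ τ > 0, ∀ x, HasDerivAt (fun τ => f τ x) (g τ x) τ)
    {τ : ℝ} (hτ : 1 ≤ τ) (x : ℝ) : mix μ g τ x = μ * mix μ f τ x - μ * f τ x := by
  obtain ⟨C, hC⟩ := hf.bd |x|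
  have hder : ∀ s ∈ Ici (0:ℝ), HasDerivAt (fun s => μ * exp (-μ * s) * f (τ + s) x)
      (μ * exp (-μ * s) * g (τ + s) x - μ * (μ * exp (-μ * s) * f (τ + s) x)) s := by
    intro s hs
    have hs' : 0 ≤ s := hs
    have h1 := (Front.exp1 (-μ) s).const_mul μ
    have h2 : HasDerivAt (fun s => f (τ + s) x) (g (τ + s) x) s := (hd (τ + s) (by linarith) x).comp_const_add τ s
    exact (h1.mul h2).congr_deriv (by ring)
  have hlim : Tendsto (fun s => μ * exp (-μ * s) * f (τ + s) x) atTop (𝓝 0) := by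
    have h1 : Tendsto (fun s : ℝ => μ * exp (-μ * s) * C) atTop (𝓝 0) := by
      have h2 : Tendsto (fun s : ℝ => -μ * s) atTop atBot := tendsto_id.const_mul_atTop_of_neg (by linarith)
      simpa using ((Real.tendsto_exp_atBot.comp h2).const_mul μ).mul_const C
    refine squeeze_zero_norm' ?_ h1
    filter_upwards [eventually_ge_atTop 0] with s hs
    rw [norm_mul, norm_of_nonneg (by positivity)]
    gcongr
    exact hC _ (by linarith) _ le_rfl
  have hi := (mix_int hμ hg hτ x).sub ((mix_int hμ hf hτ x).const_mul μ)
  have := integral_Ioi_of_hasDerivAt_of_tendsto' hder hi hlim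
  rw [integral_sub (mix_int hμ hg hτ x) ((mix_int hμ hf hτ x).const_mul μ), integral_const_mul] at this
  simp only [mul_zero, exp_zero, add_zero, mul_one] at this
  unfold mix
  linarith

end mixl

lemma grad_bound {p p1 p2 : ℝ → ℝ} {lam : ℝ} (hl : 0 ≤ lam) (d1 : ∀ x, HasDerivAt p (p1 x) x)
    (d2 : ∀ x, HasDerivAt p1 (p2 x) x) (h0 : ∀ x ≥ 0, 0 ≤ p x) (h2 : ∀ x ≥ 0, p2 x ≤ lam ^ 2 * p x)
    {x : ℝ} (hx : 0 < x) : |p1 x| ≤ (lam + 1 / x) * p x := by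
  have eN : ∀ y, HasDerivAt (fun y => exp (-lam * y)) (-lam * exp (-lam * y)) y := Front.exp1 (-lam)
  have eP : ∀ y, HasDerivAt (fun y => exp (lam * y)) (lam * exp (lam * y)) y := Front.exp1 lam
  have hpos : 0 ≤ 1 / x * p x := mul_nonneg (by positivity) (h0 x hx.le)
  rw [abs_le]
  constructor
  · by_contra hcon
    push Not at hcon
    have hneg : p1 x + lam * p x < 0 := by linarith
    have hG : AntitoneOn (fun y => (p1 y + lam * p y) * exp (-lam * y)) (Ici 0) := by
      refine antitoneOn_of_hasDerivWithinAt_nonpos (convex_Ici 0)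
        (f' := fun y => (p2 y - lam ^ 2 * p y) * exp (-lam * y)) ?_ ?_ ?_
      · exact fun y _ => (((d2 y).add ((d1 y).const_mul lam)).mul (eN y)).continuousAt.continuousWithinAt
      · exact fun y _ => ((((d2 y).add ((d1 y).const_mul lam)).mul (eN y)).congr_deriv (by simp; ring)).hasDerivWithinAt
      · intro y hy
        rw [interior_Ici] at hy
        have := h2 y (le_of_lt hy)
        exact mul_nonpos_of_nonpos_of_nonneg (by linarith) (exp_pos _).le
    set c := -(p1 x + lam * p x) * exp (-lam * x) with hc
    have hc0 : 0 < c := mul_pos (by linarith) (exp_pos _)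
    have hK : AntitoneOn (fun y => p y * exp (lam * y) + c * y) (Ici x) := by
      refine antitoneOn_of_hasDerivWithinAt_nonpos (convex_Ici x)
        (f' := fun y => (p1 y + lam * p y) * exp (lam * y) + c) ?_ ?_ ?_
      · exact fun y _ => (((d1 y).mul (eP y)).add ((hasDerivAt_id y).const_mul c)).continuousAt.continuousWithinAt
      · exact fun y _ => ((((d1 y).mul (eP y)).add ((hasDerivAt_id y).const_mul c)).congr_deriv (by ring)).hasDerivWithinAt
      · intro y hy
        rw [interior_Ici] at hy
        have hy' : x < y := hy
        have h3 := hG (show x ∈ Ici 0 from hx.le) (show y ∈ Ici (0:ℝ) from (by simp; linarith)) hy'.le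
        simp only at h3
        have e1 : exp (-lam * y) * exp (lam * y) = 1 := by rw [← exp_add]; simp
        have e2 : 1 ≤ exp (lam * y) := one_le_exp (mul_nonneg hl (by linarith))
        have e3 := exp_pos (-lam * y)
        have h4 : (p1 y + lam * p y) * exp (-lam * y) ≤ -c := by rw [hc]; linarith
        have h5 : (p1 y + lam * p y) = ((p1 y + lam * p y) * exp (-lam * y)) * exp (lam * y) := by
          rw [mul_assoc, e1, mul_one]
        have h6 : p1 y + lam * p y ≤ -c := by
          rw [h5]; nlinarith
        nlinarith
    set y := x + (p x * exp (lam * x) + 1) / c with hy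
    have hq : 0 ≤ p x * exp (lam * x) := mul_nonneg (h0 x hx.le) (exp_pos _).le
    have hyx : x ≤ y := by rw [hy]; have : 0 ≤ (p x * exp (lam * x) + 1) / c := by positivity
                           linarith
    have h7 := hK self_mem_Ici (show y ∈ Ici x from hyx) hyx
    simp only at h7
    have h8 : c * y = c * x + (p x * exp (lam * x) + 1) := by rw [hy]; field_simp
    have h9 : 0 ≤ p y * exp (lam * y) := mul_nonneg (h0 y (by linarith)) (exp_pos _).le
    linarith
  · by_contra hcon
    push Not at hcon
    set K := (p1 x - lam * p x) * exp (lam * x) with hK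
    have hK0 : 0 < K := mul_pos (by linarith) (exp_pos _)
    have hG : AntitoneOn (fun y => (p1 y - lam * p y) * exp (lam * y)) (Ici 0) := by
      refine antitoneOn_of_hasDerivWithinAt_nonpos (convex_Ici 0)
        (f' := fun y => (p2 y - lam ^ 2 * p y) * exp (lam * y)) ?_ ?_ ?_
      · exact fun y _ => (((d2 y).sub ((d1 y).const_mul lam)).mul (eP y)).continuousAt.continuousWithinAt
      · exact fun y _ => ((((d2 y).sub ((d1 y).const_mul lam)).mul (eP y)).congr_deriv (by simp; ring)).hasDerivWithinAt
      · intro y hy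
        rw [interior_Ici] at hy
        have := h2 y (le_of_lt hy)
        exact mul_nonpos_of_nonpos_of_nonneg (by linarith) (exp_pos _).le
    have hM : MonotoneOn (fun y => p y * exp (-lam * y) - K * exp (-lam * x) * exp (-lam * x) * y) (Icc 0 x) := by
      refine monotoneOn_of_hasDerivWithinAt_nonneg (convex_Icc 0 x)
        (f' := fun y => (p1 y - lam * p y) * exp (-lam * y) - K * exp (-lam * x) * exp (-lam * x)) ?_ ?_ ?_
      · exact fun y _ => (((d1 y).mul (eN y)).sub ((hasDerivAt_id y).const_mul _)).continuousAt.continuousWithinAt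
      · exact fun y _ => ((((d1 y).mul (eN y)).sub ((hasDerivAt_id y).const_mul _)).congr_deriv (by ring)).hasDerivWithinAt
      · intro y hy
        rw [interior_Icc] at hy
        have h3 := hG (show y ∈ Ici 0 from hy.1.le) (show x ∈ Ici (0:ℝ) from hx.le) hy.2.le
        simp only at h3
        rw [← hK] at h3
        have e1 : exp (lam * y) * exp (-lam * y) = 1 := by rw [← exp_add]; simp
        have e3 : exp (-lam * x) ≤ exp (-lam * y) :=
          exp_le_exp.2 (by have := mnl hy.2.le hl; linarith)
        have h5 : (p1 y - lam * p y) * exp (-lam * y) =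
          (p1 y - lam * p y) * exp (lam * y) * exp (-lam * y) * exp (-lam * y) := by
          rw [mul_assoc _ (exp (lam * y)), e1, mul_one]
        rw [h5, sub_nonneg]
        have := hK0.le.trans h3
        have := exp_pos (-lam * y)
        gcongr
    have h7 := hM (left_mem_Icc.2 hx.le) (right_mem_Icc.2 hx.le) hx.le
    simp only [mul_zero, exp_zero, sub_zero, mul_one] at h7
    have h8 := h0 0 le_rfl
    have e1 : exp (lam * x) * exp (-lam * x) = 1 := by rw [← exp_add]; simp
    have h9 : K * exp (-lam * x) = p1 x - lam * p x := by rw [hK, mul_assoc, e1, mul_one]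
    rw [h9] at h7
    have e := exp_pos (-lam * x)
    have h11 : (p1 x - lam * p x) * x ≤ p x := by
      have : ((p1 x - lam * p x) * x) * exp (-lam * x) ≤ p x * exp (-lam * x) := by linarith
      exact le_of_mul_le_mul_right this e
    have h12 : p1 x - lam * p x ≤ 1 / x * p x := by
      rw [one_div, inv_mul_eq_div, le_div_iff₀ hx]; exact h11
    linarith

noncomputable def wt (τ : ℝ) : ℝ := (τ * sqrt τ)⁻¹

lemma wt_pos {τ : ℝ} (h : 0 < τ) : 0 < wt τ := by unfold wt; positivity

lemma wt_anti {τ τ' : ℝ} (h : 0 < τ) (h' : τ ≤ τ') : wt τ' ≤ wt τ := by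
  unfold wt
  have := sqrt_pos.2 h
  have := h.trans_le h'
  gcongr

lemma wt_deriv {τ : ℝ} (h : 0 < τ) : HasDerivAt wt (-(3 / (2 * τ)) * wt τ) τ := by
  unfold wt
  have hs := sqrt_pos.2 h
  have h1 := ((hasDerivAt_id τ).mul ((hasDerivAt_id τ).sqrt h.ne')).inv (by simp only [id, Pi.mul_apply]; positivity)
  refine h1.congr_deriv ?_
  simp only [id, Pi.mul_apply]
  have e := sq_sqrt h.le
  field_simp
  rw [e]; ring

noncomputable def e0 : ℝ := (sqrt (4 * Real.pi))⁻¹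
lemma e0_le : e0 ≤ 1 := by
  unfold e0
  have : (1:ℝ) ≤ sqrt (4 * Real.pi) := by rw [Real.one_le_sqrt]; linarith [Real.pi_gt_three]
  exact inv_le_one_of_one_le₀ this
lemma e0_ge : 1 / 4 ≤ e0 := by
  unfold e0
  rw [one_div]
  have hp := Real.pi_pos
  apply inv_anti₀ (by positivity)
  rw [Real.sqrt_le_left (by norm_num)]
  linarith [Real.pi_le_four]
lemma gk_e0 {τ : ℝ} (h : 0 < τ) (z : ℝ) : gk τ z = e0 * (sqrt τ)⁻¹ * exp (-z ^ 2 / (4 * τ)) := by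
  unfold gk e0
  rw [Real.sqrt_mul (by have := Real.pi_pos; positivity), mul_inv]

noncomputable def EE (τ z : ℝ) : ℝ := τ⁻¹ * gk τ z
lemma EE_eq {τ : ℝ} (h : 0 < τ) (z : ℝ) : EE τ z = e0 * wt τ * exp (-z ^ 2 / (4 * τ)) := by
  unfold EE wt; rw [gk_e0 h, mul_inv]; ring
lemma EE_pos {τ : ℝ} (h : 0 < τ) (z : ℝ) : 0 < EE τ z := by
  unfold EE; have := gk_pos h z; positivity
lemma exp_gauss_le {τ : ℝ} (h : 0 < τ) (z : ℝ) : exp (-z ^ 2 / (4 * τ)) ≤ 1 := by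
  apply exp_le_one_iff.2
  apply div_nonpos_of_nonpos_of_nonneg <;> nlinarith [sq_nonneg z]
lemma EE_le {τ : ℝ} (h : 0 < τ) (z : ℝ) : EE τ z ≤ wt τ := by
  rw [EE_eq h]
  have h1 := wt_pos h
  have h2 := e0_le
  have h3 := exp_gauss_le h z
  have h4 : 0 < e0 := by linarith [e0_ge]
  calc e0 * wt τ * _ ≤ 1 * wt τ * 1 := by gcongr
    _ = _ := by ring
lemma EE_dz {τ : ℝ} (h : 0 < τ) (z : ℝ) : HasDerivAt (EE τ) (-z / (2 * τ) * EE τ z) z := by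
  unfold EE
  refine ((gk_deriv_z h z).const_mul τ⁻¹).congr_deriv ?_
  unfold gk1; ring
lemma EE_dt {τ : ℝ} (h : 0 < τ) (z : ℝ) :
    HasDerivAt (fun τ => EE τ z) ((z ^ 2 / (4 * τ ^ 2) - 3 / (2 * τ)) * EE τ z) τ := by
  unfold EE
  refine ((hasDerivAt_inv h.ne').mul (gk_deriv_t h z)).congr_deriv ?_
  unfold gk2; field_simp; ring

lemma ker_eq {τ : ℝ} (h : 0 < τ) (x Y : ℝ) : gk τ (x + Y) = gk τ (x - Y) * exp (-(x * Y / τ)) := by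
  unfold gk
  rw [mul_assoc (sqrt _)⁻¹, ← exp_add]
  congr 2
  field_simp; ring

lemma ker_le {τ : ℝ} (h : 0 < τ) {x Y : ℝ} (hx : 0 ≤ x) (hY : 0 ≤ Y) :
    0 ≤ gk τ (x - Y) - gk τ (x + Y) ∧ gk τ (x - Y) - gk τ (x + Y) ≤ x * wt τ * Y := by
  rw [ker_eq h]
  have h1 := gk_pos h (x - Y)
  have hw : 0 ≤ x * Y / τ := by positivity
  have h2 := add_one_le_exp (-(x * Y / τ))
  have h3 : exp (-(x * Y / τ)) ≤ 1 := exp_le_one_iff.2 (by linarith)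
  constructor
  · nlinarith
  · have h4 : gk τ (x - Y) * (1 - exp (-(x * Y / τ))) ≤ gk τ (x - Y) * (x * Y / τ) := by
      apply mnl _ h1.le; linarith
    have h5 := EE_le h (x - Y)
    have h6 : gk τ (x - Y) * (x * Y / τ) = x * Y * EE τ (x - Y) := by unfold EE; ring
    have h7 : x * Y * EE τ (x - Y) ≤ x * Y * wt τ := by gcongr
    linarith

lemma ker_dt {τ : ℝ} (h : 0 < τ) {x Y : ℝ} (hx : 0 ≤ x) (hY : 0 ≤ Y) :
    -(3 / (2 * τ)) * (gk τ (x - Y) - gk τ (x + Y)) ≤ gk2 τ (x - Y) - gk2 τ (x + Y) := by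
  unfold gk2
  rw [ker_eq h]
  have h1 := gk_pos h (x - Y)
  set G := gk τ (x - Y)
  have hw : 0 ≤ x * Y / τ := by positivity
  set W := x * Y / τ with hW
  have h2 := add_one_le_exp W
  have h3 : exp W * exp (-W) = 1 := by rw [← exp_add]; simp
  set e := exp (-W)
  have he : 0 < e := exp_pos _
  have h4 : W * e ≤ 1 - e := by nlinarith
  have h5 : 0 ≤ 1 - e := le_trans (by positivity) h4
  have key : ((x - Y) ^ 2 / (4 * τ ^ 2) - 1 / (2 * τ)) * G - ((x + Y) ^ 2 / (4 * τ ^ 2) - 1 / (2 * τ)) * (G * e)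
    - (-(3 / (2 * τ)) * (G - G * e)) = G * (1 / τ * (1 - e - W * e) + (x - Y) ^ 2 / (4 * τ ^ 2) * (1 - e)) := by
    have : x * Y = W * τ := by rw [hW]; field_simp
    have e2 : (x + Y) ^ 2 = (x - Y) ^ 2 + 4 * (W * τ) := by rw [← this]; ring
    rw [e2]; field_simp; ring
  have h6 : 0 ≤ G * (1 / τ * (1 - e - W * e) + (x - Y) ^ 2 / (4 * τ ^ 2) * (1 - e)) := by
    have : 0 ≤ 1 - e - W * e := by linarith
    positivity
  linarith

lemma HmK_MB {K : ℝ → ℝ → ℝ} (hK : KB K) {n Y : ℝ → ℝ} (hn : Integrable n) (hY : Continuous Y) :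
    MB (HmK K n Y) := by
  refine ⟨fun p hp => (HmK_contAt hK hn hY hp p.2).continuousWithinAt, fun N => ?_⟩
  obtain ⟨C, hC⟩ := hK.bdd 1 one_pos
  refine ⟨∫ y, ‖n y‖ * C, fun τ hτ x _ => ?_⟩
  unfold HmK
  rw [← Real.norm_eq_abs]
  refine norm_integral_le_of_norm_le (hn.norm.mul_const C) (Eventually.of_forall fun y => ?_)
  rw [norm_mul]
  gcongr
  exact hC τ hτ _

section f1
variable {g : ℝ → ℝ}

noncomputable def fo (K : ℝ → ℝ → ℝ) (g : ℝ → ℝ) (τ x : ℝ) : ℝ :=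
  HmK K g (fun y => 1 + |y|) τ x + -1 * HmK K g (fun y => -(1 + |y|)) τ x

lemma fo_MB {K : ℝ → ℝ → ℝ} (hK : KB K) (hg : Integrable g) : MB (fo K g) :=
  (HmK_MB hK hg (by fun_prop)).add ((MB_const (fun _ => -1) continuous_const).mul (HmK_MB hK hg (by fun_prop)))

lemma fo_int {K : ℝ → ℝ → ℝ} (hK : KB K) (hg : Integrable g) {τ : ℝ} (hτ : 0 < τ) (x : ℝ) :
    Integrable (fun y => g y * (K τ (x - (1 + |y|)) - K τ (x + (1 + |y|)))) ∧
    fo K g τ x = ∫ y, g y * (K τ (x - (1 + |y|)) - K τ (x + (1 + |y|))) := by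
  have h1 := HmK_integrable hK hg (Y := fun y => 1 + |y|) (by fun_prop) hτ x
  have h2 := HmK_integrable hK hg (Y := fun y => -(1 + |y|)) (by fun_prop) hτ x
  have e : (fun y => g y * (K τ (x - (1 + |y|)) - K τ (x + (1 + |y|)))) =
      fun y => g y * K τ (x - (1 + |y|)) - g y * K τ (x - -(1 + |y|)) := by
    ext y; rw [sub_neg_eq_add]; ring
  rw [e]
  refine ⟨h1.sub h2, ?_⟩
  rw [integral_sub h1 h2]
  unfold fo HmK; ring

lemma fo_dx {K K' : ℝ → ℝ → ℝ} (hK : KB K) (hK' : KB K')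
    (hd : ∀ τ > 0, ∀ z, HasDerivAt (fun z => K τ z) (K' τ z) z) (hg : Integrable g) :
    ∀ τ > 0, ∀ x, HasDerivAt (fo K g τ) (fo K' g τ x) x := fun τ hτ x =>
  (HmK_deriv_x hK hK' hd hg (by fun_prop) hτ x).add ((HmK_deriv_x hK hK' hd hg (by fun_prop) hτ x).const_mul (-1))

lemma fo_dt (hg : Integrable g) : ∀ τ > 0, ∀ x, HasDerivAt (fun τ => fo gk g τ x) (fo gk2 g τ x) τ := fun τ hτ x =>
  (Hm_dt hg (by fun_prop) hτ x).add ((Hm_dt hg (by fun_prop) hτ x).const_mul (-1))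

lemma fo_nonneg (hg : Integrable g) (hg0 : ∀ y, 0 ≤ g y) {τ x : ℝ} (hτ : 0 < τ) (hx : 0 ≤ x) : 0 ≤ fo gk g τ x := by
  rw [(fo_int KB_gk hg hτ x).2]
  exact integral_nonneg fun y => mul_nonneg (hg0 y) (ker_le hτ hx (by positivity)).1

lemma fo_le (hg : Integrable g) (hg0 : ∀ y, 0 ≤ g y) (hg1 : Integrable (fun y => (1 + |y|) * g y)) {N : ℝ}
    (hN : ∫ y, (1 + |y|) * g y ≤ N) {τ x : ℝ} (hτ : 0 < τ) (hx : 0 ≤ x) : fo gk g τ x ≤ N * x * wt τ := by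
  obtain ⟨h1, h2⟩ := fo_int KB_gk hg hτ x
  rw [h2]
  have hw := wt_pos hτ
  calc _ ≤ ∫ y, (x * wt τ) * ((1 + |y|) * g y) := by
        refine integral_mono h1 (hg1.const_mul _) fun y => ?_
        have := mnl (ker_le hτ hx (show 0 ≤ 1 + |y| by positivity)).2 (hg0 y)
        simp only; linarith
    _ = (x * wt τ) * ∫ y, (1 + |y|) * g y := integral_const_mul _ _
    _ ≤ (x * wt τ) * N := by gcongr
    _ = _ := by ring

lemma fo_dt_ge (hg : Integrable g) (hg0 : ∀ y, 0 ≤ g y) {τ x : ℝ} (hτ : 0 < τ) (hx : 0 ≤ x) :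
    -(3 / (2 * τ)) * fo gk g τ x ≤ fo gk2 g τ x := by
  obtain ⟨h1, h2⟩ := fo_int KB_gk hg hτ x
  obtain ⟨h3, h4⟩ := fo_int KB_gk2 hg hτ x
  rw [h2, h4, ← integral_const_mul]
  refine integral_mono (h1.const_mul _) h3 fun y => ?_
  have := mnl (ker_dt hτ hx (show 0 ≤ 1 + |y| by positivity)) (hg0 y)
  simp only; linarith

lemma fo_ge {τ1 : ℝ} (hτ1 : 32 ≤ τ1) : ∃ c > 0, ∀ g : ℝ → ℝ, Integrable g → (∀ y, 0 ≤ g y) → ∀ τ ∈ Icc 32 τ1, ∀ x ≥ 1,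
    c * ∫ y, g y * exp (-(x - y) ^ 2 / 64) ≤ fo gk g τ x := by
  have hτ10 : 0 < τ1 := by linarith
  have he0 : 0 < e0 := by linarith [e0_ge]
  have hc1 : 0 < 1 - exp (-(1 / τ1)) := by
    have : exp (-(1 / τ1)) < 1 := Real.exp_lt_one_iff.2 (by simp [hτ10])
    linarith
  refine ⟨e0 * (sqrt τ1)⁻¹ * exp (-1) * (1 - exp (-(1 / τ1))), by positivity, ?_⟩
  intro g hg hg0 τ hτ x hx
  have hτ0 : 0 < τ := by linarith [hτ.1]
  obtain ⟨h1, h2⟩ := fo_int KB_gk hg hτ0 x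
  rw [h2, ← integral_const_mul]
  refine integral_mono_of_nonneg (Eventually.of_forall fun y => ?_) h1 (Eventually.of_forall fun y => ?_)
  · have := hg0 y
    simp only [Pi.zero_apply]; positivity
  · simp only
    have hY : 0 ≤ 1 + |y| := by positivity
    rw [ker_eq hτ0, gk_e0 hτ0]
    have a1 : (sqrt τ1)⁻¹ ≤ (sqrt τ)⁻¹ :=
      inv_anti₀ (sqrt_pos.2 hτ0) (Real.sqrt_le_sqrt hτ.2)
    have a2 : exp (-(x * (1 + |y|) / τ)) ≤ exp (-(1 / τ1)) := by
      apply exp_le_exp.2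
      rw [neg_le_neg_iff, div_le_div_iff₀ hτ10 hτ0]
      have h0 := abs_nonneg y
      nlinarith [hτ.2, mul_nonneg (sub_nonneg.2 hx) h0, mul_nonneg hτ10.le h0]
    have a3 : exp (-1) * exp (-(x - y) ^ 2 / 64) ≤ exp (-(x - (1 + |y|)) ^ 2 / (4 * τ)) := by
      rw [← exp_add]
      apply exp_le_exp.2
      have hq : (x - (1 + |y|)) ^ 2 ≤ 2 * (x - y) ^ 2 + 2 := by
        rcases le_total 0 y with hy | hy
        · rw [abs_of_nonneg hy]; nlinarith [sq_nonneg (x - y + 1)]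
        · rw [abs_of_nonpos hy]
          nlinarith [sq_nonneg (x - y)]
      have hq2 : (x - (1 + |y|)) ^ 2 / (4 * τ) ≤ (2 * (x - y) ^ 2 + 2) / 128 := by
        apply div_le_div₀ (by positivity) hq (by norm_num) (by linarith [hτ.1])
      rw [neg_div, neg_div]
      have : (2 * (x - y) ^ 2 + 2) / 128 = (x - y) ^ 2 / 64 + 1 / 64 := by ring
      linarith
    have hgy := hg0 y
    have hE1 := exp_pos (-(x - y) ^ 2 / 64)
    have hs : 0 < sqrt τ := sqrt_pos.2 hτ0
    calc _ = g y * ((e0 * (sqrt τ1)⁻¹ * (exp (-1) * exp (-(x - y) ^ 2 / 64))) * (1 - exp (-(1 / τ1)))) := by ring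
      _ ≤ g y * ((e0 * (sqrt τ)⁻¹ * exp (-(x - (1 + |y|)) ^ 2 / (4 * τ))) * (1 - exp (-(x * (1 + |y|) / τ)))) := by
        gcongr
      _ = _ := by ring

end f1

section k0
variable {κ H : ℝ}

lemma MBE (H : ℝ) : MB (fun s y => EE s (y + H)) := by
  refine ⟨?_, fun N => ⟨1, fun τ hτ x _ => ?_⟩⟩
  · unfold EE
    refine ContinuousOn.mul (ContinuousOn.inv₀ (by fun_prop) fun p hp => (ne_of_gt hp)) ?_
    exact gk_cont.comp (f := fun p : ℝ × ℝ => (p.1, p.2 + H)) (by fun_prop) (fun p hp => hp)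
  · have h0 : 0 < τ := by linarith
    rw [abs_of_pos (EE_pos h0 _)]
    refine (EE_le h0 _).trans ((wt_anti one_pos hτ).trans ?_)
    unfold wt; simp

noncomputable def k0 (κ H s y : ℝ) : ℝ := EE s (y + H) * (y + H - exp (-κ * y))
noncomputable def k0x (κ H s y : ℝ) : ℝ :=
  s⁻¹ * EE s (y + H) * (-(y + H) / 2 * (y + H - exp (-κ * y))) + EE s (y + H) * (1 + κ * exp (-κ * y))
noncomputable def k0xx (κ H s y : ℝ) : ℝ :=
  s⁻¹ * s⁻¹ * EE s (y + H) * ((y + H) ^ 2 / 4 * (y + H - exp (-κ * y)))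
   + s⁻¹ * EE s (y + H) * (-(1 / 2) * (y + H - exp (-κ * y)) - (y + H) * (1 + κ * exp (-κ * y)))
   + EE s (y + H) * (-κ ^ 2 * exp (-κ * y))
noncomputable def k0t (κ H s y : ℝ) : ℝ :=
  s⁻¹ * s⁻¹ * EE s (y + H) * ((y + H) ^ 2 / 4 * (y + H - exp (-κ * y)))
   + s⁻¹ * EE s (y + H) * (-(3 / 2) * (y + H - exp (-κ * y)))

lemma MBk0 : MB (k0 κ H) := (MBE H).mul (MB_const (fun y => (y + H - exp (-κ * y))) (by fun_prop))
lemma MBk0x : MB (k0x κ H) := ((MB_inv.mul (MBE H)).mul (MB_const (fun y => (-(y + H) / 2 * (y + H - exp (-κ * y)))) (by fun_prop))).add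
  ((MBE H).mul (MB_const (fun y => (1 + κ * exp (-κ * y))) (by fun_prop)))
lemma MBk0xx : MB (k0xx κ H) :=
  ((((MB_inv.mul MB_inv).mul (MBE H)).mul (MB_const (fun y => ((y + H) ^ 2 / 4 * (y + H - exp (-κ * y)))) (by fun_prop))).add
  ((MB_inv.mul (MBE H)).mul (MB_const (fun y => (-(1 / 2) * (y + H - exp (-κ * y)) - (y + H) * (1 + κ * exp (-κ * y)))) (by fun_prop)))).add
  ((MBE H).mul (MB_const (fun y => (-κ ^ 2 * exp (-κ * y))) (by fun_prop)))
lemma MBk0t : MB (k0t κ H) :=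
  (((MB_inv.mul MB_inv).mul (MBE H)).mul (MB_const (fun y => ((y + H) ^ 2 / 4 * (y + H - exp (-κ * y)))) (by fun_prop))).add
  ((MB_inv.mul (MBE H)).mul (MB_const (fun y => (-(3 / 2) * (y + H - exp (-κ * y)))) (by fun_prop)))

lemma k0_A (κ H x : ℝ) : HasDerivAt (fun y => y + H - exp (-κ * y)) (1 + κ * exp (-κ * x)) x :=
  (((hasDerivAt_id x).add_const H).sub (Front.exp1 (-κ) x)).congr_deriv (by ring)

lemma k0_dx : ∀ τ > 0, ∀ x, HasDerivAt (k0 κ H τ) (k0x κ H τ x) x := by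
  intro τ hτ x
  have h1 := (EE_dz hτ (x + H)).comp_add_const x H
  refine (h1.mul (k0_A κ H x)).congr_deriv ?_
  unfold k0x; ring

lemma k0_dxx : ∀ τ > 0, ∀ x, HasDerivAt (k0x κ H τ) (k0xx κ H τ x) x := by
  intro τ hτ x
  have h1 := (EE_dz hτ (x + H)).comp_add_const x H
  have h2 : HasDerivAt (fun y => -(y + H) / 2) (-1 / 2) x := (((hasDerivAt_id x).add_const H).neg).div_const 2
  have h3 := (h1.const_mul τ⁻¹).mul (h2.mul (k0_A κ H x))
  have h4 := h1.mul (((Front.exp1 (-κ) x).const_mul κ).const_add 1)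
  refine (h3.add h4).congr_deriv ?_
  unfold k0xx; simp only [Pi.mul_apply]; ring

lemma k0_dt : ∀ τ > 0, ∀ x, HasDerivAt (fun τ => k0 κ H τ x) (k0t κ H τ x) τ := by
  intro τ hτ x
  refine ((EE_dt hτ (x + H)).mul_const _).congr_deriv ?_
  unfold k0t
  field_simp
  ring

lemma k0_margin {τ x : ℝ} (hτ : 0 < τ) (hκ : 0 < κ) (hz : 0 ≤ x + H) :
    κ ^ 2 * exp (-κ * x) * EE τ (x + H) ≤ k0t κ H τ x - k0xx κ H τ x := by
  have e : k0t κ H τ x - k0xx κ H τ x - κ ^ 2 * exp (-κ * x) * EE τ (x + H) =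
      τ⁻¹ * EE τ (x + H) * exp (-κ * x) * (1 + κ * (x + H)) := by
    unfold k0t k0xx; ring
  have := EE_pos hτ (x + H)
  have : 0 ≤ τ⁻¹ * EE τ (x + H) * exp (-κ * x) * (1 + κ * (x + H)) := by positivity
  linarith

lemma k0_bds {τ x : ℝ} (hτ : 0 < τ) (hκ : 0 < κ) (hx : 0 ≤ x) (hH : 1 ≤ H) :
    EE τ (x + H) * (x + H - 1) ≤ k0 κ H τ x ∧ k0 κ H τ x ≤ (x + H) * EE τ (x + H) ∧
    -(3 / (2 * τ)) * k0 κ H τ x ≤ k0t κ H τ x := by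
  have h1 := EE_pos hτ (x + H)
  have h2 : exp (-κ * x) ≤ 1 := exp_le_one_iff.2 (by nlinarith)
  have h3 := exp_pos (-κ * x)
  have hA : 0 ≤ x + H - exp (-κ * x) := by linarith
  refine ⟨by unfold k0; gcongr, by unfold k0; nlinarith, ?_⟩
  have e : k0t κ H τ x - -(3 / (2 * τ)) * k0 κ H τ x =
      τ⁻¹ * τ⁻¹ * EE τ (x + H) * ((x + H) ^ 2 / 4 * (x + H - exp (-κ * x))) := by
    unfold k0t k0; field_simp; ring
  have : 0 ≤ τ⁻¹ * τ⁻¹ * EE τ (x + H) * ((x + H) ^ 2 / 4 * (x + H - exp (-κ * x))) := by positivity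
  linarith
end k0

lemma wt_two {τ : ℝ} (h : 0 < τ) : wt τ / 3 ≤ wt (2 * τ) := by
  unfold wt
  have hs := sqrt_pos.2 h
  rw [Real.sqrt_mul (by norm_num), div_eq_mul_inv, ← mul_inv]
  apply inv_anti₀ (by positivity)
  have h2 : sqrt 2 ≤ 3 / 2 := by rw [Real.sqrt_le_left (by norm_num)]; norm_num
  have : 0 < τ * sqrt τ := by positivity
  nlinarith

theorem bblock {μ κ H τ0 : ℝ} (hμ : 0 < μ) (hκ : 0 < κ) (hH : 1 ≤ H) (hτ0 : 32 ≤ τ0) :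
    ∃ c > 0, ∀ (g : ℝ → ℝ) (N Λ : ℝ), Integrable g → (∀ y, 0 ≤ g y) → Integrable (fun y => (1 + |y|) * g y) →
      ∫ y, (1 + |y|) * g y ≤ N → 0 ≤ Λ → ∃ p p1 p2 pt : ℝ → ℝ → ℝ,
      (∀ τ > 1, ∀ x, HasDerivAt (fun s => p s x) (pt τ x) τ) ∧
      (∀ τ > 1, ∀ x, HasDerivAt (p τ) (p1 τ x) x) ∧
      (∀ τ > 1, ∀ x, HasDerivAt (p1 τ) (p2 τ x) x) ∧
      (∀ τ > 1, ∀ x, ContinuousAt (fun q : ℝ × ℝ => p q.1 q.2) (τ, x)) ∧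
      (∀ τ > 1, ∀ x ≥ 0, 0 ≤ p τ x ∧ -(3 / (2 * τ)) * p τ x ≤ pt τ x ∧ pt τ x ≤ μ * p τ x ∧ p2 τ x ≤ pt τ x ∧
        p τ x ≤ wt τ * (N * x + Λ * (x + H))) ∧
      (∀ τ > 1, ∀ x > 0, |p1 τ x| ≤ (sqrt μ + 1 / x) * p τ x) ∧
      (∀ τ > 1, ∀ x ≥ 0, ∀ R > 0, ∃ Eb, μ * exp (-μ * (R * (x + H) + 1)) *
          (wt (τ + R * (x + H) + 1) * exp (-((x + H) / (4 * R))) / 4) ≤ Eb ∧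
        Λ * κ ^ 2 * exp (-κ * x) * Eb ≤ pt τ x - p2 τ x ∧ p τ x ≤ N * x * wt τ + Λ * (x + H) * Eb) ∧
      (∀ τ > 1, ∀ x ≥ 0, 1 / μ ≤ τ → (x + H) ^ 2 ≤ τ → Λ * (exp (-2) / 12) * wt τ * (x + H - 1) ≤ p τ x) ∧
      (∀ x ≥ 1, c * ∫ y, g y * exp (-(x - y) ^ 2 / 64) ≤ p τ0 x) := by
  obtain ⟨c, hc, hcb⟩ := fo_ge (τ1 := τ0 + 1) (by linarith)
  refine ⟨μ * 1 * exp (-μ * (0 + 1)) * c, by positivity, ?_⟩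
  intro g N Λ hg hg0 hg1 hN hΛ
  have hN0 : 0 ≤ N := le_trans (integral_nonneg fun y => mul_nonneg (by positivity) (hg0 y)) hN
  have dxf : ∀ τ > 0, ∀ x, HasDerivAt (fun y => 1 * fo gk g τ y + Λ * k0 κ H τ y) (1 * fo gk1 g τ x + Λ * k0x κ H τ x) x :=
    fun τ hτ x => ((fo_dx KB_gk KB_gk1 (fun _ h z => gk_deriv_z h z) hg τ hτ x).const_mul 1).add ((k0_dx τ hτ x).const_mul Λ)
  have dxxf : ∀ τ > 0, ∀ x, HasDerivAt (fun y => 1 * fo gk1 g τ y + Λ * k0x κ H τ y) (1 * fo gk2 g τ x + Λ * k0xx κ H τ x) x :=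
    fun τ hτ x => ((fo_dx KB_gk1 KB_gk2 (fun _ h z => gk1_deriv_z h z) hg τ hτ x).const_mul 1).add ((k0_dxx τ hτ x).const_mul Λ)
  have dtf : ∀ τ > 0, ∀ x, HasDerivAt (fun τ => 1 * fo gk g τ x + Λ * k0 κ H τ x) (1 * fo gk2 g τ x + Λ * k0t κ H τ x) τ :=
    fun τ hτ x => ((fo_dt hg τ hτ x).const_mul 1).add ((k0_dt τ hτ x).const_mul Λ)
  have hlin : ∀ {f1 f2 : ℝ → ℝ → ℝ}, MB f1 → MB f2 → MB (fun s y => 1 * f1 s y + Λ * f2 s y) := fun h1 h2 =>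
    ((MB_const (fun _ => 1) continuous_const).mul h1).add ((MB_const (fun _ => Λ) continuous_const).mul h2)
  have hf := hlin (fo_MB KB_gk hg) (MBk0 (κ := κ) (H := H))
  have hfx := hlin (fo_MB KB_gk1 hg) (MBk0x (κ := κ) (H := H))
  have hfxx := hlin (fo_MB KB_gk2 hg) (MBk0xx (κ := κ) (H := H))
  have hft := hlin (fo_MB KB_gk2 hg) (MBk0t (κ := κ) (H := H))
  have hk0n : ∀ {τ x : ℝ}, 0 < τ → 0 ≤ x → 0 ≤ k0 κ H τ x := fun {τ x} hτ hx =>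
    le_trans (mul_nonneg (EE_pos hτ _).le (by linarith)) (k0_bds hτ hκ hx hH).1
  have hfn : ∀ τ > 0, ∀ x ≥ 0, 0 ≤ 1 * fo gk g τ x + Λ * k0 κ H τ x := fun τ hτ x hx => by
    have := fo_nonneg hg hg0 hτ hx
    have := hk0n hτ hx
    positivity
  have hmar : ∀ τ > 0, ∀ x ≥ 0, Λ * κ ^ 2 * exp (-κ * x) * EE τ (x + H) + (1 * fo gk2 g τ x + Λ * k0xx κ H τ x)
      ≤ 1 * fo gk2 g τ x + Λ * k0t κ H τ x := fun τ hτ x hx => by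
    have := mnl (k0_margin (κ := κ) (H := H) (x := x) hτ hκ (by linarith)) hΛ
    linarith
  have main : ∀ τ > 1, ∀ x ≥ 0, 0 ≤ mix μ (fun s y => 1 * fo gk g s y + Λ * k0 κ H s y) τ x ∧
      -(3 / (2 * τ)) * mix μ (fun s y => 1 * fo gk g s y + Λ * k0 κ H s y) τ x ≤ mix μ (fun s y => 1 * fo gk2 g s y + Λ * k0t κ H s y) τ x ∧
      mix μ (fun s y => 1 * fo gk2 g s y + Λ * k0t κ H s y) τ x ≤ μ * mix μ (fun s y => 1 * fo gk g s y + Λ * k0 κ H s y) τ x ∧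
      mix μ (fun s y => 1 * fo gk2 g s y + Λ * k0xx κ H s y) τ x ≤ mix μ (fun s y => 1 * fo gk2 g s y + Λ * k0t κ H s y) τ x ∧
      mix μ (fun s y => 1 * fo gk g s y + Λ * k0 κ H s y) τ x ≤ wt τ * (N * x + Λ * (x + H)) := by
    intro τ hτ x hx
    refine ⟨mix_nonneg hμ fun s hs => hfn s (by linarith) x hx, ?_, ?_, ?_, ?_⟩
    · have h1 := mix_lin hμ hf hf hτ.le x (-(3 / (2 * τ))) 0
      rw [zero_mul, add_zero] at h1
      rw [← h1]
      refine mix_mono hμ (((MB_const (fun _ => (-(3 / (2 * τ)))) continuous_const).mul hf).add ((MB_const (fun _ => 0) continuous_const).mul hf))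
        hft hτ.le x fun s hs => ?_
      have hs0 : 0 < s := by linarith
      have h2 := fo_dt_ge hg hg0 hs0 hx
      have h3 := mnl (k0_bds hs0 hκ hx hH).2.2 hΛ
      have h4 := hfn s hs0 x hx
      have h5 : 3 / (2 * s) ≤ 3 / (2 * τ) := by gcongr
      have h6 := mnr h5 h4
      linarith
    · rw [mix_ibp hμ hf hft dtf hτ.le x]
      have := mul_nonneg hμ.le (hfn τ (by linarith) x hx)
      linarith
    · refine mix_mono hμ hfxx hft hτ.le x fun s hs => ?_
      have hs0 : 0 < s := by linarith
      have h1 := hmar s hs0 x hx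
      have := EE_pos hs0 (x + H)
      have : 0 ≤ Λ * κ ^ 2 * exp (-κ * x) * EE s (x + H) := by positivity
      linarith
    · refine mix_le hμ hf hτ.le fun s hs => ?_
      have hs0 : 0 < s := by linarith
      have h1 := fo_le hg hg0 hg1 hN hs0 hx
      have h2 := (k0_bds hs0 hκ hx hH).2.1
      have h3 : (x + H) * EE s (x + H) ≤ (x + H) * wt s := mnl (EE_le hs0 _) (by linarith)
      have h4 := mnl (h2.trans h3) hΛ
      have h5 := mnr (wt_anti (by linarith) hs) (show 0 ≤ N * x + Λ * (x + H) by
        have : 0 ≤ x + H := by linarith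
        positivity)
      linarith
  refine ⟨mix μ (fun s y => 1 * fo gk g s y + Λ * k0 κ H s y), mix μ (fun s y => 1 * fo gk1 g s y + Λ * k0x κ H s y),
    mix μ (fun s y => 1 * fo gk2 g s y + Λ * k0xx κ H s y), mix μ (fun s y => 1 * fo gk2 g s y + Λ * k0t κ H s y),
    fun τ hτ x => mix_dt hμ hf hft dtf hτ x, fun τ hτ x => mix_dx hμ hf hfx dxf hτ.le x,
    fun τ hτ x => mix_dx hμ hfx hfxx dxxf hτ.le x, fun τ hτ x => mix_contAt hμ hf hτ x, main, ?_, ?_, ?_, ?_⟩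
  · intro τ hτ x hx
    refine grad_bound (Real.sqrt_nonneg μ) (fun x => mix_dx hμ hf hfx dxf hτ.le x)
      (fun x => mix_dx hμ hfx hfxx dxxf hτ.le x) (fun y hy => (main τ hτ y hy).1) (fun y hy => ?_) hx
    rw [sq_sqrt hμ.le]
    obtain ⟨_, _, h3, h4, _⟩ := main τ hτ y hy
    exact h4.trans h3
  · intro τ hτ x hx R hR
    have hz : 0 < x + H := by linarith
    refine ⟨mix μ (fun s y => EE s (y + H)) τ x, ?_, ?_, ?_⟩
    · have hq : 0 < wt (τ + R * (x + H) + 1) := wt_pos (by positivity)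
      have := mix_ge hμ (MBE H) hτ.le (x := x) (s1 := R * (x + H)) (l := 1)
        (c := wt (τ + R * (x + H) + 1) * exp (-((x + H) / (4 * R))) / 4) (by positivity) one_pos.le (by positivity)
        (fun s hs => (EE_pos (by linarith) _).le) (fun s hs => by
          have hRz : 0 < R * (x + H) := by positivity
          have hs0 : 0 < s := by linarith [hs.1]
          rw [EE_eq (by linarith)]
          have h1 : wt (τ + R * (x + H) + 1) ≤ wt (τ + s) := wt_anti (by linarith) (by linarith [hs.2])
          have h2 : exp (-((x + H) / (4 * R))) ≤ exp (-(x + H) ^ 2 / (4 * (τ + s))) := by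
            apply exp_le_exp.2
            rw [neg_div, neg_le_neg_iff, div_le_div_iff₀ (by positivity) (by positivity)]
            nlinarith [hs.1, mul_nonneg hz.le (show 0 ≤ τ + s - R * (x + H) by linarith [hs.1])]
          have h3 := e0_ge
          have h4 : 0 < wt (τ + s) := wt_pos (by linarith)
          calc _ = 1 / 4 * wt (τ + R * (x + H) + 1) * exp (-((x + H) / (4 * R))) := by ring
            _ ≤ _ := by gcongr)
      rwa [mul_one] at this
    · have h1 := mix_lin hμ (MBE H) hfxx hτ.le x (Λ * κ ^ 2 * exp (-κ * x)) 1
      have h2 := mix_mono hμ (((MB_const (fun _ => Λ * κ ^ 2 * exp (-κ * x)) continuous_const).mul (MBE H)).add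
        ((MB_const (fun _ => 1) continuous_const).mul hfxx)) hft hτ.le x fun s hs => by
          have := hmar s (by linarith) x hx
          linarith
      linarith
    · have h1 := mix_lin hμ (MB_const (fun _ => 1) continuous_const) (MBE H) hτ.le x (N * x * wt τ) (Λ * (x + H))
      rw [mix_cst hμ 1] at h1
      have h2 := mix_mono hμ hf (((MB_const (fun _ => N * x * wt τ) continuous_const).mul (MB_const (fun _ => 1) continuous_const)).add
        ((MB_const (fun _ => Λ * (x + H)) continuous_const).mul (MBE H))) hτ.le x fun s hs => by
          have hs0 : 0 < s := by linarith
          have h1 := fo_le hg hg0 hg1 hN hs0 hx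
          have h2 := mnl (k0_bds hs0 hκ hx hH).2.1 hΛ
          have h3 := mnl (wt_anti (by linarith) hs) (show 0 ≤ N * x by positivity)
          linarith
      linarith
  · intro τ hτ x hx hτμ hzτ
    have hz : 0 ≤ x + H - 1 := by linarith
    have hw := wt_pos (show 0 < τ by linarith)
    have := mix_ge hμ hf hτ.le (x := x) (s1 := 0) (l := 1 / μ) (c := Λ * (exp (-1) / 12 * wt τ * (x + H - 1)))
      le_rfl (by positivity) (by positivity) (fun s hs => hfn s (by linarith) x hx) (fun s hs => by
        have hs0 : 0 < τ + s := by linarith [hs.1]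
        have h1 := (k0_bds hs0 hκ hx hH).1
        have h2 := fo_nonneg hg hg0 hs0 hx
        have h3 : exp (-1) / 12 * wt τ ≤ EE (τ + s) (x + H) := by
          rw [EE_eq hs0]
          have a1 := e0_ge
          have a2 : wt (2 * τ) ≤ wt (τ + s) := wt_anti hs0 (by linarith [hs.2])
          have a3 := wt_two (show 0 < τ by linarith)
          have a4 : exp (-1) ≤ exp (-(x + H) ^ 2 / (4 * (τ + s))) := by
            apply exp_le_exp.2
            rw [neg_div, neg_le_neg_iff, div_le_iff₀ (by positivity)]
            linarith [hs.1]
          have a5 := a3.trans a2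
          have hws := wt_pos hs0
          have he0 : 0 < e0 := by linarith
          calc _ = 1 / 4 * (wt τ / 3) * exp (-1) := by ring
            _ ≤ e0 * wt (τ + s) * exp (-(x + H) ^ 2 / (4 * (τ + s))) := by
              gcongr
        have h4 := (mnr h3 hz).trans h1
        have h5 := mnl h4 hΛ
        linarith)
    refine le_trans (le_of_eq ?_) this
    have e1 : μ * (1 / μ) = 1 := by field_simp
    have e2 : -μ * (0 + 1 / μ) = -1 := by field_simp; ring
    have e3 : exp (-2) = exp (-1) * exp (-1) := by rw [← exp_add]; norm_num
    rw [e1, e2, e3]; ring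
  · intro x hx
    have h1 : 0 ≤ c * ∫ y, g y * exp (-(x - y) ^ 2 / 64) :=
      mul_nonneg hc.le (integral_nonneg fun y => mul_nonneg (hg0 y) (exp_pos _).le)
    have := mix_ge hμ hf (show 1 ≤ τ0 by linarith) (x := x) (s1 := 0) (l := 1) le_rfl one_pos.le h1
      (fun s hs => hfn s (by linarith) x (by linarith)) (fun s hs => by
        have := hcb g hg hg0 (τ0 + s) ⟨by linarith [hs.1], by linarith [hs.2]⟩ x hx
        have := mul_nonneg hΛ (hk0n (show 0 < τ0 + s by linarith [hs.1]) (show 0 ≤ x by linarith))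
        linarith)
    linarith

lemma wt_mul_ge {τ τ' s : ℝ} (h : 0 < τ) (hs : 1 ≤ s) (h' : 0 < τ') (hle : τ' ≤ τ * s) : wt τ / s ^ 2 ≤ wt τ' := by
  refine le_trans ?_ (wt_anti h' hle)
  have h1 := sqrt_pos.2 h
  have h2 : sqrt s ≤ s := by
    rw [Real.sqrt_le_left (by linarith)]; nlinarith
  have h3 := sqrt_pos.2 (show 0 < s by linarith)
  unfold wt
  rw [Real.sqrt_mul h.le, div_eq_mul_inv, ← mul_inv]
  apply inv_anti₀ (by positivity)
  calc τ * s * (√τ * √s) = (τ * √τ) * s * √s := by ring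
    _ ≤ (τ * √τ) * s * s := by gcongr
    _ = _ := by ring

lemma xexp {k x : ℝ} (hk : 0 < k) : x * exp (-(k * x)) ≤ 1 / k := by
  have h1 := add_one_le_exp (k * x)
  rw [Real.exp_neg, ← div_eq_mul_inv, div_le_div_iff₀ (exp_pos _) hk]
  linarith

lemma marg {γ C3 H A : ℝ} (hγ : 0 < γ) (hC : 0 < C3) (hH : 1 ≤ H) (hA : 0 < A) :
    ∃ L ≥ (1:ℝ), ∀ x ≥ (0:ℝ), C3 * (exp (-(γ * x / 2)) * x) * (2 + 4 / γ * (x + H)) ^ 2 ≤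
      L * (A * exp (-(γ / 8) * x) * exp (-(γ * (x + H) / 8))) := by
  have hw : 0 < H + γ / 2 := by linarith
  refine ⟨max 1 (C3 * ((4 / γ) ^ 2 * (6 / (γ / 4) ^ 3 * exp (γ / 4 * (H + γ / 2)))) * exp (γ * H / 8) / A), le_max_left _ _, fun x hx => ?_⟩
  have h1 : (γ / 4 * (x + (H + γ / 2))) ^ 3 / 6 ≤ exp (γ / 4 * (x + (H + γ / 2))) := by
    have := Real.pow_div_factorial_le_exp (γ / 4 * (x + (H + γ / 2))) (by positivity) 3
    simpa [Nat.factorial] using this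
  have h2 : x * (2 + 4 / γ * (x + H)) ^ 2 ≤ (4 / γ) ^ 2 * (6 / (γ / 4) ^ 3 * exp (γ / 4 * (H + γ / 2))) * exp (γ * x / 4) := by
    have e1 : 2 + 4 / γ * (x + H) = 4 / γ * (x + (H + γ / 2)) := by field_simp; ring
    have e2 : exp (γ / 4 * (x + (H + γ / 2))) = exp (γ / 4 * (H + γ / 2)) * exp (γ * x / 4) := by
      rw [← exp_add]; ring_nf
    rw [e1]
    rw [e2] at h1
    calc _ ≤ (x + (H + γ / 2)) * (4 / γ * (x + (H + γ / 2))) ^ 2 := by gcongr; linarith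
      _ = (4 / γ) ^ 2 * (6 / (γ / 4) ^ 3 * ((γ / 4 * (x + (H + γ / 2))) ^ 3 / 6)) := by field_simp
      _ ≤ (4 / γ) ^ 2 * (6 / (γ / 4) ^ 3 * (exp (γ / 4 * (H + γ / 2)) * exp (γ * x / 4))) := by gcongr
      _ = _ := by ring
  have e3 : exp (-(γ * x / 2)) * exp (γ * x / 4) * exp (γ * H / 8) = 
      exp (-(γ / 8) * x) * exp (-(γ * (x + H) / 8)) * exp (γ * H / 4) := by
    simp only [← exp_add]; ring_nf
  have e4 : exp (-(γ / 8) * x) * exp (-(γ * (x + H) / 8)) = exp (-(γ * x / 2)) * exp (γ * x / 4) / exp (γ * H / 8) := by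
    rw [eq_div_iff (exp_pos _).ne']
    simp only [← exp_add]; ring_nf
  set D := (4 / γ) ^ 2 * (6 / (γ / 4) ^ 3 * exp (γ / 4 * (H + γ / 2))) with hD
  calc _ = C3 * exp (-(γ * x / 2)) * (x * (2 + 4 / γ * (x + H)) ^ 2) := by ring
    _ ≤ C3 * exp (-(γ * x / 2)) * (D * exp (γ * x / 4)) := by gcongr
    _ = (C3 * D * exp (γ * H / 8) / A) * (A * exp (-(γ / 8) * x) * exp (-(γ * (x + H) / 8))) := by
      rw [mul_assoc A, e4]; field_simp
    _ ≤ _ := by gcongr; exact le_max_right _ _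

structure BS (a b σ r γ : ℝ) (U V : ℝ → ℝ) (κ2 XB τ0 c N Λ H : ℝ) (g : ℝ → ℝ) (p p1 p2 pt : ℝ → ℝ → ℝ) : Prop where
  dt : ∀ τ ≥ τ0, ∀ x, HasDerivAt (fun s => p s x) (pt τ x) τ
  dx : ∀ τ ≥ τ0, ∀ x, HasDerivAt (p τ) (p1 τ x) x
  dxx : ∀ τ ≥ τ0, ∀ x, HasDerivAt (p1 τ) (p2 τ x) x
  ct : ∀ τ ≥ τ0, ∀ x, ContinuousAt (fun q : ℝ × ℝ => p q.1 q.2) (τ, x)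
  nn : ∀ τ ≥ τ0, ∀ x ≥ 0, 0 ≤ p τ x
  le1 : ∀ τ ≥ τ0, ∀ x ≥ XB, exp (-γ * x) * p τ x ≤ 1 ∧ κ2 * (exp (-γ * x) * p τ x) ≤ 1
  eP : ∀ τ ≥ τ0, ∀ x ≥ XB, p2 τ x + p τ x * (a * (1 - V x) - 2 * U x + a * U x * κ2 + (a * κ2 + 1) * (exp (-γ * x) * p τ x)) ≤ pt τ x
  eQ : ∀ τ ≥ τ0, ∀ x ≥ XB, σ * p2 τ x + 2 * γ * (1 - σ) * p1 τ x + p τ x * (- (r + (2 - σ) * γ ^ 2) / 2 + r * (2 * (1 - V x) - b * U x) + r * (κ2 + b) * (exp (-γ * x) * p τ x)) ≤ pt τ x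
  up : ∀ τ ≥ τ0, ∀ x ≥ 0, p τ x ≤ wt τ * (N * x + Λ * (x + H))
  lo : ∀ τ ≥ τ0, Λ * (exp (-2) / 12) * wt τ * (XB + H - 1) ≤ p τ XB
  ini : ∀ x ≥ 1, c * ∫ y, g y * exp (-(x - y) ^ 2 / 64) ≤ p τ0 x

set_option maxHeartbeats 1000000 in
lemma bsuper {a b σ r γ δ : ℝ} {U V : ℝ → ℝ} (h : Front a b σ r γ δ U V) {C0 X0 : ℝ} (hC0 : 0 < C0)
    (hU0 : ∀ x ≥ X0, U x ≤ C0 * exp (-(γ * x / 2))) (hV0 : ∀ x ≥ X0, 1 - V x ≤ C0 * exp (-(γ * x / 2)))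
    {κ2 m : ℝ} (hκ2 : 0 < κ2) (hm : 1 ≤ m) :
    ∃ XB ≥ (1:ℝ), X0 ≤ XB ∧ ∃ τm ≥ (32:ℝ), ∃ L0 ≥ (1:ℝ), ∃ Λ1 > (0:ℝ), ∀ τ0 ≥ τm, ∃ c > 0, ∀ g : ℝ → ℝ, ∀ N Λ : ℝ,
      Integrable g → (∀ y, 0 ≤ g y) → Integrable (fun y => (1 + |y|) * g y) → ∫ y, (1 + |y|) * g y ≤ N →
      L0 * N ≤ Λ → Λ ≤ Λ1 → ∃ p p1 p2 pt, BS a b σ r γ U V κ2 XB τ0 c N Λ (m * XB) g p p1 p2 pt := by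
  have hγ := h.g0
  have ha := h.a0
  have hr := h.r0
  have hb : 0 < b := by linarith [h.b1]
  have hs := h.s0
  have hs2 := h.s2
  obtain ⟨k, hk⟩ : ∃ k, k = r + (2 - σ) * γ ^ 2 := ⟨_, rfl⟩
  have hk0 : 0 < k := by rw [hk]; have : 0 < (2 - σ) * γ ^ 2 := mul_pos (by linarith) (by positivity)
                         linarith
  obtain ⟨s, hsd⟩ : ∃ s, s = min (γ / 8) (k / (32 * γ)) := ⟨_, rfl⟩
  have hs0 : 0 < s := by rw [hsd]; positivity
  have hs1 : s ≤ γ / 8 := hsd ▸ min_le_left _ _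
  have hs3 : s * (32 * γ) ≤ k := by
    rw [← le_div_iff₀ (by positivity)]; exact hsd ▸ min_le_right _ _
  obtain ⟨μ, hμd⟩ : ∃ μ, μ = s ^ 2 := ⟨_, rfl⟩
  have hμ : 0 < μ := by rw [hμd]; positivity
  have hμs : √μ = s := by rw [hμd, Real.sqrt_sq hs0.le]
  have hμ1 : μ ≤ γ ^ 2 / 64 := by
    rw [hμd]; linarith only [mul_le_mul hs1 hs1 hs0.le (by positivity)]
  have hμ2 : σ * μ ≤ k / 64 := by
    have : μ ≤ k / 256 := by rw [hμd]; linarith only [mnl hs1 hs0.le, hs3]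
    linarith only [mnr h.s2.le hμ.le, this, hk0]
  obtain ⟨C3, hC3⟩ : ∃ C3, C3 = a * C0 + a * C0 * κ2 + 1 := ⟨_, rfl⟩
  have hC30 : 0 < C3 := by rw [hC3]; positivity
  obtain ⟨κ, hκd⟩ : ∃ κ, κ = γ / 8 := ⟨_, rfl⟩
  have hκ : 0 < κ := by rw [hκd]; positivity
  obtain ⟨η, hηd⟩ : ∃ η, η = min (κ ^ 2 / 2 / (C3 * (1 + m) * (8 / γ))) (k / 8 / (2 * r * C0 + r * b)) := ⟨_, rfl⟩
  have hη : 0 < η := by rw [hηd]; positivity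
  have hη1 : η * (C3 * (1 + m) * (8 / γ)) ≤ κ ^ 2 / 2 := by
    rw [← le_div_iff₀ (by positivity)]; exact hηd ▸ min_le_left _ _
  have hη2 : η * (2 * r * C0 + r * b) ≤ k / 8 := by
    rw [← le_div_iff₀ (by positivity)]; exact hηd ▸ min_le_right _ _
  obtain ⟨XB, hXB1, hXB0, hXB2, hXB3⟩ : ∃ XB : ℝ, 1 ≤ XB ∧ X0 ≤ XB ∧ 4 / (γ * η) ≤ XB ∧ 32 * γ / k ≤ XB :=
    ⟨max (max 1 X0) (max (4 / (γ * η)) (32 * γ / k)), by simp, by simp, by simp, by simp⟩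
  have hEη : ∀ x ≥ XB, exp (-(γ / 4 * x)) ≤ η := by
    intro x hx
    have hx0 : 0 < x := by linarith
    have := xexp (x := x) (show 0 < γ / 4 by positivity)
    have h2 : 4 / (γ * η) ≤ x := hXB2.trans hx
    rw [div_le_iff₀ (by positivity)] at h2
    have h3 : x * exp (-(γ / 4 * x)) ≤ x * η := by
      refine this.trans ?_
      rw [div_le_iff₀ (by positivity)]; linarith
    exact le_of_mul_le_mul_left h3 hx0
  obtain ⟨H, hHd⟩ : ∃ H, H = m * XB := ⟨_, rfl⟩
  have hH : 1 ≤ H := by rw [hHd]; exact one_le_mul_of_one_le_of_one_le hm hXB1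
  obtain ⟨L, hL1, hL⟩ := marg (A := κ ^ 2 / 2 * (μ * exp (-μ) / 4)) hγ hC30 hH (by positivity)
  have hm1 : ∀ x ≥ XB, C3 * exp (-(γ * x / 2)) * (x + H) ≤ κ ^ 2 / 2 * exp (-κ * x) := by
    intro x hx
    have hx0 : 0 < x := by linarith
    have h1 := xexp (x := x) (show 0 < γ / 8 by positivity)
    have h2 := hEη x hx
    have e1 : exp (-(γ * x / 2)) = exp (-(γ / 4 * x)) * exp (-(γ / 8 * x)) * exp (-κ * x) := by
      rw [hκd]; simp only [← exp_add]; ring_nf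
    have e2 : x + H ≤ (1 + m) * x := by
      rw [hHd]; linarith only [mnl hx (show 0 ≤ m by linarith only [hm])]
    rw [e1]
    calc _ ≤ C3 * (exp (-(γ / 4 * x)) * exp (-(γ / 8 * x)) * exp (-κ * x)) * ((1 + m) * x) := by gcongr
      _ = C3 * (1 + m) * exp (-(γ / 4 * x)) * (x * exp (-(γ / 8 * x))) * exp (-κ * x) := by ring
      _ ≤ C3 * (1 + m) * η * (1 / (γ / 8)) * exp (-κ * x) := by gcongr
      _ = η * (C3 * (1 + m) * (8 / γ)) * exp (-κ * x) := by field_simp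
      _ ≤ _ := by gcongr
  refine ⟨XB, hXB1, hXB0, max (max 32 (1 / μ)) (max ((XB + H) ^ 2) (24 / k)), by simp, L, hL1,
    1 / (1 + κ2) / (2 * (H + 2 / γ)), by positivity, fun τ0 hτ0 => ?_⟩
  simp only [ge_iff_le, max_le_iff] at hτ0
  obtain ⟨⟨t1, t2⟩, t3, t4⟩ := hτ0
  obtain ⟨c, hc, hbb⟩ := bblock hμ hκ hH t1
  refine ⟨c, hc, fun g N Λ g1 g2 g3 g4 hΛN hΛ1 => ?_⟩
  have hN : 0 ≤ N := le_trans (integral_nonneg fun y => mul_nonneg (by positivity) (g2 y)) g4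
  have hNΛ : N ≤ Λ := (le_mul_of_one_le_left hN hL1).trans hΛN
  have hΛ : 0 ≤ Λ := hN.trans hNΛ
  obtain ⟨p, p1, p2, pt, dt, dx, dxx, ct, basic, grad, margin, lo, ini⟩ := hbb g N Λ g1 g2 g3 g4 hΛ
  clear hbb
  have hτ : ∀ τ ≥ τ0, 1 < τ := fun τ h => by linarith
  have hp0 : ∀ τ ≥ τ0, ∀ x ≥ 0, 0 ≤ p τ x := fun τ h1 x hx => (basic τ (hτ τ h1) x hx).1
  have hup : ∀ τ ≥ τ0, ∀ x ≥ 0, p τ x ≤ wt τ * (N * x + Λ * (x + H)) :=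
    fun τ h1 x hx => (basic τ (hτ τ h1) x hx).2.2.2.2
  have hwt1 : ∀ τ ≥ τ0, wt τ ≤ 1 := fun τ h1 => by
    refine (wt_anti one_pos (hτ τ h1).le).trans ?_
    unfold wt; simp
  have hEp : ∀ τ ≥ τ0, ∀ x ≥ XB, exp (-γ * x) * p τ x ≤ 1 / (1 + κ2) * exp (-(γ * x / 2)) := by
    intro τ h1 x hx
    have hx0 : 0 ≤ x := by linarith
    have h2 := hup τ h1 x hx0
    have h3 := hwt1 τ h1
    have h4 : p τ x ≤ 2 * Λ * (x + H) := by
      calc _ ≤ 1 * (N * x + Λ * (x + H)) := h2.trans (by gcongr)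
        _ ≤ _ := by linarith [mnr hNΛ hx0, mul_nonneg hΛ (show 0 ≤ H by linarith)]
    have h5 := xexp (x := x) (show 0 < γ / 2 by positivity)
    have h6 : exp (-(γ / 2 * x)) ≤ 1 := exp_le_one_iff.2 (by linarith [mul_nonneg hγ.le hx0])
    have h7 : exp (-(γ / 2 * x)) * (x + H) ≤ H + 2 / γ := by
      have : (1:ℝ) / (γ / 2) = 2 / γ := by field_simp
      linarith [mnr h6 (show 0 ≤ H by linarith)]
    have e1 : exp (-γ * x) = exp (-(γ / 2 * x)) * exp (-(γ * x / 2)) := by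
      rw [← exp_add]; ring_nf
    rw [le_div_iff₀ (by positivity)] at hΛ1
    rw [e1]
    calc _ ≤ exp (-(γ / 2 * x)) * exp (-(γ * x / 2)) * (2 * Λ * (x + H)) := by gcongr
      _ = 2 * Λ * (exp (-(γ / 2 * x)) * (x + H)) * exp (-(γ * x / 2)) := by ring
      _ ≤ 2 * Λ * (H + 2 / γ) * exp (-(γ * x / 2)) := by gcongr
      _ ≤ _ := by gcongr; linarith
  have hE1 : ∀ x ≥ XB, exp (-(γ * x / 2)) ≤ 1 := fun x hx => exp_le_one_iff.2 (by
    have : 0 < γ * x := mul_pos hγ (by linarith)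
    linarith)
  have hEη' : ∀ x ≥ XB, exp (-(γ * x / 2)) ≤ η := fun x hx => by
    refine le_trans (exp_le_exp.2 ?_) (hEη x hx)
    have : 0 < γ * x := mul_pos hγ (by linarith)
    linarith
  have hEp0 : ∀ τ ≥ τ0, ∀ x ≥ XB, 0 ≤ exp (-γ * x) * p τ x := fun τ h1 x hx =>
    mul_nonneg (exp_pos _).le (hp0 τ h1 x (by linarith))
  have hEp1 : ∀ τ ≥ τ0, ∀ x ≥ XB, (1 + κ2) * (exp (-γ * x) * p τ x) ≤ exp (-(γ * x / 2)) := by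
    intro τ h1 x hx
    have h2 := hEp τ h1 x hx
    rw [one_div_mul_eq_div, le_div_iff₀ (by positivity)] at h2
    linarith
  have hmar : ∀ τ ≥ τ0, ∀ x ≥ XB, C3 * exp (-(γ * x / 2)) * p τ x ≤ pt τ x - p2 τ x := by
    intro τ h1 x hx
    have hx0 : 0 ≤ x := by linarith
    have hτ0 : 0 < τ := by linarith
    have hR : 0 < 4 / γ := by positivity
    obtain ⟨Eb, E1, E2, E3⟩ := margin τ (hτ τ h1) x hx0 (4 / γ) hR
    have hS : 1 ≤ 2 + 4 / γ * (x + H) := by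
      have : 0 < 4 / γ * (x + H) := by positivity
      linarith
    have w1 : wt τ / (2 + 4 / γ * (x + H)) ^ 2 ≤ wt (τ + 4 / γ * (x + H) + 1) := by
      apply wt_mul_ge hτ0 hS (by positivity)
      have := hτ τ h1
      have : 0 < 4 / γ * (x + H) := by positivity
      linarith [mnr (hτ τ h1).le this.le]
    have hw := wt_pos hτ0
    have E4 : μ * exp (-μ) / 4 * exp (-(γ * (x + H) / 8)) * (wt τ / (2 + 4 / γ * (x + H)) ^ 2) ≤ Eb := by
      refine le_trans ?_ E1
      have e1 : exp (-μ) * exp (-(γ * (x + H) / 8)) ≤ exp (-μ * (4 / γ * (x + H) + 1)) * exp (-((x + H) / (4 * (4 / γ)))) := by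
        rw [← exp_add, ← exp_add]
        apply exp_le_exp.2
        have e2 : (x + H) / (4 * (4 / γ)) = γ * (x + H) / 16 := by field_simp; norm_num
        have e3 : μ * (4 / γ * (x + H)) ≤ γ ^ 2 / 64 * (4 / γ * (x + H)) := by gcongr
        have e4 : γ ^ 2 / 64 * (4 / γ * (x + H)) = γ * (x + H) / 16 := by field_simp; norm_num
        rw [e2]; linarith
      calc _ = μ / 4 * (exp (-μ) * exp (-(γ * (x + H) / 8))) * (wt τ / (2 + 4 / γ * (x + H)) ^ 2) := by ring
        _ ≤ μ / 4 * (exp (-μ * (4 / γ * (x + H) + 1)) * exp (-((x + H) / (4 * (4 / γ))))) * wt (τ + 4 / γ * (x + H) + 1) := by gcongr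
        _ = _ := by ring
    have hEb : 0 ≤ Eb := le_trans (by positivity) E4
    have E5 : C3 * exp (-(γ * x / 2)) * (N * x * wt τ) ≤ Λ * (κ ^ 2 / 2) * exp (-κ * x) * Eb := by
      have h2 := hL x hx0
      have h3 : C3 * (exp (-(γ * x / 2)) * x) ≤ L * (κ ^ 2 / 2 * (μ * exp (-μ) / 4) * exp (-(γ / 8) * x) * exp (-(γ * (x + H) / 8))) / (2 + 4 / γ * (x + H)) ^ 2 := by
        rw [le_div_iff₀ (by positivity)]; exact h2
      rw [← hκd] at h3
      calc _ = N * wt τ * (C3 * (exp (-(γ * x / 2)) * x)) := by ring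
        _ ≤ N * wt τ * _ := mnl h3 (by positivity)
        _ = L * N * (κ ^ 2 / 2) * exp (-κ * x) * (μ * exp (-μ) / 4 * exp (-(γ * (x + H) / 8)) * (wt τ / (2 + 4 / γ * (x + H)) ^ 2)) := by ring
        _ ≤ _ := by gcongr
    have E6 := mnr (hm1 x hx) (mul_nonneg hΛ hEb)
    have E7 := mnl E3 (show 0 ≤ C3 * exp (-(γ * x / 2)) by positivity)
    linarith
  refine ⟨p, p1, p2, pt, fun τ h => dt τ (hτ τ h), fun τ h => dx τ (hτ τ h), fun τ h => dxx τ (hτ τ h),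
    fun τ h => ct τ (hτ τ h), hp0, ?_, ?_, ?_, ?_, ?_, ini⟩
  · intro τ h1 x hx
    have h2 := hEp1 τ h1 x hx
    have h3 := hE1 x hx
    have h4 := hEp0 τ h1 x hx
    have h5 := mul_nonneg hκ2.le h4
    constructor <;> linarith
  · intro τ h1 x hx
    have h2 := hEp1 τ h1 x hx
    have h4 := hEp0 τ h1 x hx
    have h5 := hmar τ h1 x hx
    have h6 := hp0 τ h1 x (by linarith)
    have hu := hU0 x (by linarith)
    have hv := hV0 x (by linarith)
    have hub := h.U01 x
    have q1 : (a * κ2 + 1) * (exp (-γ * x) * p τ x) ≤ exp (-(γ * x / 2)) := by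
      refine le_trans ?_ h2
      have : a * κ2 ≤ κ2 := mul_le_of_le_one_left hκ2.le h.a1.le
      exact mnr (by linarith) h4
    have q2 := mnl hu (show 0 ≤ a * κ2 by positivity)
    have q3 := mnl hv ha.le
    have q4 : a * (1 - V x) - 2 * U x + a * U x * κ2 + (a * κ2 + 1) * (exp (-γ * x) * p τ x) ≤ C3 * exp (-(γ * x / 2)) := by
      rw [hC3]; linarith [hub.1]
    have := mnl q4 h6
    linarith
  · intro τ h1 x hx
    have hx0 : 0 < x := by linarith
    have h2 := hEp1 τ h1 x hx
    have h4 := hEp0 τ h1 x hx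
    have h6 := hp0 τ h1 x (by linarith)
    have hv := hV0 x (by linarith)
    have hub := h.U01 x
    obtain ⟨-, b1, b2, b3, -⟩ := basic τ (hτ τ h1) x hx0.le
    have b4 := grad τ (hτ τ h1) x hx0
    rw [hμs] at b4
    have hη' := hEη' x hx
    have q1 : r * (κ2 + b) * (exp (-γ * x) * p τ x) ≤ r * b * exp (-(γ * x / 2)) := by
      have : κ2 + b ≤ b * (1 + κ2) := by linarith [mnr h.b1.le hκ2.le]
      calc _ ≤ r * (b * (1 + κ2)) * (exp (-γ * x) * p τ x) := by gcongr
        _ = r * b * ((1 + κ2) * (exp (-γ * x) * p τ x)) := by ring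
        _ ≤ _ := by gcongr
    have q2 : r * (2 * (1 - V x) - b * U x) ≤ r * (2 * C0 * exp (-(γ * x / 2))) := by
      have : 0 < b * U x := mul_pos hb hub.1
      gcongr; linarith
    have q3 : r * (2 * (1 - V x) - b * U x) + r * (κ2 + b) * (exp (-γ * x) * p τ x) ≤ k / 8 := by
      have := mnl hη' (show 0 ≤ 2 * r * C0 + r * b by positivity)
      linarith
    have q4 : 2 * γ * (1 - σ) * p1 τ x ≤ k / 8 * p τ x := by
      have i1 : |2 * γ * (1 - σ)| ≤ 2 * γ := by
        rw [abs_le]; constructor <;> linarith [mul_pos hγ hs, mul_pos hγ (show 0 < 2 - σ by linarith)]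
      have i2 : 2 * γ * (1 / x) ≤ k / 16 := by
        have : 32 * γ / k ≤ x := hXB3.trans hx
        rw [div_le_iff₀ hk0] at this
        rw [mul_one_div, div_le_iff₀ hx0]; linarith
      calc _ ≤ |2 * γ * (1 - σ) * p1 τ x| := le_abs_self _
        _ = |2 * γ * (1 - σ)| * |p1 τ x| := abs_mul _ _
        _ ≤ (2 * γ) * ((s + 1 / x) * p τ x) := by gcongr
        _ = (2 * γ * s + 2 * γ * (1 / x)) * p τ x := by ring
        _ ≤ _ := by gcongr; linarith
    have q5 : σ * p2 τ x ≤ k / 64 * p τ x := by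
      calc _ ≤ σ * (μ * p τ x) := by gcongr; linarith
        _ = σ * μ * p τ x := by ring
        _ ≤ _ := by gcongr
    have q6 : 3 / (2 * τ) * p τ x ≤ k / 16 * p τ x := by
      refine mnr ?_ h6
      rw [div_le_iff₀ hk0] at t4
      rw [div_le_iff₀ (by linarith)]
      linarith [mnl h1 hk0.le]
    have q7 := mnl q3 h6
    rw [← hk]
    have := mul_nonneg hk0.le h6
    linarith
  · rw [← hHd]; exact hup
  · intro τ h1
    rw [← hHd]
    exact lo τ (hτ τ h1) XB (by linarith) (by linarith) (by linarith)

structure AB (a b σ r γ δ : ℝ) (U V : ℝ → ℝ) (XA m Cp cp : ℝ) (ψ ψ1 ψ2 χ χ1 χ2 : ℝ → ℝ) : Prop where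
  m0 : 0 < m
  C0 : 0 < Cp
  c0 : 0 < cp
  d1 : ∀ x, HasDerivAt ψ (ψ1 x) x
  d2 : ∀ x, HasDerivAt ψ1 (ψ2 x) x
  e1 : ∀ x, HasDerivAt χ (χ1 x) x
  e2 : ∀ x, HasDerivAt χ1 (χ2 x) x
  P : ∀ x ≤ XA, 1 * ψ2 x + 2 * γ * ψ1 x + ψ x * (1 - 2 * U x - a * V x) + a * U x * χ x ≤ -(m * ψ x)
  Q : ∀ x ≤ XA, σ * χ2 x + 2 * γ * χ1 x + χ x * (r * (1 - b * U x - 2 * V x)) + r * b * V x * ψ x ≤ -(m * χ x)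
  bP : ∀ x ≤ XA, cp * exp (δ * x) ≤ ψ x ∧ ψ x ≤ Cp * exp (δ * x)
  bQ : ∀ x ≤ XA, cp * exp (δ * x) ≤ χ x ∧ χ x ≤ Cp * exp (δ * x)
  fP : ∀ x ∈ Icc 0 XA, 3 / 4 * -deriv U x ≤ ψ x ∧ ψ x ≤ 2 * -deriv U x
  fQ : ∀ x ∈ Icc 0 XA, 3 / 4 * deriv V x ≤ χ x ∧ χ x ≤ 2 * deriv V x

noncomputable def gA (M τ0 : ℝ) (ψ : ℝ → ℝ) (t x : ℝ) : ℝ := M * wt (t - 1 + τ0) * ψ x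
noncomputable def gB (k γ τ0 : ℝ) (p : ℝ → ℝ → ℝ) (t x : ℝ) : ℝ := k * (exp (-γ * x) * p (t - 1 + τ0) x)
noncomputable def glue (XB XA : ℝ) (A B : ℝ → ℝ → ℝ) (t x : ℝ) : ℝ :=
  if x ≤ XB then A t x else if x ≤ XA then min (A t x) (B t x) else B t x

lemma gA_maj {M τ0 t x : ℝ} {ψ ψ1 ψ2 : ℝ → ℝ} (h : 0 < t - 1 + τ0) (d1 : ∀ x, HasDerivAt ψ (ψ1 x) x)
    (d2 : ∀ x, HasDerivAt ψ1 (ψ2 x) x) :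
    LocMaj (gA M τ0 ψ) t x (-(3 / (2 * (t - 1 + τ0))) * gA M τ0 ψ t x) (M * wt (t - 1 + τ0) * ψ1 x) (M * wt (t - 1 + τ0) * ψ2 x) := by
  refine LocMaj.of_smooth (W1 := gA M τ0 ψ1) ?_ (Eventually.of_forall fun y => (d1 y).const_mul _) ((d2 x).const_mul _)
  have h1 : HasDerivAt (fun s : ℝ => s - 1 + τ0) 1 t := ((hasDerivAt_id t).sub_const 1).add_const τ0
  have := (((wt_deriv h).comp t h1).const_mul M).mul_const (ψ x)
  refine this.congr_deriv ?_
  unfold gA; ring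

lemma gB_maj {k γ τ0 t x : ℝ} {p p1 p2 pt : ℝ → ℝ → ℝ} (dt : HasDerivAt (fun s => p s x) (pt (t - 1 + τ0) x) (t - 1 + τ0))
    (d1 : ∀ x, HasDerivAt (p (t - 1 + τ0)) (p1 (t - 1 + τ0) x) x) (d2 : ∀ x, HasDerivAt (p1 (t - 1 + τ0)) (p2 (t - 1 + τ0) x) x) :
    LocMaj (gB k γ τ0 p) t x (k * (exp (-γ * x) * pt (t - 1 + τ0) x))
      (k * (exp (-γ * x) * (p1 (t - 1 + τ0) x - γ * p (t - 1 + τ0) x)))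
      (k * (exp (-γ * x) * (p2 (t - 1 + τ0) x - 2 * γ * p1 (t - 1 + τ0) x + γ ^ 2 * p (t - 1 + τ0) x))) := by
  refine LocMaj.of_smooth (W1 := fun t x => k * (exp (-γ * x) * (p1 (t - 1 + τ0) x - γ * p (t - 1 + τ0) x))) ?_
    (Eventually.of_forall fun y => ?_) ?_
  · have h1 : HasDerivAt (fun s : ℝ => s - 1 + τ0) 1 t := ((hasDerivAt_id t).sub_const 1).add_const τ0
    have := ((dt.comp t h1).const_mul (exp (-γ * x))).const_mul k
    exact this.congr_deriv (by ring)
  · refine (((Front.exp1 (-γ) y).mul (d1 y)).const_mul k).congr_deriv ?_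
    ring
  · refine (((Front.exp1 (-γ) x).mul ((d2 x).sub ((d1 x).const_mul γ))).const_mul k).congr_deriv ?_
    simp only [Pi.sub_apply]; ring

lemma gA_ct {M τ0 t x : ℝ} {ψ : ℝ → ℝ} (h : 0 < t - 1 + τ0) (d1 : ContinuousAt ψ x) :
    ContinuousAt (fun q : ℝ × ℝ => gA M τ0 ψ q.1 q.2) (t, x) := by
  unfold gA
  have h1 : ContinuousAt (fun q : ℝ × ℝ => q.1 - 1 + τ0) (t, x) := by fun_prop
  have h2 : ContinuousAt (fun q : ℝ × ℝ => wt (q.1 - 1 + τ0)) (t, x) :=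
    ContinuousAt.comp (g := wt) (f := fun q : ℝ × ℝ => q.1 - 1 + τ0) (wt_deriv h).continuousAt h1
  have h3 : ContinuousAt (fun q : ℝ × ℝ => ψ q.2) (t, x) := ContinuousAt.comp (f := fun q : ℝ × ℝ => q.2) d1 continuousAt_snd
  exact (h2.const_mul M).mul h3

lemma gB_ct {k γ τ0 t x : ℝ} {p : ℝ → ℝ → ℝ} (h : ContinuousAt (fun q : ℝ × ℝ => p q.1 q.2) (t - 1 + τ0, x)) :
    ContinuousAt (fun q : ℝ × ℝ => gB k γ τ0 p q.1 q.2) (t, x) := by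
  unfold gB
  have h1 : ContinuousAt (fun q : ℝ × ℝ => (q.1 - 1 + τ0, q.2)) (t, x) := by fun_prop
  have h2 : ContinuousAt (fun q : ℝ × ℝ => p (q.1 - 1 + τ0) q.2) (t, x) :=
    ContinuousAt.comp (g := fun q : ℝ × ℝ => p q.1 q.2) (f := fun q : ℝ × ℝ => (q.1 - 1 + τ0, q.2)) h h1
  have h3 : ContinuousAt (fun q : ℝ × ℝ => exp (-γ * q.2)) (t, x) := by fun_prop
  exact (h3.mul h2).const_mul k

section
variable {XB XA : ℝ} {A B : ℝ → ℝ → ℝ} {t x : ℝ}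

lemma glue_A (h : x < XA) : glue XB XA A B t x ≤ A t x := by
  unfold glue; split_ifs with h1 h2
  · exact le_rfl
  · exact min_le_left _ _
  · exact absurd h.le h2

lemma glue_B (h : XB < x) : glue XB XA A B t x ≤ B t x := by
  unfold glue; split_ifs with h1 h2
  · exact absurd h (not_lt.2 h1)
  · exact min_le_right _ _
  · exact le_rfl

lemma glue_or (hX : XB < XA) (hc : B t XA < A t XA) :
    (x < XA ∧ glue XB XA A B t x = A t x) ∨ (XB < x ∧ glue XB XA A B t x = B t x) := by
  unfold glue; split_ifs with h1 h2
  · exact Or.inl ⟨by linarith, rfl⟩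
  · rcases min_choice (A t x) (B t x) with h | h
    · by_cases hx : x = XA
      · subst hx; exact absurd (min_eq_left_iff.1 h) (not_le.2 hc)
      · exact Or.inl ⟨lt_of_le_of_ne h2 hx, h⟩
    · exact Or.inr ⟨by linarith, h⟩
  · exact Or.inr ⟨by linarith, rfl⟩

lemma glue_maj_A (hx : x < XA) (he : glue XB XA A B t x = A t x) {a0 a1 a2 : ℝ} (h : LocMaj A t x a0 a1 a2) :
    LocMaj (glue XB XA A B) t x a0 a1 a2 :=
  h.congr_le he (Eventually.of_forall fun _ => glue_A hx) ((eventually_lt_nhds hx).mono fun _ h => glue_A h)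

lemma glue_maj_B (hx : XB < x) (he : glue XB XA A B t x = B t x) {a0 a1 a2 : ℝ} (h : LocMaj B t x a0 a1 a2) :
    LocMaj (glue XB XA A B) t x a0 a1 a2 :=
  h.congr_le he (Eventually.of_forall fun _ => glue_B hx) ((eventually_gt_nhds hx).mono fun _ h => glue_B h)

lemma glue_ct (hX : XB < XA) (hA : ∀ x, ContinuousAt (fun q : ℝ × ℝ => A q.1 q.2) (t, x))
    (hB : ∀ x, ContinuousAt (fun q : ℝ × ℝ => B q.1 q.2) (t, x)) (c1 : A t XB < B t XB) (c2 : B t XA < A t XA) :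
    ContinuousAt (fun q : ℝ × ℝ => glue XB XA A B q.1 q.2) (t, x) := by
  have ev1 : ∀ z, x < z → ∀ᶠ q : ℝ × ℝ in 𝓝 (t, x), q.2 < z := fun z hz =>
    continuousAt_snd.eventually (eventually_lt_nhds hz)
  have ev2 : ∀ z, z < x → ∀ᶠ q : ℝ × ℝ in 𝓝 (t, x), z < q.2 := fun z hz =>
    continuousAt_snd.eventually (eventually_gt_nhds hz)
  have eA : (∀ᶠ q : ℝ × ℝ in 𝓝 (t, x), q.2 < XA ∧ (q.2 ≤ XB ∨ A q.1 q.2 < B q.1 q.2)) → ContinuousAt (fun q : ℝ × ℝ => glue XB XA A B q.1 q.2) (t, x) := by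
    intro h
    refine (hA x).congr (h.mono fun q hq => ?_)
    obtain ⟨h1, h2⟩ := hq
    by_cases h3 : q.2 ≤ XB
    · simp [glue, h3]
    · have := h2.resolve_left h3
      simp [glue, h3, h1.le, this.le]
  have eB : (∀ᶠ q : ℝ × ℝ in 𝓝 (t, x), XB < q.2 ∧ (XA < q.2 ∨ B q.1 q.2 < A q.1 q.2)) → ContinuousAt (fun q : ℝ × ℝ => glue XB XA A B q.1 q.2) (t, x) := by
    intro h
    refine (hB x).congr (h.mono fun q hq => ?_)
    obtain ⟨h1, h2⟩ := hq
    by_cases h3 : XA < q.2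
    · simp [glue, not_le.2 h1, not_le.2 h3]
    · have := h2.resolve_left h3
      simp [glue, not_le.2 h1, not_lt.1 h3, this.le]
  rcases lt_trichotomy x XB with h | h | h
  · apply eA
    filter_upwards [ev1 XB h] with q h1 using ⟨by linarith, Or.inl h1.le⟩
  · subst h
    apply eA
    filter_upwards [ev1 XA hX, (hA x).eventually_lt (hB x) c1] with q h1 h2 using ⟨h1, Or.inr h2⟩
  rcases lt_trichotomy x XA with h' | h' | h'
  · have hc : ContinuousAt (fun q : ℝ × ℝ => min (A q.1 q.2) (B q.1 q.2)) (t, x) := Filter.Tendsto.min (hA x) (hB x)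
    refine hc.congr ?_
    filter_upwards [ev1 XA h', ev2 XB h] with q h1 h2
    simp [glue, not_le.2 h2, h1.le]
  · subst h'
    apply eB
    filter_upwards [ev2 XB hX, (hB x).eventually_lt (hA x) c2] with q h1 h2 using ⟨h1, Or.inr h2⟩
  · apply eB
    filter_upwards [ev2 XA h'] with q h1 using ⟨by linarith, Or.inl h1⟩
end

lemma algA {A a0 l m n q : ℝ} (hA : 0 ≤ A) (h1 : l ≤ -(m * A)) (h2 : n ≤ m / 2) (h3 : q ≤ m / 2) (h4 : -q * A ≤ a0) :
    l + A * n ≤ a0 := by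
  nlinarith

set_option maxHeartbeats 1000000 in
theorem glueStep {a b σ r γ δ : ℝ} {U V : ℝ → ℝ} (h : Front a b σ r γ δ U V)
    {XA m Cp cp : ℝ} {ψ ψ1 ψ2 χ χ1 χ2 : ℝ → ℝ} (hA : AB a b σ r γ δ U V XA m Cp cp ψ ψ1 ψ2 χ χ1 χ2)
    {κ2 XB τ0 c N Λ H : ℝ} {g : ℝ → ℝ} {p p1 p2 pt : ℝ → ℝ → ℝ}
    (hB : BS a b σ r γ U V κ2 XB τ0 c N Λ H g p p1 p2 pt) (hκ : κ2 = 2 * r * b / (r + (2 - σ) * γ ^ 2))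
    (hXB : 1 ≤ XB) (hX : XB < XA) (hτ0 : 2 ≤ τ0) (hτm : 3 / (2 * τ0) ≤ m / 2)
    {M s : ℝ} (hM : 0 ≤ M) (hs : M * (Cp * exp (δ * XA)) ≤ s) (hs1 : s ≤ 1) (hs2 : (1 + a) * s ≤ m / 2) (hs3 : r * ((1 + b) * s) ≤ m / 2)
    (c1 : ∀ τ ≥ τ0, M * wt τ * ψ XB < exp (-γ * XB) * p τ XB)
    (c2 : ∀ τ ≥ τ0, M * wt τ * χ XB < κ2 * (exp (-γ * XB) * p τ XB))
    (c3 : ∀ τ ≥ τ0, exp (-γ * XA) * p τ XA < M * wt τ * ψ XA)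
    (c4 : ∀ τ ≥ τ0, κ2 * (exp (-γ * XA) * p τ XA) < M * wt τ * χ XA)
    {B T : ℝ} {P Q : ℝ → ℝ → ℝ} (hPQ : PQ a b σ r (2 * γ) B T U V P Q) (hB0 : 0 ≤ B)
    (iA : ∀ x ≤ XA, |P 1 x| ≤ M * wt τ0 * ψ x ∧ |Q 1 x| ≤ M * wt τ0 * χ x)
    (iB : ∀ x ≥ XB, |P 1 x| ≤ exp (-γ * x) * p τ0 x ∧ |Q 1 x| ≤ κ2 * (exp (-γ * x) * p τ0 x)) :
    ∀ t ∈ Icc 1 T, ∀ x, (x ≤ XA ∧ |P t x| ≤ M * wt (t - 1 + τ0) * ψ x ∨ XB ≤ x ∧ |P t x| ≤ exp (-γ * x) * p (t - 1 + τ0) x) ∧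
      (x ≤ XA ∧ |Q t x| ≤ M * wt (t - 1 + τ0) * χ x ∨ XB ≤ x ∧ |Q t x| ≤ κ2 * (exp (-γ * x) * p (t - 1 + τ0) x)) := by
  have hγ := h.g0
  have hr := h.r0
  have ha := h.a0
  have hb : 0 < b := by linarith [h.b1]
  have hk0 : 0 < r + (2 - σ) * γ ^ 2 := by
    have : 0 < (2 - σ) * γ ^ 2 := mul_pos (by linarith [h.s2]) (by positivity)
    linarith
  have hκ0 : 0 < κ2 := by rw [hκ]; positivity
  have hκe : κ2 * (r + (2 - σ) * γ ^ 2) = 2 * r * b := by rw [hκ]; field_simp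
  have hm := hA.m0
  set Ap := gA M τ0 ψ with hAp
  set Aq := gA M τ0 χ with hAq
  set Bp := gB 1 γ τ0 p with hBp
  set Bq := gB κ2 γ τ0 p with hBq
  set Pb := glue XB XA Ap Bp with hPb
  set Qb := glue XB XA Aq Bq with hQb
  have hτ : ∀ t ∈ Icc 1 T, τ0 ≤ t - 1 + τ0 := fun t ht => by linarith [ht.1]
  have hψ0 : ∀ x ≤ XA, 0 ≤ ψ x := fun x hx => le_trans (mul_nonneg hA.c0.le (exp_pos _).le) (hA.bP x hx).1
  have hχ0 : ∀ x ≤ XA, 0 ≤ χ x := fun x hx => le_trans (mul_nonneg hA.c0.le (exp_pos _).le) (hA.bQ x hx).1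
  have hw0 : ∀ t ∈ Icc 1 T, 0 < wt (t - 1 + τ0) := fun t ht => wt_pos (by linarith [hτ t ht])
  have hw1 : ∀ t ∈ Icc 1 T, wt (t - 1 + τ0) ≤ 1 := fun t ht => by
    refine (wt_anti one_pos (by linarith [hτ t ht])).trans ?_
    unfold wt; simp
  have hAs : ∀ t ∈ Icc 1 T, ∀ x ≤ XA, ∀ f : ℝ → ℝ, f x ≤ Cp * exp (δ * x) → gA M τ0 f t x ≤ s := by
    intro t ht x hx f hf
    refine le_trans ?_ hs
    have i1 : f x ≤ Cp * exp (δ * XA) := hf.trans (mnl (exp_le_exp.2 (mnl hx h.d0.le)) hA.C0.le)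
    have i2 := hw1 t ht
    have i3 := (hw0 t ht).le
    have i4 := hA.C0
    unfold gA
    calc _ ≤ M * wt (t - 1 + τ0) * (Cp * exp (δ * XA)) := by gcongr
      _ ≤ M * 1 * (Cp * exp (δ * XA)) := by gcongr
      _ = _ := by ring
  have hApn : ∀ t ∈ Icc 1 T, ∀ x ≤ XA, 0 ≤ Ap t x := fun t ht x hx => mul_nonneg (mul_nonneg hM (hw0 t ht).le) (hψ0 x hx)
  have hAqn : ∀ t ∈ Icc 1 T, ∀ x ≤ XA, 0 ≤ Aq t x := fun t ht x hx => mul_nonneg (mul_nonneg hM (hw0 t ht).le) (hχ0 x hx)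
  have hB0n : ∀ t ∈ Icc 1 T, ∀ x ≥ XB, 0 ≤ exp (-γ * x) * p (t - 1 + τ0) x := fun t ht x hx =>
    mul_nonneg (exp_pos _).le (hB.nn _ (hτ t ht) x (by linarith))
  have hBpe : ∀ t x, Bp t x = exp (-γ * x) * p (t - 1 + τ0) x := fun t x => one_mul _
  have hBqe : ∀ t x, Bq t x = κ2 * (exp (-γ * x) * p (t - 1 + τ0) x) := fun t x => rfl
  have oP : ∀ t ∈ Icc 1 T, ∀ x, (x < XA ∧ Pb t x = Ap t x) ∨ (XB < x ∧ Pb t x = Bp t x) := fun t ht x =>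
    glue_or hX (by rw [hBpe]; exact c3 _ (hτ t ht))
  have oQ : ∀ t ∈ Icc 1 T, ∀ x, (x < XA ∧ Qb t x = Aq t x) ∨ (XB < x ∧ Qb t x = Bq t x) := fun t ht x =>
    glue_or hX (c4 _ (hτ t ht))
  have hP01 : ∀ t ∈ Icc 1 T, ∀ x, 0 ≤ Pb t x ∧ Pb t x ≤ 1 := by
    intro t ht x
    rcases oP t ht x with ⟨hx, he⟩ | ⟨hx, he⟩
    · rw [he]; exact ⟨hApn t ht x hx.le, (hAs t ht x hx.le ψ (hA.bP x hx.le).2).trans hs1⟩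
    · rw [he, hBpe]; exact ⟨hB0n t ht x hx.le, (hB.le1 _ (hτ t ht) x hx.le).1⟩
  have hQ01 : ∀ t ∈ Icc 1 T, ∀ x, 0 ≤ Qb t x ∧ Qb t x ≤ 1 := by
    intro t ht x
    rcases oQ t ht x with ⟨hx, he⟩ | ⟨hx, he⟩
    · rw [he]; exact ⟨hAqn t ht x hx.le, (hAs t ht x hx.le χ (hA.bQ x hx.le).2).trans hs1⟩
    · rw [he, hBqe]; exact ⟨mul_nonneg hκ0.le (hB0n t ht x hx.le), (hB.le1 _ (hτ t ht) x hx.le).2⟩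
  have hPc : ∀ t ∈ Icc 1 T, ∀ x, ContinuousAt (fun q : ℝ × ℝ => Pb q.1 q.2) (t, x) := fun t ht x =>
    glue_ct hX (fun x => gA_ct (by linarith [hτ t ht]) (hA.d1 x).continuousAt) (fun x => gB_ct (hB.ct _ (hτ t ht) x))
      (by rw [hBpe]; exact c1 _ (hτ t ht)) (by rw [hBpe]; exact c3 _ (hτ t ht))
  have hQc : ∀ t ∈ Icc 1 T, ∀ x, ContinuousAt (fun q : ℝ × ℝ => Qb q.1 q.2) (t, x) := fun t ht x =>
    glue_ct hX (fun x => gA_ct (by linarith [hτ t ht]) (hA.e1 x).continuousAt) (fun x => gB_ct (hB.ct _ (hτ t ht) x))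
      (c2 _ (hτ t ht)) (c4 _ (hτ t ht))
  have hq : ∀ t ∈ Icc 1 T, 3 / (2 * (t - 1 + τ0)) ≤ m / 2 := fun t ht => by
    refine le_trans ?_ hτm
    have := hτ t ht
    gcongr
  have hPm : ∀ t ∈ Ioc 1 T, ∀ x, ∃ a0 a1 a2, LocMaj Pb t x a0 a1 a2 ∧
      1 * a2 + 2 * γ * a1 + Pb t x * (1 - 2 * U x - a * V x) + a * U x * Qb t x
        + Pb t x * (a * Qb t x + Pb t x) ≤ a0 := by
    intro t ht0 x
    have ht : t ∈ Icc 1 T := ⟨ht0.1.le, ht0.2⟩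
    have hux := (h.U01 x).1
    have n0 := (hQ01 t ht x).1
    rcases oP t ht x with ⟨hx, he⟩ | ⟨hx, he⟩
    · refine ⟨_, _, _, glue_maj_A hx he (gA_maj (by linarith [hτ t ht]) hA.d1 hA.d2), ?_⟩
      have q1 : Qb t x ≤ Aq t x := glue_A hx
      have n1 := hApn t ht x hx.le
      have s1 : Ap t x ≤ s := hAs t ht x hx.le ψ (hA.bP x hx.le).2
      have s2 : Aq t x ≤ s := hAs t ht x hx.le χ (hA.bQ x hx.le).2
      rw [he]
      refine algA (m := m) (q := 3 / (2 * (t - 1 + τ0))) n1 ?_ ?_ (hq t ht) le_rfl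
      · have := mnl (hA.P x hx.le) (mul_nonneg hM (hw0 t ht).le)
        have q2 := mnl q1 (mul_nonneg ha.le hux.le)
        rw [hAq] at q2
        rw [hAp]
        unfold gA at *
        linarith
      · have := mnl (q1.trans s2) ha.le
        linarith
    · have ht' := hτ t ht
      refine ⟨_, _, _, glue_maj_B hx he (gB_maj (hB.dt _ ht' x) (hB.dx _ ht') (hB.dxx _ ht')), ?_⟩
      have q1 : Qb t x ≤ Bq t x := glue_B hx
      have n1 := hB0n t ht x hx.le
      have e1 := hB.eP _ ht' x hx.le
      have e2 := mnl e1 (exp_pos (-γ * x)).le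
      rw [hBqe] at q1
      have q2 := mnl q1 (mul_nonneg ha.le hux.le)
      have q3 := mnl (mnl q1 ha.le) n1
      rw [he, hBpe]
      have g2 : 1 = a + γ ^ 2 := by linarith [h.g2]
      have g3 := congrArg (fun z => z * (exp (-γ * x) * p (t - 1 + τ0) x)) g2
      beta_reduce at g3
      linarith
  have hQm : ∀ t ∈ Ioc 1 T, ∀ x, ∃ a0 a1 a2, LocMaj Qb t x a0 a1 a2 ∧
      σ * a2 + 2 * γ * a1 + Qb t x * (r * (1 - b * U x - 2 * V x)) + r * b * V x * Pb t x
        + Qb t x * (r * (Qb t x + b * Pb t x)) ≤ a0 := by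
    intro t ht0 x
    have ht : t ∈ Icc 1 T := ⟨ht0.1.le, ht0.2⟩
    have hvx := h.V01 x
    have n0 := (hP01 t ht x).1
    have hrb : 0 < r * b := mul_pos hr hb
    rcases oQ t ht x with ⟨hx, he⟩ | ⟨hx, he⟩
    · refine ⟨_, _, _, glue_maj_A hx he (gA_maj (by linarith [hτ t ht]) hA.e1 hA.e2), ?_⟩
      have q1 : Pb t x ≤ Ap t x := glue_A hx
      have n1 := hAqn t ht x hx.le
      have s1 : Ap t x ≤ s := hAs t ht x hx.le ψ (hA.bP x hx.le).2
      have s2 : Aq t x ≤ s := hAs t ht x hx.le χ (hA.bQ x hx.le).2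
      rw [he]
      refine algA (m := m) (q := 3 / (2 * (t - 1 + τ0))) n1 ?_ ?_ (hq t ht) le_rfl
      · have := mnl (hA.Q x hx.le) (mul_nonneg hM (hw0 t ht).le)
        have q2 := mnl q1 (mul_nonneg hrb.le hvx.1.le)
        rw [hAp] at q2
        rw [hAq]
        unfold gA at *
        linarith
      · have := mnl (q1.trans s1) hrb.le
        have := mnl s2 hr.le
        linarith
    · have ht' := hτ t ht
      refine ⟨_, _, _, glue_maj_B hx he (gB_maj (hB.dt _ ht' x) (hB.dx _ ht') (hB.dxx _ ht')), ?_⟩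
      have q1 : Pb t x ≤ Bp t x := glue_B hx
      have n1 := hB0n t ht x hx.le
      have e1 := hB.eQ _ ht' x hx.le
      have e2 := mnl e1 (mul_nonneg hκ0.le (exp_pos (-γ * x)).le)
      rw [hBpe] at q1
      rw [he, hBqe]
      set Ep := exp (-γ * x) * p (t - 1 + τ0) x with hEp
      have q2 : r * b * V x * Pb t x ≤ r * b * Ep := by
        calc _ ≤ r * b * 1 * Ep := by
              have := hvx.2.le
              have := hvx.1
              gcongr
          _ = _ := by ring
      have q3 := mnl (mnl q1 hrb.le) (mul_nonneg hκ0.le n1)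
      have g3 := congrArg (fun z => z * Ep / 2) hκe
      beta_reduce at g3
      have e3 : κ2 * exp (-γ * x) * (σ * p2 (t - 1 + τ0) x + 2 * γ * (1 - σ) * p1 (t - 1 + τ0) x + p (t - 1 + τ0) x * (- (r + (2 - σ) * γ ^ 2) / 2 + r * (2 * (1 - V x) - b * U x) + r * (κ2 + b) * Ep)) =
        σ * (κ2 * (exp (-γ * x) * (p2 (t - 1 + τ0) x - 2 * γ * p1 (t - 1 + τ0) x + γ ^ 2 * p (t - 1 + τ0) x))) + 2 * γ * (κ2 * (exp (-γ * x) * (p1 (t - 1 + τ0) x - γ * p (t - 1 + τ0) x))) + κ2 * Ep * (r * (1 - b * U x - 2 * V x)) + κ2 * (r + (2 - σ) * γ ^ 2) * Ep / 2 + κ2 * Ep * (r * (κ2 * Ep)) + κ2 * Ep * (r * b * Ep) := by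
        rw [hEp]; ring
      rw [e3] at e2
      linarith
  have iP : ∀ x, |P 1 x| ≤ Pb 1 x := by
    intro x
    have e : (1:ℝ) - 1 + τ0 = τ0 := by ring
    have hA' : x ≤ XA → |P 1 x| ≤ Ap 1 x := fun hx => by rw [hAp]; unfold gA; rw [e]; exact (iA x hx).1
    have hB' : XB ≤ x → |P 1 x| ≤ Bp 1 x := fun hx => by rw [hBpe, e]; exact (iB x hx).1
    rw [hPb]; unfold glue; split_ifs with h1 h2
    · exact hA' (by linarith)
    · exact le_min (hA' h2) (hB' (by linarith))
    · exact hB' (by linarith)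
  have iQ : ∀ x, |Q 1 x| ≤ Qb 1 x := by
    intro x
    have e : (1:ℝ) - 1 + τ0 = τ0 := by ring
    have hA' : x ≤ XA → |Q 1 x| ≤ Aq 1 x := fun hx => by rw [hAq]; unfold gA; rw [e]; exact (iA x hx).2
    have hB' : XB ≤ x → |Q 1 x| ≤ Bq 1 x := fun hx => by rw [hBqe, e]; exact (iB x hx).2
    rw [hQb]; unfold glue; split_ifs with h1 h2
    · exact hA' (by linarith)
    · exact le_min (hA' h2) (hB' (by linarith))
    · exact hB' (by linarith)
  have key := fun (d : ℝ) (hd : 0 < d) => CL hPQ h.a0 h.a1 h.b1 h.s0 h.r0 h.U01 h.V01 zero_le_one hPc hQc hP01 hQ01 hPm hQm hd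
    (fun x => lt_of_le_of_lt (iP x) (by linarith [mul_pos hd (cosh_pos x)]))
    (fun x => lt_of_le_of_lt (iQ x) (by linarith [mul_pos hd (cosh_pos x)])) hB0
  intro t ht x
  have fP : |P t x| ≤ Pb t x := by
    refine lim_eps (mul_pos (exp_pos ((20 + σ + |2 * γ| + 10 * r + 10 * r * b + 2 * B + r * (1 + b) * B) * (t - 1))) (cosh_pos x)).le fun d hd => ?_
    rw [← mul_assoc]; exact (key d hd t ht x).1
  have fQ : |Q t x| ≤ Qb t x := by
    refine lim_eps (mul_pos (exp_pos ((20 + σ + |2 * γ| + 10 * r + 10 * r * b + 2 * B + r * (1 + b) * B) * (t - 1))) (cosh_pos x)).le fun d hd => ?_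
    rw [← mul_assoc]; exact (key d hd t ht x).2
  constructor
  · rcases oP t ht x with ⟨hx, he⟩ | ⟨hx, he⟩
    · exact Or.inl ⟨hx.le, by rw [he] at fP; exact fP⟩
    · exact Or.inr ⟨hx.le, by rw [he, hBpe] at fP; exact fP⟩
  · rcases oQ t ht x with ⟨hx, he⟩ | ⟨hx, he⟩
    · exact Or.inl ⟨hx.le, by rw [he] at fQ; exact fQ⟩
    · exact Or.inr ⟨hx.le, by rw [he] at fQ; exact fQ⟩

noncomputable def W0 (γ δ x : ℝ) : ℝ := min (exp (-γ * x)) (exp (δ * x))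

lemma W0_pos (γ δ x : ℝ) : 0 < W0 γ δ x := lt_min (exp_pos _) (exp_pos _)

lemma W0_shift {γ δ : ℝ} (hγ : 0 < γ) (hδ : 0 < δ) (x y : ℝ) : W0 γ δ y ≤ W0 γ δ x * exp ((γ + δ) * |x - y|) := by
  unfold W0
  rw [min_mul_of_nonneg _ _ (exp_pos _).le, ← exp_add, ← exp_add]
  have h1 := le_abs_self (x - y)
  have h2 := neg_abs_le (x - y)
  have h3 := abs_nonneg (x - y)
  apply min_le_min <;> apply exp_le_exp.2 <;>
    linarith [mnl h1 hγ.le, mnl h2 hγ.le, mnl h1 hδ.le,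
      mnl h2 hδ.le, mul_nonneg hγ.le h3, mul_nonneg hδ.le h3]

lemma W0_le_one {γ δ : ℝ} (hγ : 0 < γ) (hδ : 0 < δ) (x : ℝ) : W0 γ δ x ≤ 1 := by
  rcases le_total 0 x with h | h
  · exact (min_le_left _ _).trans (exp_le_one_iff.2 (by linarith [mul_nonneg hγ.le h]))
  · exact (min_le_right _ _).trans (exp_le_one_iff.2 (mul_nonpos_of_nonneg_of_nonpos hδ.le h))

lemma W0_right {γ δ x : ℝ} (hγ : 0 < γ) (hδ : 0 < δ) (hx : 0 ≤ x) : W0 γ δ x = exp (-γ * x) :=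
  min_eq_left (exp_le_exp.2 (by linarith [mul_nonneg hγ.le hx, mul_nonneg hδ.le hx]))

lemma W0_left {γ δ x X : ℝ} (hγ : 0 < γ) (hδ : 0 < δ) (hX : 0 ≤ X) (hx : x ≤ X) :
    exp (δ * x) ≤ exp ((γ + δ) * X) * W0 γ δ x := by
  unfold W0
  rw [mul_min_of_nonneg _ _ (exp_pos _).le, ← exp_add, ← exp_add]
  have h := mul_nonneg (show 0 ≤ γ + δ by linarith) hX
  apply le_min <;> apply exp_le_exp.2
  · linarith [mnl hx (show 0 ≤ γ + δ by linarith)]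
  · linarith

lemma gauss_shift (γ x y : ℝ) : exp (-γ * y) * exp (-(x - y) ^ 2 / 32) ≤
    exp (16 * γ ^ 2) * exp (-γ * x) * exp (-(x - y) ^ 2 / 64) := by
  simp only [← exp_add]
  apply exp_le_exp.2
  nlinarith [sq_nonneg ((x - y) / 8 - 4 * γ)]

lemma cross1 {KM Λ w ψ e p b1 X l k z : ℝ} (hKM : 0 < KM) (hΛ : 0 < Λ) (hw : 0 < w) (he : 0 < e) (hX : 0 < X)
    (hk : 0 < k) (h1 : ψ ≤ 2 * (2 * b1 * (X * e))) (h2 : Λ * l * w * z ≤ p) (h3 : 4 * KM * b1 * X < k * (l * z)) :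
    KM * Λ * w * ψ < k * (e * p) := by
  calc _ ≤ KM * Λ * w * (2 * (2 * b1 * (X * e))) := by gcongr
    _ = Λ * w * e * (4 * KM * b1 * X) := by ring
    _ < Λ * w * e * (k * (l * z)) := by gcongr
    _ = k * (e * (Λ * l * w * z)) := by ring
    _ ≤ _ := by gcongr

lemma cross2 {KM Λ w ψ e p b1 X k z : ℝ} (hKM : 0 < KM) (hΛ : 0 < Λ) (hw : 0 < w) (he : 0 < e) (hX : 0 < X)
    (hk : 0 < k) (h1 : 3 / 4 * (b1 / 2 * (X * e)) ≤ ψ) (h2 : p ≤ w * z) (hz : z ≤ 3 * Λ * X) (h3 : 9 * k ≤ KM * b1) :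
    k * (e * p) < KM * Λ * w * ψ := by
  have h4 : 0 < Λ * w * e * X := by positivity
  calc _ ≤ k * (e * (w * (3 * Λ * X))) := by gcongr; exact h2.trans (by gcongr)
    _ = (3 * k) * (Λ * w * e * X) := by ring
    _ < (3 / 8 * (KM * b1)) * (Λ * w * e * X) := mul_lt_mul_of_pos_right (by linarith) h4
    _ = KM * Λ * w * (3 / 4 * (b1 / 2 * (X * e))) := by ring
    _ ≤ _ := by gcongr

set_option maxHeartbeats 1000000 in
theorem core {a b σ r γ δ : ℝ} {U V : ℝ → ℝ} (h : Front a b σ r γ δ U V) {X0 C0 b1 b2 : ℝ} (hC0 : 0 < C0) (hb1 : 0 < b1) (hb2 : 0 < b2)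
    (hU0 : ∀ x ≥ X0, U x ≤ C0 * exp (-(γ * x / 2))) (hV0 : ∀ x ≥ X0, 1 - V x ≤ C0 * exp (-(γ * x / 2)))
    (hU1 : ∀ x ≥ X0, b1 / 2 * (x * exp (-γ * x)) ≤ -deriv U x ∧ -deriv U x ≤ 2 * b1 * (x * exp (-γ * x)))
    (hV1 : ∀ x ≥ X0, b2 / 2 * (x * exp (-γ * x)) ≤ deriv V x ∧ deriv V x ≤ 2 * b2 * (x * exp (-γ * x))) :
    ∃ C > (0:ℝ), ∃ ε > (0:ℝ), ∀ B T : ℝ, ∀ P Q : ℝ → ℝ → ℝ, PQ a b σ r (2 * γ) B T U V P Q → 0 ≤ B → 0 ≤ T →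
      ∀ n : ℝ → ℝ, (∀ y, 0 ≤ n y) → (∀ y, n y ≤ ε) → Integrable n → Integrable (fun y => (1 + |y|) * n y) →
      ∫ y, (1 + |y|) * n y ≤ ε → (∀ y, |P 0 y| + |Q 0 y| ≤ n y * W0 γ δ y) →
      ∀ x, |P T x| + |Q T x| ≤ C * (ε * (1 + |x|) * wt (1 + T) * W0 γ δ x) := by
  have hγ := h.g0
  have hδ := h.d0
  have hr := h.r0
  have ha := h.a0
  have hb : 0 < b := by linarith [h.b1]
  obtain ⟨C1, hC1, st1⟩ := step1 (c := 2 * γ) h.a0 h.a1 h.b1 h.s0 h.s2 h.r0 h.U01 h.V01 (γ + δ) (by linarith)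
  obtain ⟨κ2, hκ⟩ : ∃ κ2, κ2 = 2 * r * b / (r + (2 - σ) * γ ^ 2) := ⟨_, rfl⟩
  have hκ0 : 0 < κ2 := by
    have : 0 < (2 - σ) * γ ^ 2 := mul_pos (by linarith [h.s2]) (by positivity)
    rw [hκ]; positivity
  obtain ⟨KM, hKMd⟩ : ∃ KM, KM = 9 / b1 + 9 * κ2 / b2 := ⟨_, rfl⟩
  have hKM : 0 < KM := by rw [hKMd]; positivity
  have hK1 : 9 * 1 ≤ KM * b1 := by
    have e : KM * b1 = 9 + 9 * κ2 / b2 * b1 := by rw [hKMd]; field_simp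
    have : 0 < 9 * κ2 / b2 * b1 := by positivity
    linarith
  have hK2 : 9 * κ2 ≤ KM * b2 := by
    have e : KM * b2 = 9 / b1 * b2 + 9 * κ2 := by rw [hKMd]; field_simp
    have : 0 < 9 / b1 * b2 := by positivity
    linarith
  obtain ⟨l, hl⟩ : ∃ l, l = exp (-2) / 12 := ⟨_, rfl⟩
  have hl0 : 0 < l := by rw [hl]; positivity
  obtain ⟨mm, hmm⟩ : ∃ mm, mm = 1 + (4 * KM * b1 + 4 * KM * b2 / κ2) / l := ⟨_, rfl⟩
  have hmm1 : 1 ≤ mm := by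
    rw [hmm]; have : 0 < (4 * KM * b1 + 4 * KM * b2 / κ2) / l := by positivity
    linarith
  have hlm : l * mm = l + 4 * KM * b1 + 4 * KM * b2 / κ2 := by rw [hmm]; field_simp; ring
  have hm1 : 4 * KM * b1 < 1 * (l * mm) := by
    have : 0 < 4 * KM * b2 / κ2 := by positivity
    linarith
  have hm2 : 4 * KM * b2 < κ2 * (l * mm) := by
    have e : κ2 * (l * mm) = κ2 * l + κ2 * (4 * KM * b1) + 4 * KM * b2 := by rw [hlm]; field_simp
    have : 0 < κ2 * l := by positivity
    have : 0 < κ2 * (4 * KM * b1) := by positivity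
    linarith
  obtain ⟨XB, hXB1, hXB0, τm, hτm, L0, hL0, Λ1, hΛ1, bs⟩ := bsuper h hC0 hU0 hV0 hκ0 hmm1
  obtain ⟨XA, hXA⟩ : ∃ XA, XA = (mm + 2) * XB := ⟨_, rfl⟩
  have hXBp : 0 < XB := by linarith
  have hmX : 0 < mm * XB := by positivity
  have hXBA : XB < XA := by rw [hXA]; linarith
  obtain ⟨ψ, ψ1, ψ2, χ, χ1, χ2, m, Cp, cp, hm, hCp, hcp, q1, q2, q3, q4, q5, q6, q7, q8, q9, q10⟩ := h.ablock XA (by linarith)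
  have hA : AB a b σ r γ δ U V XA m Cp cp ψ ψ1 ψ2 χ χ1 χ2 := ⟨hm, hCp, hcp, q1, q2, q3, q4, q5, q6, q7, q8, q9, q10⟩
  clear q1 q2 q3 q4 q5 q6 q7 q8 q9 q10
  obtain ⟨τ0, hτ0d⟩ : ∃ τ0, τ0 = max τm (3 / m) := ⟨_, rfl⟩
  have hτ01 : τm ≤ τ0 := hτ0d ▸ le_max_left _ _
  have hτ02 : 3 / (2 * τ0) ≤ m / 2 := by
    have h1 : 3 / m ≤ τ0 := hτ0d ▸ le_max_right _ _
    rw [div_le_iff₀ hm] at h1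
    rw [div_le_iff₀ (by linarith)]; linarith
  obtain ⟨c, hc, bs⟩ := bs τ0 hτ01
  have hwτ0 := wt_pos (show 0 < τ0 by linarith)
  obtain ⟨E0, hE0⟩ : ∃ E0, E0 = C1 * exp (16 * γ ^ 2) := ⟨_, rfl⟩
  have hE0p : 0 < E0 := by rw [hE0]; positivity
  obtain ⟨C2, hC2⟩ : ∃ C2, C2 = E0 / c * (1 + 1 / κ2) := ⟨_, rfl⟩
  have hC2p : 0 < C2 := by rw [hC2]; positivity
  have hC2a : E0 ≤ c * C2 := by
    have : c * C2 = E0 + E0 / κ2 := by rw [hC2]; field_simp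
    have : 0 < E0 / κ2 := by positivity
    linarith
  have hC2b : E0 ≤ κ2 * (c * C2) := by
    have : κ2 * (c * C2) = E0 * κ2 + E0 := by rw [hC2]; field_simp
    have : 0 < E0 * κ2 := by positivity
    linarith
  obtain ⟨L, hL⟩ : ∃ L, L = L0 * C2 + C1 / (KM * wt τ0 * cp) := ⟨_, rfl⟩
  have hLa : L0 * C2 ≤ L := by
    have : 0 < C1 / (KM * wt τ0 * cp) := by positivity
    linarith
  have hLb : C1 ≤ KM * L * wt τ0 * cp := by
    have e : KM * L * wt τ0 * cp = KM * (L0 * C2) * wt τ0 * cp + C1 := by rw [hL]; field_simp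
    have : 0 < KM * (L0 * C2) * wt τ0 * cp := by positivity
    linarith
  have hL0p : 0 < L := lt_of_lt_of_le (by positivity) hLa
  obtain ⟨s, hs⟩ : ∃ s, s = min 1 (min (m / (2 * (1 + a))) (m / (2 * (r * (1 + b))))) := ⟨_, rfl⟩
  have hs0 : 0 < s := by rw [hs]; positivity
  have hs1 : s ≤ 1 := hs ▸ min_le_left _ _
  have hs2 : (1 + a) * s ≤ m / 2 := by
    have : s ≤ m / (2 * (1 + a)) := hs ▸ (min_le_right _ _).trans (min_le_left _ _)
    rw [le_div_iff₀ (by positivity)] at this; linarith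
  have hs3 : r * ((1 + b) * s) ≤ m / 2 := by
    have : s ≤ m / (2 * (r * (1 + b))) := hs ▸ (min_le_right _ _).trans (min_le_right _ _)
    rw [le_div_iff₀ (by positivity)] at this; linarith
  obtain ⟨ε, hε⟩ : ∃ ε, ε = min (1 / C1) (min (Λ1 / L) (s / (KM * L * (Cp * exp (δ * XA))))) := ⟨_, rfl⟩
  have hε0 : 0 < ε := by rw [hε]; positivity
  have hε1 : C1 * ε ≤ 1 := by
    have : ε ≤ 1 / C1 := hε ▸ min_le_left _ _
    rw [le_div_iff₀ hC1] at this; linarith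
  have hε2 : L * ε ≤ Λ1 := by
    have : ε ≤ Λ1 / L := hε ▸ (min_le_right _ _).trans (min_le_left _ _)
    rw [le_div_iff₀ hL0p] at this; linarith
  have hε3 : KM * (L * ε) * (Cp * exp (δ * XA)) ≤ s := by
    have : ε ≤ s / (KM * L * (Cp * exp (δ * XA))) := hε ▸ (min_le_right _ _).trans (min_le_right _ _)
    rw [le_div_iff₀ (by positivity)] at this; linarith
  obtain ⟨CA, hCA⟩ : ∃ CA, CA = KM * L * Cp * exp ((γ + δ) * XA) := ⟨_, rfl⟩
  have hCAp : 0 < CA := by rw [hCA]; positivity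
  obtain ⟨CB, hCB⟩ : ∃ CB, CB = C2 + L * (1 + mm * XB) := ⟨_, rfl⟩
  have hCBp : 0 < CB := by rw [hCB]; positivity
  have hw2 := wt_pos (show (0:ℝ) < 2 by norm_num)
  clear hκ0 hs hε hL hC2 hE0p hτ0d hKMd hmm hlm
  have hκ0 : 0 < κ2 := by
    have : 0 < (2 - σ) * γ ^ 2 := mul_pos (by linarith [h.s2]) (by positivity)
    rw [hκ]; positivity
  refine ⟨2 * C1 / wt 2 + 2 * CA + (1 + κ2) * CB, by positivity, ε, hε0, fun B T P Q hPQ hB0 hT n n0 n1 ni ni2 nI hn x => ?_⟩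
  have hW := W0_pos γ δ x
  have hwT := wt_pos (show 0 < 1 + T by linarith)
  have hPi : Integrable (fun y => |P 0 y| + |Q 0 y|) := by
    refine ni.mono' ?_ (Eventually.of_forall fun y => ?_)
    · have c1 := (hPQ.dP 0 ⟨le_rfl, hT⟩).continuous
      have c2 := (hPQ.dQ 0 ⟨le_rfl, hT⟩).continuous
      exact (c1.abs.add c2.abs).aestronglyMeasurable
    · rw [norm_of_nonneg (by positivity)]
      exact (hn y).trans (mul_le_of_le_one_right (n0 y) (W0_le_one hγ hδ y))
  have hN0 : ∀ y, |P 0 y| + |Q 0 y| ≤ ε := fun y =>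
    (hn y).trans ((mul_le_of_le_one_right (n0 y) (W0_le_one hγ hδ y)).trans (n1 y))
  have hsh : ∀ x y, |P 0 y| + |Q 0 y| ≤ ε * W0 γ δ x * exp ((γ + δ) * |x - y|) := fun x y => by
    rw [mul_assoc]
    exact (hn y).trans (mul_le_mul (n1 y) (W0_shift hγ hδ x y) (W0_pos _ _ _).le hε0.le)
  have hx1 : 1 ≤ 1 + |x| := by linarith [abs_nonneg x]
  set D := ε * (1 + |x|) * wt (1 + T) * W0 γ δ x with hD
  have hDp : 0 < D := by rw [hD]; positivity
  rcases le_total T 1 with hT1 | hT1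
  · have := (st1 B T P Q hPQ hB0 hT1 hT hPi ε hN0 hε1).1 T ⟨hT, le_rfl⟩ x (ε * W0 γ δ x) (by positivity) (hsh x)
    have i1 : wt 2 ≤ wt (1 + T) := wt_anti (by linarith) (by linarith)
    have i2 : C1 * (ε * W0 γ δ x) ≤ C1 / wt 2 * D := by
      calc _ = C1 / wt 2 * (ε * 1 * wt 2 * W0 γ δ x) := by field_simp
        _ ≤ _ := by rw [hD]; gcongr
    have i3 : 2 * C1 / wt 2 * D = 2 * (C1 / wt 2 * D) := by ring
    have i4 : 0 < (2 * CA + (1 + κ2) * CB) * D := by positivity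
    linarith
  · obtain ⟨s1a, s1b⟩ := st1 B 1 P Q (hPQ.mono hT1) hB0 le_rfl zero_le_one hPi ε hN0 hε1
    have s1a := fun x => s1a 1 ⟨zero_le_one, le_rfl⟩ x (ε * W0 γ δ x) (mul_nonneg hε0.le (W0_pos _ _ _).le) (hsh x)
    have s1b := s1b rfl
    have hI : ∀ x, (∫ y, (|P 0 y| + |Q 0 y|) * exp (-(x - y) ^ 2 / 32)) ≤
        exp (16 * γ ^ 2) * exp (-γ * x) * ∫ y, n y * exp (-(x - y) ^ 2 / 64) := by
      intro x
      rw [← integral_const_mul]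
      have gb : ∀ k > (0:ℝ), ∀ y, exp (-(x - y) ^ 2 / k) ≤ 1 := fun k hk y =>
        exp_le_one_iff.2 (div_nonpos_of_nonpos_of_nonneg (by linarith [sq_nonneg (x - y)]) hk.le)
      have gi : ∀ k > (0:ℝ), ∀ f : ℝ → ℝ, Integrable f → Integrable (fun y => f y * exp (-(x - y) ^ 2 / k)) := by
        intro k hk f hf
        refine hf.norm.mono' (hf.aestronglyMeasurable.mul (by fun_prop)) (Eventually.of_forall fun y => ?_)
        rw [norm_mul, norm_of_nonneg (exp_pos _).le]
        exact mul_le_of_le_one_right (norm_nonneg _) (gb k hk y)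
      refine integral_mono (gi 32 (by norm_num) _ hPi) ((gi 64 (by norm_num) _ ni).const_mul _) fun y => ?_
      calc _ ≤ n y * W0 γ δ y * exp (-(x - y) ^ 2 / 32) := mnr (hn y) (exp_pos _).le
        _ ≤ n y * exp (-γ * y) * exp (-(x - y) ^ 2 / 32) :=
          mnr (mnl (min_le_left _ _) (n0 y)) (exp_pos _).le
        _ = n y * (exp (-γ * y) * exp (-(x - y) ^ 2 / 32)) := by ring
        _ ≤ n y * _ := mnl (gauss_shift γ x y) (n0 y)
        _ = _ := by ring
    have hΛN : L0 * (C2 * ε) ≤ L * ε := by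
      rw [← mul_assoc]; exact mnr hLa hε0.le
    have hΛ0 : 0 < L * ε := mul_pos hL0p hε0
    have hNΛ : C2 * ε ≤ L * ε := le_trans (le_mul_of_one_le_left (by positivity) hL0) hΛN
    obtain ⟨p, p1, p2, pt, hB⟩ := bs (fun y => C2 * n y) (C2 * ε) (L * ε) (ni.const_mul _) (fun y => mul_nonneg hC2p.le (n0 y))
      (by simpa only [mul_left_comm] using ni2.const_mul C2)
      (by simp only [mul_left_comm _ C2]; rw [integral_const_mul]; exact mnl nI hC2p.le) hΛN hε2
    clear bs
    have τp : ∀ τ ≥ τ0, 0 < wt τ := fun τ h => wt_pos (by linarith)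
    have fB := hA.fP XB ⟨hXBp.le, hXBA.le⟩
    have fA := hA.fP XA ⟨by linarith, le_rfl⟩
    have gB := hA.fQ XB ⟨hXBp.le, hXBA.le⟩
    have gA := hA.fQ XA ⟨by linarith, le_rfl⟩
    have uB := hU1 XB hXB0
    have uA := hU1 XA (by linarith)
    have vB := hV1 XB hXB0
    have vA := hV1 XA (by linarith)
    have hz1 : mm * XB ≤ XB + mm * XB - 1 := by linarith
    have hzA : C2 * ε * XA + L * ε * (XA + mm * XB) ≤ 3 * (L * ε) * XA := by
      have i1 : mm * XB ≤ XA := by rw [hXA]; linarith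
      have i2 := mnr hNΛ (show 0 ≤ XA by linarith)
      have i3 := mnl i1 hΛ0.le
      linarith
    have r1 : 4 * KM * b1 * XB < 1 * (l * (XB + mm * XB - 1)) := by
      have := mul_lt_mul_of_pos_right hm1 hXBp
      have := mnl hz1 hl0.le
      linarith
    have r2 : 4 * KM * b2 * XB < κ2 * (l * (XB + mm * XB - 1)) := by
      have := mul_lt_mul_of_pos_right hm2 hXBp
      have := mnl (mnl hz1 hl0.le) hκ0.le
      linarith
    have lo := hB.lo
    rw [← hl] at lo
    have hXAp : 0 < XA := by linarith
    have res := glueStep h hA hB hκ hXB1 hXBA (by linarith) hτ02 (M := KM * (L * ε)) (by positivity) hε3 hs1 hs2 hs3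
      (fun τ ht => by
        have := cross1 hKM hΛ0 (τp τ ht) (exp_pos (-γ * XB)) hXBp one_pos (fB.2.trans (by linarith [uB.2])) (lo τ ht) r1
        rwa [one_mul] at this)
      (fun τ ht => cross1 hKM hΛ0 (τp τ ht) (exp_pos (-γ * XB)) hXBp hκ0 (gB.2.trans (by linarith [vB.2])) (lo τ ht) r2)
      (fun τ ht => by
        have := cross2 hKM hΛ0 (τp τ ht) (exp_pos (-γ * XA)) hXAp one_pos (le_trans (by linarith [uA.1]) fA.1) (hB.up τ ht XA hXAp.le) hzA hK1
        rwa [one_mul] at this)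
      (fun τ ht => cross2 hKM hΛ0 (τp τ ht) (exp_pos (-γ * XA)) hXAp hκ0 (le_trans (by linarith [vA.1]) gA.1) (hB.up τ ht XA hXAp.le) hzA hK2)
      hPQ hB0
      (fun x hx => by
        have key : ∀ f, cp * exp (δ * x) ≤ f → C1 * (ε * W0 γ δ x) ≤ KM * (L * ε) * wt τ0 * f := by
          intro f hf
          calc _ ≤ C1 * (ε * exp (δ * x)) := by gcongr; exact min_le_right _ _
            _ ≤ (KM * L * wt τ0 * cp) * (ε * exp (δ * x)) := by gcongr
            _ = KM * (L * ε) * wt τ0 * (cp * exp (δ * x)) := by ring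
            _ ≤ _ := by gcongr
        exact ⟨(s1a x).1.trans (key _ (hA.bP x hx).1), (s1a x).2.trans (key _ (hA.bQ x hx).1)⟩)
      (fun x hx => by
        have i1 := hB.ini x (by linarith)
        have i2 : 0 ≤ ∫ y, n y * exp (-(x - y) ^ 2 / 64) :=
          integral_nonneg fun y => mul_nonneg (n0 y) (exp_pos _).le
        simp only [mul_assoc] at i1
        rw [integral_const_mul] at i1
        have i3 := mnl (hI x) hC1.le
        set J := ∫ y, n y * exp (-(x - y) ^ 2 / 64) with hJ
        have i4 : C1 * (exp (16 * γ ^ 2) * exp (-γ * x) * J) = E0 * (exp (-γ * x) * J) := by rw [hE0]; ring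
        rw [i4] at i3
        have i5 : 0 ≤ exp (-γ * x) * J := mul_nonneg (exp_pos _).le i2
        have i6 := mnl i1 (exp_pos (-γ * x)).le
        have i7 := mnr hC2a i5
        have i8 := mnr hC2b i5
        have i9 := mnl i6 hκ0.le
        exact ⟨(s1b x).1.trans (by linarith), (s1b x).2.trans (by linarith)⟩)
      T ⟨hT1, le_rfl⟩ x
    have hwl : wt (T - 1 + τ0) ≤ wt (1 + T) := wt_anti (by linarith) (by linarith)
    have hwp := τp (T - 1 + τ0) (by linarith)
    have kA : x ≤ XA → ∀ f, f ≤ Cp * exp (δ * x) → KM * (L * ε) * wt (T - 1 + τ0) * f ≤ CA * D := by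
      intro hx f hf
      calc _ ≤ KM * (L * ε) * wt (T - 1 + τ0) * (Cp * (exp ((γ + δ) * XA) * W0 γ δ x)) := by
            gcongr; exact hf.trans (by gcongr; exact W0_left hγ hδ hXAp.le hx)
        _ ≤ KM * (L * ε) * wt (1 + T) * (Cp * (exp ((γ + δ) * XA) * W0 γ δ x)) := by gcongr
        _ = CA * (ε * 1 * wt (1 + T) * W0 γ δ x) := by rw [hCA]; ring
        _ ≤ _ := by rw [hD]; gcongr
    have kB : XB ≤ x → exp (-γ * x) * p (T - 1 + τ0) x ≤ CB * D := by
      intro hx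
      have hx0 : 0 ≤ x := by linarith
      have i1 := hB.up (T - 1 + τ0) (by linarith) x hx0
      have i2 : C2 * ε * x + L * ε * (x + mm * XB) ≤ CB * (ε * (1 + |x|)) := by
        rw [abs_of_nonneg hx0, hCB]
        have := mul_pos hC2p hε0
        have := mul_nonneg hΛ0.le (mul_nonneg hmX.le hx0)
        linarith
      rw [← W0_right hγ hδ hx0]
      calc _ ≤ W0 γ δ x * (wt (T - 1 + τ0) * (C2 * ε * x + L * ε * (x + mm * XB))) := by gcongr
        _ ≤ W0 γ δ x * (wt (1 + T) * (CB * (ε * (1 + |x|)))) := by gcongr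
        _ = _ := by rw [hD]; ring
    have j1 : |P T x| ≤ (CA + CB) * D := by
      have := mul_pos hCAp hDp
      have := mul_pos hCBp hDp
      rcases res.1 with ⟨hx, h1⟩ | ⟨hx, h1⟩
      · have := kA hx _ (hA.bP x hx).2
        linarith
      · have := kB hx
        linarith
    have j2 : |Q T x| ≤ (CA + κ2 * CB) * D := by
      have := mul_pos hCAp hDp
      have := mul_pos hκ0 (mul_pos hCBp hDp)
      rcases res.2 with ⟨hx, h1⟩ | ⟨hx, h1⟩
      · have := kA hx _ (hA.bQ x hx).2
        linarith
      · have := mnl (kB hx) hκ0.le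
        linarith
    have j3 : 0 < 2 * C1 / wt 2 * D := by positivity
    linarith

lemma mkPQ {a b σ r γ δ : ℝ} {U V : ℝ → ℝ} (h : Front a b σ r γ δ U V) {B T : ℝ} {u v : ℝ → ℝ → ℝ}
    (cu : ∀ x, ContinuousOn (fun t => u t x) (Icc 0 T)) (cv : ∀ x, ContinuousOn (fun t => v t x) (Icc 0 T))
    (du : ∀ t ∈ Icc 0 T, ContDiff ℝ 2 (u t)) (dv : ∀ t ∈ Icc 0 T, ContDiff ℝ 2 (v t))
    (eu : ∀ t ∈ Ioc 0 T, ∀ x, HasDerivAt (fun s => u s x)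
      (deriv (deriv (u t)) x + 2 * γ * deriv (u t) x + u t x * (1 - u t x - a * v t x)) t)
    (ev : ∀ t ∈ Ioc 0 T, ∀ x, HasDerivAt (fun s => v s x)
      (σ * deriv (deriv (v t)) x + 2 * γ * deriv (v t) x + r * v t x * (1 - b * u t x - v t x)) t)
    (hB0 : 0 ≤ B) (hB : ∀ t ∈ Icc 0 T, ∀ x, |u t x| ≤ B ∧ |v t x| ≤ B) :
    PQ a b σ r (2 * γ) (B + 1) T U V (fun t x => u t x - U x) (fun t x => V x - v t x) := by
  have Ru : ∀ s ∈ Icc 0 T, ∀ x, RC u T s x := by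
    refine RC_all (d := 1) (c := 2 * γ) (B := B) (CF := B * (1 + B + a * B)) (F := fun t x => u t x * (1 - u t x - a * v t x)) one_pos
      ⟨cu, du, fun t ht x => (eu t ht x).congr_deriv (by ring), fun t ht x => (hB t ht x).1, fun t ht x => ?_⟩
    obtain ⟨h1, h2⟩ := hB t (Ioc_subset_Icc_self ht) x
    rw [abs_mul]
    refine mul_le_mul h1 ?_ (abs_nonneg _) hB0
    have h3 := abs_le.1 h1
    have h4 := abs_le.1 h2
    have h5 := mnl h4.1 h.a0.le
    have h6 := mnl h4.2 h.a0.le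
    rw [abs_le]; constructor <;> linarith
  have Rv : ∀ s ∈ Icc 0 T, ∀ x, RC v T s x := by
    refine RC_all (d := σ) (c := 2 * γ) (B := B) (CF := r * B * (1 + b * B + B)) (F := fun t x => r * v t x * (1 - b * u t x - v t x)) h.s0
      ⟨cv, dv, fun t ht x => ev t ht x, fun t ht x => (hB t ht x).2, fun t ht x => ?_⟩
    obtain ⟨h1, h2⟩ := hB t (Ioc_subset_Icc_self ht) x
    have hb : 0 < b := by linarith [h.b1]
    rw [abs_mul, abs_mul, abs_of_pos h.r0]
    refine mul_le_mul (mnl h2 h.r0.le) ?_ (abs_nonneg _) (mul_nonneg h.r0.le hB0)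
    have h3 := abs_le.1 h1
    have h4 := abs_le.1 h2
    have h5 := mnl h3.1 hb.le
    have h6 := mnl h3.2 hb.le
    rw [abs_le]; constructor <;> linarith
  refine ⟨fun x => (cu x).sub continuousOn_const, fun x => continuousOn_const.sub (cv x), fun t ht => (du t ht).sub h.Ur,
    fun t ht => h.Vr.sub (dv t ht), fun t ht x => ?_, fun t ht x => ?_, fun t ht x => ?_, fun t ht x => ?_, fun t ht x => ?_, fun t ht x => ?_⟩
  · have hd := du t (Ioc_subset_Icc_self ht)
    have e1 : deriv (fun x => u t x - U x) = fun x => deriv (u t) x - deriv U x :=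
      funext fun y => ((cd2_d1 hd y).sub (cd2_d1 h.Ur y)).deriv
    have e2 : deriv (deriv (fun x => u t x - U x)) x = deriv (deriv (u t)) x - deriv (deriv U) x := by
      rw [e1]; exact ((cd2_d2 hd x).sub (cd2_d2 h.Ur x)).deriv
    refine ((eu t ht x).sub_const (U x)).congr_deriv ?_
    rw [e2, e1]
    linear_combination h.Uo x
  · have hd := dv t (Ioc_subset_Icc_self ht)
    have e1 : deriv (fun x => V x - v t x) = fun x => deriv V x - deriv (v t) x :=
      funext fun y => ((cd2_d1 h.Vr y).sub (cd2_d1 hd y)).deriv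
    have e2 : deriv (deriv (fun x => V x - v t x)) x = deriv (deriv V) x - deriv (deriv (v t)) x := by
      rw [e1]; exact ((cd2_d2 h.Vr x).sub (cd2_d2 hd x)).deriv
    refine ((ev t ht x).const_sub (V x)).congr_deriv ?_
    rw [e2, e1]
    linear_combination - h.Vo x
  · have := abs_le.1 (hB t ht x).1
    rw [abs_le]; constructor <;> linarith [(h.U01 x).1, (h.U01 x).2]
  · have := abs_le.1 (hB t ht x).2
    rw [abs_le]; constructor <;> linarith [(h.V01 x).1, (h.V01 x).2]
  · exact ContinuousWithinAt.sub (Ru t ht x) (h.Ur.continuous.comp continuous_snd).continuousWithinAt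
  · exact ContinuousWithinAt.sub (h.Vr.continuous.comp continuous_snd).continuousWithinAt (Rv t ht x)

lemma om_comp {γ δ : ℝ} (hγ : 0 < γ) (hδ : 0 < δ) {ω : ℝ → ℝ} (hc : Continuous ω) (hp : ∀ x, 0 < ω x)
    (hr : ∀ x ≥ (1:ℝ), ω x = exp (-γ * x)) (hl : ∀ x ≤ (-1:ℝ), ω x = exp (δ * x)) :
    ∃ c1 > 0, ∃ c2 > 0, ∀ x, c1 * W0 γ δ x ≤ ω x ∧ ω x ≤ c2 * W0 γ δ x := by
  have hW : Continuous (W0 γ δ) := by unfold W0; fun_prop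
  have hq : Continuous (fun x => ω x / W0 γ δ x) := hc.div hW fun x => (W0_pos _ _ _).ne'
  obtain ⟨x1, -, h1⟩ := isCompact_Icc.exists_isMinOn (s := Icc (-1:ℝ) 1) ⟨0, by norm_num⟩ hq.continuousOn
  obtain ⟨x2, -, h2⟩ := isCompact_Icc.exists_isMaxOn (s := Icc (-1:ℝ) 1) ⟨0, by norm_num⟩ hq.continuousOn
  have p1 := div_pos (hp x1) (W0_pos γ δ x1)
  refine ⟨min 1 (ω x1 / W0 γ δ x1), lt_min one_pos p1, max 1 (ω x2 / W0 γ δ x2), lt_max_of_lt_left one_pos, fun x => ?_⟩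
  have hw := W0_pos γ δ x
  have key : (x ≤ -1 ∨ 1 ≤ x) → ω x = W0 γ δ x := by
    rintro (hx | hx)
    · rw [hl x hx]
      refine le_antisymm ?_ (min_le_right _ _)
      have := W0_left (X := 0) hγ hδ le_rfl (show x ≤ 0 by linarith)
      simpa using this
    · rw [hr x hx, W0_right hγ hδ (by linarith)]
  by_cases hx : x ∈ Icc (-1:ℝ) 1
  · have a1 := h1 hx
    have a2 := h2 hx
    simp only [mem_setOf_eq] at a1 a2
    exact ⟨(le_div_iff₀ hw).1 ((min_le_right _ _).trans a1), (div_le_iff₀ hw).1 (a2.trans (le_max_right _ _))⟩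
  · have : ω x = W0 γ δ x := by
      apply key
      rw [mem_Icc, not_and_or, not_le, not_le] at hx
      exact hx.imp le_of_lt le_of_lt
    rw [this]
    constructor
    · calc _ ≤ 1 * W0 γ δ x := by gcongr; exact min_le_left _ _
        _ = _ := one_mul _
    · calc _ = 1 * W0 γ δ x := (one_mul _).symm
        _ ≤ _ := by gcongr; exact le_max_left _ _

lemma ev_up {γ k : ℝ} {f : ℝ → ℝ} (hγ : 0 < γ) (hk : 0 < k) (h : Tendsto (fun x => exp (γ * x) * f x / x) atTop (𝓝 k)) :
    ∀ᶠ x in atTop, k / 2 * (x * exp (-γ * x)) ≤ f x ∧ f x ≤ 2 * k * (x * exp (-γ * x)) := by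
  filter_upwards [h.eventually_const_lt (show k / 2 < k by linarith), h.eventually_lt_const (show k < 2 * k by linarith),
    eventually_gt_atTop 0] with x h1 h2 h3
  have e : f x = exp (γ * x) * f x / x * (x * exp (-γ * x)) := by
    have : exp (γ * x) * exp (-γ * x) = 1 := by rw [← exp_add]; simp
    rw [div_mul_eq_mul_div, eq_div_iff h3.ne']
    linear_combination (- f x * x) * this
  have h4 : 0 < x * exp (-γ * x) := by positivity
  constructor
  · rw [e]; exact mnr h1.le h4.le
  · rw [e]; exact mnr h2.le h4.le

lemma ev_up0 {γ k : ℝ} {f : ℝ → ℝ} (hγ : 0 < γ) (hk : 0 < k) (h : Tendsto (fun x => exp (γ * x) * f x / x) atTop (𝓝 k)) :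
    ∀ᶠ x in atTop, f x ≤ 4 * k / γ * exp (-(γ * x / 2)) := by
  filter_upwards [ev_up hγ hk h] with x h1
  have h2 := xexp (x := x) (show 0 < γ / 2 by linarith)
  calc _ ≤ _ := h1.2
    _ = 2 * k * (x * exp (-(γ / 2 * x))) * exp (-(γ * x / 2)) := by
      rw [mul_assoc (2 * k), mul_assoc x, ← exp_add]; ring_nf
    _ ≤ 2 * k * (1 / (γ / 2)) * exp (-(γ * x / 2)) := by gcongr
    _ = _ := by field_simp; ring

lemma wt_rpow {t : ℝ} (ht : 0 < t) : t ^ ((3:ℝ) / 2) = (wt t)⁻¹ := by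
  unfold wt
  rw [inv_inv, show (3:ℝ) / 2 = 1 + 1 / 2 by norm_num, Real.rpow_add ht, Real.rpow_one, Real.sqrt_eq_rpow]

lemma d1d2 {γ δ s K : ℝ} (hγ : 0 < γ) (hδ : 0 < δ) (hs : 0 < s) (h : δ < (-γ + √(γ ^ 2 + s * K)) / s) (hK : 0 < K) :
    s * δ ^ 2 + 2 * γ * δ < K := by
  rw [lt_div_iff₀ hs] at h
  have h1 : γ + δ * s < √(γ ^ 2 + s * K) := by linarith
  rw [Real.lt_sqrt (by positivity)] at h1
  have h2 : s * (s * δ ^ 2 + 2 * γ * δ) < s * K := by nlinarith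
  exact lt_of_mul_lt_mul_left h2 hs.le

end

open MeasureTheory Filter

/-- Nonlinear asymptotic stability of the critical pulled front of the
Lotka-Volterra competition system with algebraic rate `t^{-3/2}`:
small perturbations of the front, measured in the exponentially weighted
variables `p = (u - U*)/ω`, `q = (v - V*)/ω`, decay like `(1+|x|)(1+t)^{-3/2}`. -/
theorem critical_front_nonlinear_stability
    -- parameters
    (a b σ r : ℝ)
    (ha0 : 0 < a) (ha1 : a < 1) (hb : 1 < b) (hr : 0 < r)
    (hσ0 : 0 < σ) (hσ2 : σ < 2)
    (hpar : (a * b - max 1 (2 * (1 - a))) * r ≤ max 1 (2 * (1 - a)) * (2 - σ) * (1 - a))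
    (γ c δ : ℝ)
    (hγ : γ = Real.sqrt (1 - a)) (hc : c = 2 * γ)
    (hδ0 : 0 < δ)
    (hδ : δ < min (-γ + Real.sqrt (γ ^ 2 + 1))
        ((-γ + Real.sqrt (γ ^ 2 + σ * r * (b - 1))) / σ))
    -- the weight
    (ω : ℝ → ℝ) (hωsmooth : ContDiff ℝ (⊤ : ℕ∞) ω) (hωpos : ∀ x, 0 < ω x)
    (hωright : ∀ x ≥ (1:ℝ), ω x = Real.exp (-γ * x))
    (hωleft : ∀ x ≤ (-1:ℝ), ω x = Real.exp (δ * x))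
    -- the critical pulled front
    (U V : ℝ → ℝ) (hUreg : ContDiff ℝ 2 U) (hVreg : ContDiff ℝ 2 V)
    (hUode : ∀ x, deriv (deriv U) x + c * deriv U x + U x * (1 - U x - a * V x) = 0)
    (hVode : ∀ x, σ * deriv (deriv V) x + c * deriv V x + r * V x * (1 - b * U x - V x) = 0)
    (hlimbot : Tendsto (fun x => (U x, V x)) atBot (nhds (1, 0)))
    (hlimtop : Tendsto (fun x => (U x, V x)) atTop (nhds (0, 1)))
    (hU01 : ∀ x, 0 < U x ∧ U x < 1) (hV01 : ∀ x, 0 < V x ∧ V x < 1)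
    (hUdec : ∀ x, deriv U x < 0) (hVinc : ∀ x, 0 < deriv V x)
    -- weak exponential asymptotics of the front at +∞
    (hasymp : ∃ β₁ β₂ : ℝ, 0 < β₁ ∧ 0 < β₂ ∧
      Tendsto (fun x => Real.exp (γ * x) * U x / x) atTop (nhds β₁) ∧
      Tendsto (fun x => Real.exp (γ * x) * (1 - V x) / x) atTop (nhds β₂) ∧
      Tendsto (fun x => Real.exp (γ * x) * (-deriv U x) / x) atTop (nhds (γ * β₁)) ∧
      Tendsto (fun x => Real.exp (γ * x) * deriv V x / x) atTop (nhds (γ * β₂))) :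
    ∃ C > (0:ℝ), ∃ ε > (0:ℝ),
      ∀ T : ENNReal, 0 < T →
      ∀ u v : ℝ → ℝ → ℝ,
      -- continuity in time up to t = 0
      (∀ x : ℝ, ContinuousOn (fun t => u t x) {t : ℝ | 0 ≤ t ∧ ENNReal.ofReal t < T}) →
      (∀ x : ℝ, ContinuousOn (fun t => v t x) {t : ℝ | 0 ≤ t ∧ ENNReal.ofReal t < T}) →
      -- C² regularity in space
      (∀ t : ℝ, 0 ≤ t → ENNReal.ofReal t < T → ContDiff ℝ 2 (fun y => u t y)) →
      (∀ t : ℝ, 0 ≤ t → ENNReal.ofReal t < T → ContDiff ℝ 2 (fun y => v t y)) →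
      -- the PDE (C¹ in time on (0, T))
      (∀ t : ℝ, 0 < t → ENNReal.ofReal t < T → ∀ x : ℝ,
        HasDerivAt (fun s => u s x)
          (deriv (deriv (fun y => u t y)) x + c * deriv (fun y => u t y) x
            + u t x * (1 - u t x - a * v t x)) t) →
      (∀ t : ℝ, 0 < t → ENNReal.ofReal t < T → ∀ x : ℝ,
        HasDerivAt (fun s => v s x)
          (σ * deriv (deriv (fun y => v t y)) x + c * deriv (fun y => v t y) x
            + r * v t x * (1 - b * u t x - v t x)) t) →
      -- boundedness of the solution
      (∃ B : ℝ, ∀ t x : ℝ, 0 ≤ t → ENNReal.ofReal t < T → |u t x| ≤ B ∧ |v t x| ≤ B) →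
      -- initial datum between 0 and 1
      (∀ x : ℝ, 0 ≤ u 0 x ∧ u 0 x ≤ 1) →
      (∀ x : ℝ, 0 ≤ v 0 x ∧ v 0 x ≤ 1) →
      -- smallness of the initial weighted perturbation
      ∀ p₀ q₀ : ℝ → ℝ,
      (∀ x, p₀ x = (u 0 x - U x) / ω x) →
      (∀ x, q₀ x = (v 0 x - V x) / ω x) →
      BddAbove (Set.range fun x => |p₀ x| + |q₀ x|) →
      Integrable (fun y => (1 + |y|) * (|p₀ y| + |q₀ y|)) →
      (⨆ x : ℝ, (|p₀ x| + |q₀ x|)) + (∫ y : ℝ, (1 + |y|) * (|p₀ y| + |q₀ y|)) < ε →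
      -- conclusion: algebraic decay of the weighted perturbation
      ∀ t x : ℝ, 0 < t → ENNReal.ofReal t < T →
        (|(u t x - U x) / ω x| + |(v t x - V x) / ω x|) / (1 + |x|)
          ≤ C * ε / (1 + t) ^ ((3 : ℝ) / 2) := by
  subst hc
  have hγ0 : 0 < γ := by rw [hγ]; exact Real.sqrt_pos.2 (by linarith)
  have hγ2 : γ ^ 2 = 1 - a := by rw [hγ]; exact Real.sq_sqrt (by linarith)
  obtain ⟨β1, β2, hβ1, hβ2, t1, t2, t3, t4⟩ := hasymp
  have hF : Front a b σ r γ δ U V :=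
    { a0 := ha0, a1 := ha1, b1 := hb, s0 := hσ0, s2 := hσ2, r0 := hr, g0 := hγ0, g2 := hγ2, d0 := hδ0
      d1 := by
        have := d1d2 (s := 1) (K := 1) hγ0 hδ0 one_pos (by
          rw [div_one, mul_one]; exact hδ.trans_le (min_le_left _ _)) one_pos
        linarith
      d2 := d1d2 hγ0 hδ0 hσ0 (by
          rw [← mul_assoc]; exact hδ.trans_le (min_le_right _ _)) (mul_pos hr (by linarith))
      Ur := hUreg, Vr := hVreg, Uo := hUode, Vo := hVode
      Ub := (continuous_fst.tendsto ((1:ℝ), (0:ℝ))).comp hlimbot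
      Vb := (continuous_snd.tendsto ((1:ℝ), (0:ℝ))).comp hlimbot
      U01 := hU01, V01 := hV01, Ud := hUdec, Vd := hVinc }
  obtain ⟨X0, hX0⟩ := eventually_atTop.1 ((ev_up0 hγ0 hβ1 t1).and ((ev_up0 hγ0 hβ2 t2).and
    ((ev_up hγ0 (mul_pos hγ0 hβ1) t3).and (ev_up hγ0 (mul_pos hγ0 hβ2) t4))))
  have q1 : 0 < 4 * β1 / γ := by positivity
  have q2 : 0 < 4 * β2 / γ := by positivity
  obtain ⟨C, hC, ε, hε, key⟩ := core hF (X0 := X0) (C0 := 4 * β1 / γ + 4 * β2 / γ) (by positivity)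
    (mul_pos hγ0 hβ1) (mul_pos hγ0 hβ2)
    (fun x hx => (hX0 x hx).1.trans (mul_le_mul_of_nonneg_right (by linarith) (Real.exp_pos _).le))
    (fun x hx => (hX0 x hx).2.1.trans (mul_le_mul_of_nonneg_right (by linarith) (Real.exp_pos _).le))
    (fun x hx => (hX0 x hx).2.2.1) (fun x hx => (hX0 x hx).2.2.2)
  obtain ⟨c1, hc1, c2, hc2, hcc⟩ := om_comp hγ0 hδ0 hωsmooth.continuous hωpos hωright hωleft
  refine ⟨C * c2 / c1, by positivity, ε / c2, by positivity, ?_⟩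
  intro T hT u v cu cv du dv eu ev hB hu0 hv0 p₀ q₀ hp hq hbd hint hsm t x ht htT
  have hlt : ∀ s ∈ Set.Icc 0 t, ENNReal.ofReal s < T := fun s hs => (ENNReal.ofReal_le_ofReal hs.2).trans_lt htT
  obtain ⟨B, hB⟩ := hB
  have h00 : (0:ℝ) ∈ Set.Icc 0 t := ⟨le_rfl, ht.le⟩
  have hB0 : 0 ≤ B := (abs_nonneg _).trans (hB 0 0 le_rfl (hlt 0 h00)).1
  have hPQ := mkPQ hF (B := B) (T := t) (u := u) (v := v)
    (fun x => (cu x).mono fun s hs => ⟨hs.1, hlt s hs⟩) (fun x => (cv x).mono fun s hs => ⟨hs.1, hlt s hs⟩)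
    (fun s hs => du s hs.1 (hlt s hs)) (fun s hs => dv s hs.1 (hlt s hs))
    (fun s hs x => eu s hs.1 (hlt s ⟨hs.1.le, hs.2⟩) x) (fun s hs x => ev s hs.1 (hlt s ⟨hs.1.le, hs.2⟩) x) hB0
    (fun s hs x => hB s x hs.1 (hlt s hs))
  have hn0 : ∀ y, 0 ≤ |p₀ y| + |q₀ y| := fun y => by positivity
  have hI0 : 0 ≤ ∫ y : ℝ, (1 + |y|) * (|p₀ y| + |q₀ y|) := integral_nonneg fun y => by positivity
  have hle : ∀ y, |p₀ y| + |q₀ y| ≤ ⨆ x : ℝ, (|p₀ x| + |q₀ x|) := fun y => le_ciSup hbd y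
  have hS0 := (hn0 0).trans (hle 0)
  have pc : Continuous p₀ := by
    rw [funext hp]
    exact ((du 0 le_rfl (hlt 0 h00)).continuous.sub hUreg.continuous).div hωsmooth.continuous fun x => (hωpos x).ne'
  have qc : Continuous q₀ := by
    rw [funext hq]
    exact ((dv 0 le_rfl (hlt 0 h00)).continuous.sub hVreg.continuous).div hωsmooth.continuous fun x => (hωpos x).ne'
  have hni : Integrable (fun y => |p₀ y| + |q₀ y|) := by
    refine hint.mono' (pc.abs.add qc.abs).aestronglyMeasurable (Eventually.of_forall fun y => ?_)
    rw [Real.norm_of_nonneg (hn0 y)]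
    exact le_mul_of_one_le_left (hn0 y) (by linarith [abs_nonneg y])
  have efn : (fun y => (1 + |y|) * (c2 * (|p₀ y| + |q₀ y|))) = fun y => c2 * ((1 + |y|) * (|p₀ y| + |q₀ y|)) := by
    funext y; ring
  have hce : c2 * (ε / c2) = ε := by field_simp
  have fin := key (B + 1) t _ _ hPQ (by linarith) ht.le (fun y => c2 * (|p₀ y| + |q₀ y|))
    (fun y => mul_nonneg hc2.le (hn0 y))
    (fun y => by
      calc _ ≤ c2 * (ε / c2) := by
            refine mul_le_mul_of_nonneg_left ?_ hc2.le
            linarith [hle y]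
        _ = ε := hce)
    (hni.const_mul c2)
    (by rw [efn]; exact hint.const_mul c2)
    (by
      rw [efn, integral_const_mul]
      calc _ ≤ c2 * (ε / c2) := by
            refine mul_le_mul_of_nonneg_left ?_ hc2.le
            linarith
        _ = ε := hce)
    (fun y => by
      have e1 : |u 0 y - U y| = |p₀ y| * ω y := by
        rw [hp, abs_div, abs_of_pos (hωpos y), div_mul_cancel₀ _ (hωpos y).ne']
      have e2 : |V y - v 0 y| = |q₀ y| * ω y := by
        rw [hq, abs_div, abs_of_pos (hωpos y), div_mul_cancel₀ _ (hωpos y).ne', abs_sub_comm]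
      rw [e1, e2, ← add_mul, mul_comm c2, mul_assoc]
      exact mul_le_mul_of_nonneg_left (hcc y).2 (hn0 y))
    x
  have hx : 0 < 1 + |x| := by positivity
  have h1t : 0 < 1 + t := by linarith
  have hw := wt_pos h1t
  rw [abs_div, abs_div, abs_of_pos (hωpos x), ← add_div, abs_sub_comm (v t x), wt_rpow h1t, div_inv_eq_mul,
    div_le_iff₀ hx, div_le_iff₀ (hωpos x)]
  refine fin.trans ?_
  calc _ = C * ε / c1 * wt (1 + t) * (1 + |x|) * (c1 * W0 γ δ x) := by field_simp
    _ ≤ C * ε / c1 * wt (1 + t) * (1 + |x|) * ω x := mul_le_mul_of_nonneg_left (hcc x).1 (by positivity)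
    _ = _ := by field_simp
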